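/- For every real number r, the set of integers D < 0 with D ≡ 0 or 1 (mod 4) for which there exist a primitive positive definite integral binary quadratic form f of discriminant D and a real number C with B_f(x)·√(log x)/x → C as x → ∞ and (√|D|/2)·C < r, is finite. -/

import Mathlib

open Filter Real

/-- The number of positive integers `n ≤ x` represented by the integral binary quadratic
form `a X² + b X Y + c Y²`. -/
noncomputable def Bcount (a b c : ℤ) (x : ℝ) : ℕ :=
  Set.ncard {n : ℕ | 0 < n ∧ (n : ℝ) ≤ x ∧ ∃ u v : ℤ, (n : ℤ) = a * u ^ 2 + b * u * v + c * v ^ 2}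

/-- `(a, b, c)` are the coefficients of a primitive positive definite form of discriminant `-Δ`. -/
structure IsPrimPosForm (Δ a b c : ℤ) : Prop where
  pos : 0 < a
  disc : 4 * a * c - b ^ 2 = Δ
  prim : ∀ q : ℕ, q.Prime → ¬((q : ℤ) ∣ a ∧ (q : ℤ) ∣ b ∧ (q : ℤ) ∣ c)

/-- The positive integer `n` is represented by the form with coefficients `(a, b, c)`. -/
def Represents (a b c : ℤ) (n : ℕ) : Prop :=
  0 < n ∧ ∃ u v : ℤ, (n : ℤ) = a * u ^ 2 + b * u * v + c * v ^ 2

theorem isPrimPosForm_of_gcd {a b c : ℤ} (ha : 0 < a) (h : Int.gcd (Int.gcd a b) c = 1) :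
    IsPrimPosForm (4 * a * c - b ^ 2) a b c := by
  refine ⟨ha, rfl, fun q hq ⟨h1, h2, h3⟩ => hq.one_lt.ne' ?_⟩
  have h4 : (q : ℤ) ∣ (Int.gcd (Int.gcd a b) c : ℤ) :=
    Int.dvd_coe_gcd (Int.dvd_coe_gcd h1 h2) h3
  rw [h] at h4
  exact Nat.dvd_one.mp (by exact_mod_cast h4)

theorem IsPrimPosForm.translate {Δ a b c : ℤ} (h : IsPrimPosForm Δ a b c) (k : ℤ) :
    IsPrimPosForm Δ a (b + 2 * a * k) (a * k ^ 2 + b * k + c) := by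
  refine ⟨h.pos, by rw [← h.disc]; ring, fun q hq ⟨h1, h2, h3⟩ => h.prim q hq ⟨h1, ?_, ?_⟩⟩
  · have := dvd_sub h2 ((h1.mul_left 2).mul_right k)
    simpa using this
  · have hb : (q : ℤ) ∣ b := by
      have := dvd_sub h2 ((h1.mul_left 2).mul_right k)
      simpa using this
    have := dvd_sub h3 (dvd_add (h1.mul_right (k ^ 2)) (hb.mul_right k))
    simpa using this

theorem Represents.of_translate {a b c : ℤ} (k : ℤ) {n : ℕ}
    (h : Represents a (b + 2 * a * k) (a * k ^ 2 + b * k + c) n) : Represents a b c n := by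
  obtain ⟨hn, u, v, huv⟩ := h
  exact ⟨hn, u + k * v, v, by rw [huv]; ring⟩

theorem IsPrimPosForm.pos_right {Δ a b c : ℤ} (hΔ : 0 < Δ) (h : IsPrimPosForm Δ a b c) :
    0 < c := by
  have h1 := h.disc
  have h2 := h.pos
  by_contra hc
  nlinarith [sq_nonneg b]

theorem IsPrimPosForm.swap {Δ a b c : ℤ} (hΔ : 0 < Δ) (h : IsPrimPosForm Δ a b c) :
    IsPrimPosForm Δ c (-b) a := by
  refine ⟨h.pos_right hΔ, by rw [← h.disc]; ring, fun q hq ⟨h1, h2, h3⟩ => ?_⟩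
  exact h.prim q hq ⟨h3, (dvd_neg.mp h2), h1⟩

theorem Represents.of_swap {a b c : ℤ} {n : ℕ} (h : Represents c (-b) a n) :
    Represents a b c n := by
  obtain ⟨hn, u, v, huv⟩ := h
  exact ⟨hn, -v, u, by rw [huv]; ring⟩

theorem IsPrimPosForm.exists_reduced {Δ a b c : ℤ} (hΔ : 0 < Δ) (h : IsPrimPosForm Δ a b c) :
    ∃ a' b' c' : ℤ, IsPrimPosForm Δ a' b' c' ∧ |b'| ≤ a' ∧ a' ≤ c' ∧
      ∀ n, Represents a' b' c' n → Represents a b c n := by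
  induction hm : a.toNat using Nat.strong_induction_on generalizing a b c with
  | _ m ih =>
    have ha := h.pos
    set k : ℤ := -((b + a) / (2 * a)) with hk
    have h1 := h.translate k
    have hb : |b + 2 * a * k| ≤ a := by
      have e := Int.mul_ediv_add_emod (b + a) (2 * a)
      have p1 := Int.emod_nonneg (b + a) (show 2 * a ≠ 0 by lia)
      have p2 := Int.emod_lt_of_pos (b + a) (show 0 < 2 * a by lia)
      have : b + 2 * a * k = (b + a) % (2 * a) - a := by rw [hk]; linarith
      rw [this, abs_le]
      constructor <;> linarith
    rcases le_or_gt a (a * k ^ 2 + b * k + c) with hac | hac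
    · exact ⟨_, _, _, h1, hb, hac, fun n hn => hn.of_translate k⟩
    · have h2 := h1.swap hΔ
      have h3 := h2.pos
      obtain ⟨a', b', c', hf, hb', hac', hr⟩ := ih _ (by lia) h2 rfl
      exact ⟨a', b', c', hf, hb', hac', fun n hn => ((hr n hn).of_swap).of_translate k⟩

/-- If the odd prime `p` splits, then `p` times any number represented by a suitable form `g`
of the same discriminant is represented by the given form. -/
theorem IsPrimPosForm.exists_prime_mul {Δ a b c : ℤ} (hΔ : 0 < Δ) (h : IsPrimPosForm Δ a b c)
    {p : ℕ} (hp : p.Prime) (hp2 : p ≠ 2) (hs : jacobiSym (-Δ) p = 1) :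
    ∃ a' b' c' : ℤ, IsPrimPosForm Δ a' b' c' ∧
      ∀ n, Represents a' b' c' n → Represents a b c (p * n) := by
  have : Fact p.Prime := ⟨hp⟩
  have hleg : legendreSym p (-Δ) = 1 := by rwa [jacobiSym.legendreSym.to_jacobiSym]
  have hpΔ : ¬ (p : ℤ) ∣ Δ := by
    intro hd
    have : ((-Δ : ℤ) : ZMod p) = 0 := by
      rw [ZMod.intCast_zmod_eq_zero_iff_dvd]
      exact (dvd_neg.mpr hd)
    rw [(legendreSym.eq_zero_iff p (-Δ)).mpr this] at hleg
    exact absurd hleg (by norm_num)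
  suffices H : ∀ a b c : ℤ, IsPrimPosForm Δ a b c → (p : ℤ) ∣ a →
      ∃ a' b' c' : ℤ, IsPrimPosForm Δ a' b' c' ∧
        ∀ n, Represents a' b' c' n → Represents a b c (p * n) by
    by_cases hpa : (p : ℤ) ∣ a
    · exact H a b c h hpa
    have hne : ((-Δ : ℤ) : ZMod p) ≠ 0 := by
      rw [Ne, ZMod.intCast_zmod_eq_zero_iff_dvd]
      exact fun hd => hpΔ (dvd_neg.mp hd)
    obtain ⟨r, hr⟩ := (legendreSym.eq_one_iff p hne).mp hleg
    have h2a : (2 * (a : ZMod p)) ≠ 0 := by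
      have : ((2 * a : ℤ) : ZMod p) ≠ 0 := by
        rw [Ne, ZMod.intCast_zmod_eq_zero_iff_dvd]
        intro hd
        rcases (Nat.prime_iff_prime_int.mp hp).dvd_or_dvd hd with h' | h'
        · have : p ∣ 2 := by exact_mod_cast h'
          exact hp2 ((Nat.prime_dvd_prime_iff_eq hp Nat.prime_two).mp this)
        · exact hpa h'
      simpa using this
    obtain ⟨u, hu⟩ := ZMod.intCast_surjective ((r - (b : ZMod p)) / (2 * (a : ZMod p)))
    have hdiv : (p : ℤ) ∣ a * u ^ 2 + b * u + c := by
      rw [← ZMod.intCast_zmod_eq_zero_iff_dvd]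
      have e1 : 2 * (a : ZMod p) * u + b = r := by
        rw [hu, mul_div_cancel₀ _ h2a]; ring
      have e2 : ((4 * a * (a * u ^ 2 + b * u + c) : ℤ) : ZMod p)
          = (2 * (a : ZMod p) * u + b) ^ 2 - ((-Δ : ℤ) : ZMod p) := by
        rw [← h.disc]; push_cast; ring
      rw [e1, hr] at e2
      have e3 : (2 * (a : ZMod p)) * (2 * ((a * u ^ 2 + b * u + c : ℤ) : ZMod p)) = 0 := by
        have : (2 * (a : ZMod p)) * (2 * ((a * u ^ 2 + b * u + c : ℤ) : ZMod p)) =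
          ((4 * a * (a * u ^ 2 + b * u + c) : ℤ) : ZMod p) := by push_cast; ring
        rw [this, e2]; ring
      have e4 := (mul_eq_zero.mp e3).resolve_left h2a
      exact (mul_eq_zero.mp e4).resolve_left (left_ne_zero_of_mul h2a)
    have h1 := (h.translate u).swap hΔ
    obtain ⟨a', b', c', hf, hr'⟩ := H _ _ _ h1 hdiv
    exact ⟨a', b', c', hf, fun n hn => ((hr' n hn).of_swap).of_translate u⟩
  rintro a b c h ⟨a₁, rfl⟩
  have hp0 : (0 : ℤ) < p := by exact_mod_cast hp.pos
  refine ⟨a₁, b, p * c, ⟨pos_of_mul_pos_right h.pos hp0.le, by rw [← h.disc]; ring, ?_⟩, ?_⟩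
  · rintro q hq ⟨h1, h2, h3⟩
    by_cases hqp : q = p
    · subst hqp
      apply hpΔ
      rw [← h.disc]
      exact dvd_sub (Dvd.intro (4 * a₁ * c) (by ring)) (dvd_pow h2 two_ne_zero)
    · rcases (Nat.prime_iff_prime_int.mp hq).dvd_or_dvd h3 with h' | h'
      · exact hqp ((Nat.prime_dvd_prime_iff_eq hq hp).mp (by exact_mod_cast h'))
      · exact h.prim q hq ⟨h1.mul_left _, h2, h'⟩
  · rintro n ⟨hn, u, v, huv⟩
    exact ⟨Nat.mul_pos hp.pos hn, u, p * v, by push_cast; rw [huv]; ring⟩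

theorem sum_one_div_sq_add_sq_le {y : ℝ} (hy : 0 < y) (n : ℕ) :
    ∑ i ∈ Finset.range n, 1 / (((i : ℝ) + 1) ^ 2 + y ^ 2) ≤ 2 / y := by
  have key : ∑ i ∈ Finset.range n, 1 / (((i : ℝ) + 1) ^ 2 + y ^ 2) ≤ 2 / y - 2 / (y + n) := by
    induction n with
    | zero => simp
    | succ n ih =>
      rw [Finset.sum_range_succ]
      have h1 : (1 : ℝ) / (((n : ℝ) + 1) ^ 2 + y ^ 2) ≤ 2 / (y + n) - 2 / (y + (n + 1 : ℕ)) := by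
        have hn : (0 : ℝ) ≤ n := n.cast_nonneg
        rw [div_sub_div _ _ (by positivity) (by positivity), div_le_div_iff₀ (by positivity)
          (by positivity)]
        push_cast
        nlinarith [sq_nonneg ((n : ℝ) + 1 - y)]
      linarith
  have : (0 : ℝ) ≤ 2 / (y + n) := by positivity
  linarith

theorem sum_one_div_mul_sq_add_sq_le {B y : ℝ} (hB : 0 < B) (hy : 0 < y) (t : Finset ℕ) :
    ∑ j ∈ t, 1 / (B ^ 2 * (j : ℝ) ^ 2 + y ^ 2) ≤ 1 / y ^ 2 + 2 / (B * y) := by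
  have h1 : t ⊆ Finset.range (t.sup id + 1) := fun j hj =>
    Finset.mem_range.mpr (Nat.lt_succ_of_le (Finset.le_sup (f := id) hj))
  refine (Finset.sum_le_sum_of_subset_of_nonneg h1 fun _ _ _ => by positivity).trans ?_
  rw [Finset.sum_range_succ', add_comm]
  refine add_le_add (by simp) ?_
  have h2 := sum_one_div_sq_add_sq_le (y := y / B) (by positivity) (t.sup id)
  have h3 : ∀ i : ℕ, 1 / (B ^ 2 * ((i + 1 : ℕ) : ℝ) ^ 2 + y ^ 2) =
      (1 / B ^ 2) * (1 / (((i : ℝ) + 1) ^ 2 + (y / B) ^ 2)) := by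
    intro i; push_cast; field_simp
  simp_rw [h3, ← Finset.mul_sum]
  calc _ ≤ 1 / B ^ 2 * (2 / (y / B)) := by gcongr
    _ = _ := by field_simp

theorem sum_residueClass_nonneg_le {a y : ℝ} (ha : 0 < a) (hy : 0 < y) {E : ℤ} (hE : 0 < E)
    (s : Finset ℤ) (h0 : ∀ u ∈ s, 0 ≤ u) (hs : ∀ u ∈ s, ∀ u' ∈ s, E ∣ u - u') :
    ∑ u ∈ s, 1 / (a * (u : ℝ) ^ 2 + y ^ 2) ≤ 1 / y ^ 2 + 2 / (√a * E * y) := by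
  have hE' : (0 : ℝ) < E := by exact_mod_cast hE
  have hinj : Set.InjOn (fun u : ℤ => (u / E).toNat) s := by
    intro u hu u' hu' huu
    have n1 := Int.ediv_nonneg (h0 u hu) hE.le
    have n2 := Int.ediv_nonneg (h0 u' hu') hE.le
    have h1 : u / E = u' / E := by
      have : (u / E).toNat = (u' / E).toNat := huu
      lia
    have h2 : u % E = u' % E := Int.emod_eq_emod_iff_emod_sub_eq_zero.mpr
      (Int.emod_eq_zero_of_dvd (hs u hu u' hu'))
    rw [← Int.mul_ediv_add_emod u E, ← Int.mul_ediv_add_emod u' E, h1, h2]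
  have h1 := sum_one_div_mul_sq_add_sq_le (B := √a * E) (by positivity) hy
    (s.image fun u : ℤ => (u / E).toNat)
  rw [Finset.sum_image hinj] at h1
  refine le_trans (Finset.sum_le_sum fun u hu => ?_) h1
  have n1 := Int.ediv_nonneg (h0 u hu) hE.le
  have e1 : (((u / E).toNat : ℕ) : ℝ) = ((u / E : ℤ) : ℝ) := by
    exact_mod_cast Int.toNat_of_nonneg n1
  have e2 : ((E * (u / E) : ℤ) : ℝ) ≤ u := by exact_mod_cast Int.mul_ediv_self_le hE.ne'
  push_cast at e2
  have n1' : (0 : ℝ) ≤ ((u / E : ℤ) : ℝ) := by exact_mod_cast n1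
  rw [e1, mul_pow, Real.sq_sqrt ha.le, mul_assoc, ← mul_pow]
  gcongr

theorem sum_residueClass_le {a y : ℝ} (ha : 0 < a) (hy : 0 < y) {E : ℤ} (hE : 0 < E)
    (s : Finset ℤ) (hs : ∀ u ∈ s, ∀ u' ∈ s, E ∣ u - u') :
    ∑ u ∈ s, 1 / (a * (u : ℝ) ^ 2 + y ^ 2) ≤ 2 * (1 / y ^ 2 + 2 / (√a * E * y)) := by
  rw [← Finset.sum_filter_add_sum_filter_not s (fun u => 0 ≤ u), two_mul]
  refine add_le_add (sum_residueClass_nonneg_le ha hy hE _ (by simp) fun u hu u' hu' => ?_) ?_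
  · exact hs u (Finset.mem_filter.mp hu).1 u' (Finset.mem_filter.mp hu').1
  · have h1 := sum_residueClass_nonneg_le ha hy hE
      ((s.filter fun u => ¬ 0 ≤ u).image fun u => -u) (by
        intro u hu
        simp only [Finset.mem_image, Finset.mem_filter] at hu
        obtain ⟨w, hw, rfl⟩ := hu
        lia) (by
        intro u hu u' hu'
        simp only [Finset.mem_image, Finset.mem_filter] at hu hu'
        obtain ⟨w, hw, rfl⟩ := hu
        obtain ⟨w', hw', rfl⟩ := hu'
        have := hs w' hw'.1 w hw.1
        rwa [show -w - -w' = w' - w by ring])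
    rw [Finset.sum_image (fun _ _ _ _ h => neg_injective h)] at h1
    simpa using h1

theorem sum_natAbs_le (G : ℕ → ℝ) (hG : ∀ j, 0 ≤ G j) (s : Finset ℤ) :
    ∑ u ∈ s, G u.natAbs ≤ 2 * ∑ j ∈ s.image Int.natAbs, G j := by
  have aux : ∀ t ⊆ s, Set.InjOn Int.natAbs (t : Set ℤ) →
      ∑ u ∈ t, G u.natAbs ≤ ∑ j ∈ s.image Int.natAbs, G j := by
    intro t hts hinj
    rw [← Finset.sum_image (f := G) hinj]
    exact Finset.sum_le_sum_of_subset_of_nonneg (Finset.image_subset_image hts)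
      fun _ _ _ => hG _
  rw [← Finset.sum_filter_add_sum_filter_not s (fun u => 0 ≤ u), two_mul]
  refine add_le_add (aux _ (Finset.filter_subset _ _) ?_) (aux _ (Finset.filter_subset _ _) ?_)
  · intro u hu u' hu' h
    simp only [Finset.coe_filter, Set.mem_ofPred_eq] at hu hu'
    lia
  · intro u hu u' hu' h
    simp only [Finset.coe_filter, Set.mem_ofPred_eq] at hu hu'
    lia

theorem sum_one_div_sq_le_two (t : Finset ℕ) (ht : 0 ∉ t) :
    ∑ j ∈ t, 1 / (j : ℝ) ^ 2 ≤ 2 := by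
  have h1 : t ⊆ Finset.Ioo 0 (t.sup id + 1) := fun j hj => by
    have h0 : j ≠ 0 := fun h => ht (h ▸ hj)
    have h2 : j ≤ t.sup id := Finset.le_sup (f := id) hj
    exact Finset.mem_Ioo.mpr ⟨by lia, by lia⟩
  refine (Finset.sum_le_sum_of_subset_of_nonneg h1 fun _ _ _ => by positivity).trans ?_
  have h3 := sum_Ioo_inv_sq_le (α := ℝ) 0 (t.sup id + 1)
  simpa using h3

theorem sum_one_div_le_one_add_log (t : Finset ℕ) (ht : 0 ∉ t) {M : ℕ} (hM : ∀ j ∈ t, j ≤ M) :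
    ∑ j ∈ t, 1 / (j : ℝ) ≤ 1 + log M := by
  have h1 : t ⊆ Finset.Icc 1 M := fun j hj => by
    have : j ≠ 0 := fun h => ht (h ▸ hj)
    exact Finset.mem_Icc.mpr ⟨by lia, hM j hj⟩
  refine (Finset.sum_le_sum_of_subset_of_nonneg h1 fun _ _ _ => by positivity).trans ?_
  have := harmonic_le_one_add_log M
  rw [harmonic_eq_sum_Icc] at this
  push_cast at this
  simpa using this

/-- The value of the binary quadratic form with coefficients `(a, b, c)`. -/
def qform (a b c : ℤ) (x : ℤ × ℤ) : ℤ := a * x.1 ^ 2 + b * x.1 * x.2 + c * x.2 ^ 2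

theorem le_two_mul_qform {a b c : ℤ} (hb : |b| ≤ a) (hac : a ≤ c) (x : ℤ × ℤ) :
    a * x.1 ^ 2 + c * x.2 ^ 2 ≤ 2 * qform a b c x := by
  unfold qform
  obtain ⟨h1, h2⟩ := abs_le.mp hb
  have e1 : (a - b) * (x.1 - x.2) ^ 2 ≥ 0 := mul_nonneg (by linarith) (sq_nonneg _)
  have e2 : (a + b) * (x.1 + x.2) ^ 2 ≥ 0 := mul_nonneg (by linarith) (sq_nonneg _)
  have e3 : (c - a) * x.2 ^ 2 ≥ 0 := mul_nonneg (by linarith) (sq_nonneg _)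
  nlinarith

theorem one_div_qform_le {a b c : ℤ} (ha : 0 < a) (hb : |b| ≤ a) (hac : a ≤ c) {x : ℤ × ℤ}
    (hx : x ≠ 0) :
    1 / (qform a b c x : ℝ) ≤ 2 * (1 / ((a : ℝ) * (x.1 : ℝ) ^ 2 + (c : ℝ) * (x.2 : ℝ) ^ 2)) := by
  have h1 : ((a * x.1 ^ 2 + c * x.2 ^ 2 : ℤ) : ℝ) ≤ ((2 * qform a b c x : ℤ) : ℝ) := by
    exact_mod_cast le_two_mul_qform hb hac x
  push_cast at h1
  have h2 : 0 < a * x.1 ^ 2 + c * x.2 ^ 2 := by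
    have hc : 0 < c := by lia
    by_cases hx1 : x.1 = 0
    · have hx2 : x.2 ≠ 0 := fun h => hx (Prod.ext hx1 h)
      positivity
    · positivity
  have h2' : (0 : ℝ) < (a : ℝ) * (x.1 : ℝ) ^ 2 + (c : ℝ) * (x.2 : ℝ) ^ 2 := by exact_mod_cast h2
  rw [mul_one_div, div_le_div_iff₀ (by linarith) h2']
  linarith

theorem sum_lattice_row_zero_le {a e E g : ℤ} (ha : 0 < a) (hg : 0 < g) (hE : 0 < E)
    (he : e = g * E) (hga : g ≤ 2 * a) (s : Finset ℤ) (hs : ∀ u ∈ s, E ∣ u)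
    (hs0 : 0 ∉ s) : (e : ℝ) * ∑ u ∈ s, 1 / ((a : ℝ) * (u : ℝ) ^ 2) ≤ 8 := by
  have hdiv : ∀ u ∈ s, u = E * (u / E) := fun u hu => (Int.mul_ediv_cancel' (hs u hu)).symm
  have h1 : ∑ u ∈ s, 1 / ((a : ℝ) * (u : ℝ) ^ 2) =
      1 / (a * (E : ℝ) ^ 2) * ∑ w ∈ s.image (· / E), 1 / ((w.natAbs : ℕ) : ℝ) ^ 2 := by
    rw [Finset.sum_image, Finset.mul_sum]
    · refine Finset.sum_congr rfl fun u hu => ?_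
      conv_lhs => rw [hdiv u hu]
      rw [Nat.cast_natAbs]
      push_cast
      rw [sq_abs, mul_pow]
      rw [← mul_assoc, one_div_mul_one_div]
    · intro u hu u' hu' huu
      have huu' : u / E = u' / E := huu
      rw [hdiv u hu, hdiv u' hu', huu']
  have h2 := sum_natAbs_le (fun j => 1 / (j : ℝ) ^ 2) (fun j => by positivity) (s.image (· / E))
  have h3 := sum_one_div_sq_le_two ((s.image (· / E)).image Int.natAbs) (by
    simp only [Finset.mem_image, not_exists, not_and, Int.natAbs_eq_zero]
    rintro _ ⟨u, hu, rfl⟩ h0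
    have := hdiv u hu
    rw [h0] at this
    exact hs0 (by simpa [this] using hu))
  have h4 : ∑ w ∈ s.image (· / E), 1 / ((w.natAbs : ℕ) : ℝ) ^ 2 ≤ 4 := by linarith
  rw [h1, he]
  have ha' : (0 : ℝ) < a := by exact_mod_cast ha
  have hE' : (1 : ℝ) ≤ E := by exact_mod_cast hE
  have hga' : (g : ℝ) ≤ 2 * a := by exact_mod_cast hga
  have hg' : (0 : ℝ) < g := by exact_mod_cast hg
  push_cast
  calc ((g : ℝ) * (E : ℝ)) * (1 / (a * (E : ℝ) ^ 2) * ∑ w ∈ s.image (· / E), 1 / ((w.natAbs : ℕ) : ℝ) ^ 2)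
      ≤ ((g : ℝ) * (E : ℝ)) * (1 / (a * (E : ℝ) ^ 2) * 4) := by gcongr
    _ = 4 * ((g : ℝ) / (a * E)) := by field_simp
    _ ≤ 4 * 2 := by
      gcongr
      rw [div_le_iff₀ (by positivity)]
      nlinarith
    _ = 8 := by norm_num

theorem sum_lattice_row_le {Δ a c e E g v : ℤ} (hΔ : 0 < Δ) (ha : 0 < a) (hac : a ≤ c)
    (hΔac : Δ ≤ 4 * a * c) (hg : 0 < g) (hE : 0 < E) (he : e = g * E) (heΔ : e ^ 2 ≤ Δ)
    (s : Finset ℤ) (hs : ∀ u ∈ s, ∀ u' ∈ s, E ∣ u - u') {m : ℕ} (hm : 0 < m)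
    (hv : 2 * (v.natAbs : ℤ) = g * m) :
    (e : ℝ) * ∑ u ∈ s, 2 * (1 / ((a : ℝ) * (u : ℝ) ^ 2 + (c : ℝ) * (v : ℝ) ^ 2)) ≤
      32 * (1 / (m : ℝ) ^ 2) + 32 / √Δ * (1 / (m : ℝ)) := by
  have hc : 0 < c := by lia
  have ha' : (0 : ℝ) < a := by exact_mod_cast ha
  have hc' : (0 : ℝ) < c := by exact_mod_cast hc
  have hg' : (1 : ℝ) ≤ g := by exact_mod_cast hg
  have hm' : (0 : ℝ) < m := by exact_mod_cast hm
  have hE' : (0 : ℝ) < E := by exact_mod_cast hE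
  have hΔ' : (0 : ℝ) < Δ := by exact_mod_cast hΔ
  have he0 : 0 < e := by rw [he]; positivity
  have he2 : e ≤ 2 * c := by
    by_contra hcon
    nlinarith
  have he2' : (e : ℝ) ≤ 2 * c := by exact_mod_cast he2
  have hv' : 2 * |(v : ℝ)| = g * m := by
    have : ((2 * (v.natAbs : ℤ) : ℤ) : ℝ) = ((g * m : ℤ) : ℝ) := by rw [hv]
    push_cast at this
    simpa using this
  have habs : |(v : ℝ)| = g * m / 2 := by linarith
  have h1 := sum_residueClass_le (a := (a : ℝ)) (y := √c * |(v : ℝ)|) ha'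
    (by rw [habs]; positivity) hE s hs
  rw [mul_pow, Real.sq_sqrt hc'.le, sq_abs] at h1
  rw [← Finset.mul_sum]
  have hv2 : (v : ℝ) ^ 2 = (g * m / 2) ^ 2 := by rw [← sq_abs, habs]
  have hs4 : √Δ ≤ 2 * (√a * √c) := by
    rw [← Real.sqrt_mul ha'.le]
    apply Real.sqrt_le_iff.mpr ⟨by positivity, ?_⟩
    rw [mul_pow, Real.sq_sqrt (by positivity)]
    have : ((Δ : ℤ) : ℝ) ≤ ((4 * a * c : ℤ) : ℝ) := by exact_mod_cast hΔac
    push_cast at this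
    linarith
  calc _ ≤ (e : ℝ) * (2 * (2 * (1 / (c * (v : ℝ) ^ 2) + 2 / (√a * E * (√c * |(v : ℝ)|))))) := by
        have : (0 : ℝ) ≤ e := by exact_mod_cast he0.le
        gcongr
    _ = 16 * (e / c) * (1 / (g : ℝ) ^ 2) * (1 / (m : ℝ) ^ 2)
          + 16 / (√a * √c) * (1 / (m : ℝ)) := by
        rw [hv2, habs, he]
        push_cast
        have h5 : √a ≠ 0 := by positivity
        have h6 : √c ≠ 0 := by positivity
        field_simp
        ring
    _ ≤ _ := by
        have t1 : (e : ℝ) / c ≤ 2 := by rw [div_le_iff₀ hc']; exact he2'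
        have t2 : 1 / (g : ℝ) ^ 2 ≤ 1 := by
          rw [div_le_one (by positivity)]; exact one_le_pow₀ hg'
        have t3 : 16 / (√a * √c) ≤ 32 / √Δ := by
          rw [div_le_div_iff₀ (by positivity) (by positivity)]
          linarith
        have t4 : 16 * ((e : ℝ) / c) * (1 / (g : ℝ) ^ 2) ≤ 32 := by
          have : (0 : ℝ) ≤ e / c := by
            have : (0 : ℝ) ≤ e := by exact_mod_cast he0.le
            positivity
          calc 16 * ((e : ℝ) / c) * (1 / (g : ℝ) ^ 2) ≤ 16 * 2 * 1 := by gcongr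
            _ = 32 := by norm_num
        gcongr

theorem sum_lattice_le {Δ a b c e : ℤ} (hΔ : 0 < Δ) (h : IsPrimPosForm Δ a b c) (hb : |b| ≤ a)
    (hac : a ≤ c) (he : 0 < e) (heΔ : e ^ 2 ≤ Δ) (s : Finset (ℤ × ℤ)) (hs0 : ∀ x ∈ s, x ≠ 0)
    {M : ℕ} (hM : ∀ x ∈ s, x.2.natAbs ≤ M) (h1 : ∀ x ∈ s, e ∣ 2 * a * x.1 + b * x.2)
    (h2 : ∀ x ∈ s, e ∣ b * x.1 + 2 * c * x.2) :
    (e : ℝ) * ∑ x ∈ s, 1 / (qform a b c x : ℝ) ≤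
      144 + 64 * (1 + log ((2 * M : ℕ) : ℝ)) / √Δ := by
  have ha := h.pos
  set g : ℤ := ((Int.gcd (Int.gcd (2 * a) b : ℤ) e : ℕ) : ℤ) with hg
  have hgpos : 0 < g := by
    rw [hg]; exact_mod_cast Int.gcd_pos_of_ne_zero_right _ he.ne'
  have hge : g ∣ e := Int.gcd_dvd_right _ _
  have hg2a : g ∣ 2 * a := (Int.gcd_dvd_left _ _).trans (Int.gcd_dvd_left _ _)
  have hgb : g ∣ b := (Int.gcd_dvd_left _ _).trans (Int.gcd_dvd_right _ _)
  obtain ⟨E, hE⟩ := hge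
  have hEpos : 0 < E := by
    by_contra hcon
    nlinarith
  have hEdvd : ∀ w : ℤ, e ∣ 2 * a * w → e ∣ b * w → E ∣ w := by
    intro w hw1 hw2
    have h3 : e ∣ g * w := by
      obtain ⟨p, q, e1⟩ : ∃ p q, (Int.gcd (2 * a) b : ℤ) = 2 * a * p + b * q :=
        ⟨_, _, Int.gcd_eq_gcd_ab _ _⟩
      obtain ⟨r, t, e2⟩ : ∃ r t, g = (Int.gcd (2 * a) b : ℤ) * r + e * t :=
        ⟨_, _, Int.gcd_eq_gcd_ab _ _⟩
      rw [e2, e1]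
      rw [show ((2 * a * p + b * q) * r + e * t) * w =
        2 * a * w * (p * r) + b * w * (q * r) + e * (t * w) by ring]
      exact dvd_add (dvd_add (hw1.mul_right _) (hw2.mul_right _)) (dvd_mul_right _ _)
    rw [hE] at h3
    exact (mul_dvd_mul_iff_left hgpos.ne').mp h3
  have hrow : ∀ x ∈ s, ∀ x' ∈ s, x.2 = x'.2 → E ∣ x.1 - x'.1 := by
    intro x hx x' hx' hxx
    apply hEdvd
    · rw [show 2 * a * (x.1 - x'.1) = 2 * a * x.1 + b * x.2 - (2 * a * x'.1 + b * x.2) by ring]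
      exact dvd_sub (h1 x hx) (hxx ▸ h1 x' hx')
    · rw [show b * (x.1 - x'.1) = b * x.1 + 2 * c * x.2 - (b * x'.1 + 2 * c * x.2) by ring]
      exact dvd_sub (h2 x hx) (hxx ▸ h2 x' hx')
  have hg2v : ∀ x ∈ s, g ∣ 2 * x.2 := by
    intro x hx
    have t1 : g ∣ a * (2 * x.2) := by
      rw [show a * (2 * x.2) = 2 * a * x.2 by ring]; exact hg2a.mul_right _
    have t2 : g ∣ b * (2 * x.2) := hgb.mul_right _
    have t3 : g ∣ c * (2 * x.2) := by
      rw [show c * (2 * x.2) = b * x.1 + 2 * c * x.2 - b * x.1 by ring]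
      exact dvd_sub ((Dvd.intro E hE.symm).trans (h2 x hx)) (hgb.mul_right x.1)
    have t4 : g ∣ (((a.gcd b : ℤ).gcd c : ℕ) : ℤ) * (2 * x.2) := by
      obtain ⟨p, q, e1⟩ : ∃ p q, (Int.gcd a b : ℤ) = a * p + b * q :=
        ⟨_, _, Int.gcd_eq_gcd_ab _ _⟩
      obtain ⟨r, t, e2⟩ : ∃ r t, (Int.gcd (Int.gcd a b) c : ℤ) = (Int.gcd a b : ℤ) * r + c * t :=
        ⟨_, _, Int.gcd_eq_gcd_ab _ _⟩
      rw [e2, e1]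
      rw [show ((a * p + b * q) * r + c * t) * (2 * x.2) =
        a * (2 * x.2) * (p * r) + b * (2 * x.2) * (q * r) + c * (2 * x.2) * t by ring]
      exact dvd_add (dvd_add (t1.mul_right _) (t2.mul_right _)) (t3.mul_right _)
    have t5 : (a.gcd b : ℤ).gcd c = 1 := by
      by_contra hne
      obtain ⟨q, hq, hqd⟩ := Nat.exists_prime_and_dvd hne
      have hqd' : (q : ℤ) ∣ (((a.gcd b : ℤ).gcd c : ℕ) : ℤ) := by exact_mod_cast hqd
      have q1 := hqd'.trans (Int.gcd_dvd_left _ _)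
      exact h.prim q hq ⟨q1.trans (Int.gcd_dvd_left _ _), q1.trans (Int.gcd_dvd_right _ _),
        hqd'.trans (Int.gcd_dvd_right _ _)⟩
    rw [t5] at t4
    simpa using t4
  have hterm : ∑ x ∈ s, 1 / (qform a b c x : ℝ) ≤ ∑ v ∈ s.image Prod.snd,
      ∑ u ∈ (s.filter fun x => x.2 = v).image Prod.fst,
        2 * (1 / ((a : ℝ) * (u : ℝ) ^ 2 + (c : ℝ) * (v : ℝ) ^ 2)) := by
    rw [← Finset.sum_fiberwise_of_maps_to (g := Prod.snd) (t := s.image Prod.snd)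
      fun x hx => Finset.mem_image_of_mem _ hx]
    refine Finset.sum_le_sum fun v _ => ?_
    rw [Finset.sum_image]
    · refine Finset.sum_le_sum fun x hx => ?_
      obtain ⟨hx1, rfl⟩ := Finset.mem_filter.mp hx
      exact one_div_qform_le ha hb hac (hs0 x hx1)
    · intro x hx x' hx' hxx
      simp only [Finset.coe_filter, Set.mem_ofPred_eq] at hx hx'
      exact Prod.ext hxx (hx.2.trans hx'.2.symm)
  have he' : (0 : ℝ) < e := by exact_mod_cast he
  refine (mul_le_mul_of_nonneg_left hterm he'.le).trans ?_
  set G : ℕ → ℝ := fun m => 32 * (1 / (m : ℝ) ^ 2) + 32 / √Δ * (1 / (m : ℝ)) with hG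
  have hG0 : ∀ m, 0 ≤ G m := fun m => by rw [hG]; positivity
  rw [Finset.mul_sum, ← Finset.sum_filter_add_sum_filter_not (s.image Prod.snd) (fun v => v = 0)]
  have hzero : ∑ v ∈ (s.image Prod.snd).filter (fun v => v = 0), (e : ℝ) *
      ∑ u ∈ (s.filter fun x => x.2 = v).image Prod.fst,
        2 * (1 / ((a : ℝ) * (u : ℝ) ^ 2 + (c : ℝ) * (v : ℝ) ^ 2)) ≤ 16 := by
    refine (Finset.sum_le_sum_of_subset_of_nonneg (t := {0}) (fun v hv => by
      simpa using (Finset.mem_filter.mp hv).2) fun v _ _ => ?_).trans ?_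
    · have hc' : (0 : ℝ) ≤ c := by exact_mod_cast (ha.le.trans hac)
      have ha' : (0 : ℝ) ≤ a := by exact_mod_cast ha.le
      positivity
    rw [Finset.sum_singleton, ← Finset.mul_sum]
    have := sum_lattice_row_zero_le ha hgpos hEpos hE
      (Int.le_of_dvd (by lia) hg2a) ((s.filter fun x => x.2 = 0).image Prod.fst) (by
        simp only [Finset.mem_image, Finset.mem_filter]
        rintro u ⟨x, ⟨hx, hx0⟩, rfl⟩
        apply hEdvd
        · have := h1 x hx
          rw [hx0] at this
          simpa using this
        · have := h2 x hx
          rw [hx0] at this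
          simpa using this) (by
        simp only [Finset.mem_image, Finset.mem_filter]
        rintro ⟨x, ⟨hx, hx0⟩, hx1⟩
        exact hs0 x hx (Prod.ext hx1 hx0))
    simp only [Int.cast_zero, ne_eq, OfNat.ofNat_ne_zero, not_false_eq_true, zero_pow, mul_zero,
      add_zero]
    linarith
  set t := (s.image Prod.snd).filter (fun v => ¬ v = 0) with ht
  have htm : ∀ v ∈ t, v ≠ 0 ∧ v.natAbs ≤ M ∧ g ∣ 2 * v := by
    intro v hv
    obtain ⟨hv1, hv2⟩ := Finset.mem_filter.mp hv
    obtain ⟨x, hx, rfl⟩ := Finset.mem_image.mp hv1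
    exact ⟨hv2, hM x hx, hg2v x hx⟩
  have hmul : ∀ v ∈ t, 2 * v = g * (2 * v / g) := fun v hv =>
    (Int.mul_ediv_cancel' (htm v hv).2.2).symm
  have hmabs : ∀ v ∈ t, 2 * (v.natAbs : ℤ) = g * ((2 * v / g).natAbs : ℕ) := by
    intro v hv
    have := congrArg Int.natAbs (hmul v hv)
    rw [Int.natAbs_mul, Int.natAbs_mul] at this
    have h3 : ((2 * v.natAbs : ℕ) : ℤ) = ((g.natAbs * (2 * v / g).natAbs : ℕ) : ℤ) := by
      exact_mod_cast this
    rw [Nat.cast_mul, Nat.cast_mul, Int.natAbs_of_nonneg hgpos.le] at h3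
    exact_mod_cast h3
  have hmpos : ∀ v ∈ t, 0 < (2 * v / g).natAbs := by
    intro v hv
    rw [Int.natAbs_pos]
    intro h0
    have := hmul v hv
    rw [h0] at this
    exact (htm v hv).1 (by lia)
  have hnz : ∑ v ∈ t, (e : ℝ) * ∑ u ∈ (s.filter fun x => x.2 = v).image Prod.fst,
        2 * (1 / ((a : ℝ) * (u : ℝ) ^ 2 + (c : ℝ) * (v : ℝ) ^ 2)) ≤
      ∑ w ∈ t.image (fun v => 2 * v / g), G w.natAbs := by
    rw [Finset.sum_image]
    · refine Finset.sum_le_sum fun v hv => ?_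
      refine sum_lattice_row_le hΔ ha hac (by rw [← h.disc]; nlinarith [sq_nonneg b]) hgpos hEpos hE
        heΔ _ ?_ (hmpos v hv) (hmabs v hv)
      simp only [Finset.mem_image, Finset.mem_filter]
      rintro u ⟨x, ⟨hx, hx2⟩, rfl⟩ u' ⟨x', ⟨hx', hx2'⟩, rfl⟩
      exact hrow x hx x' hx' (hx2.trans hx2'.symm)
    · intro v hv v' hv' hvv
      have e1 := hmul v hv
      have e2 := hmul v' hv'
      have hvv' : 2 * v / g = 2 * v' / g := hvv
      rw [hvv'] at e1
      lia
  have hfin := sum_natAbs_le G hG0 (t.image fun v => 2 * v / g)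
  set J := (t.image fun v => 2 * v / g).image Int.natAbs with hJ
  have hJ0 : 0 ∉ J := by
    simp only [hJ, Finset.mem_image, not_exists, not_and]
    rintro _ ⟨v, hv, rfl⟩ h0
    exact (hmpos v hv).ne' h0
  have hJM : ∀ j ∈ J, j ≤ 2 * M := by
    simp only [hJ, Finset.mem_image]
    rintro _ ⟨_, ⟨v, hv, rfl⟩, rfl⟩
    have e1 := hmabs v hv
    have e2 := (htm v hv).2.1
    have : ((2 * v / g).natAbs : ℤ) ≤ g * ((2 * v / g).natAbs : ℕ) := by
      nlinarith
    lia
  have b1 := sum_one_div_sq_le_two J hJ0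
  have b2 := sum_one_div_le_one_add_log J hJ0 hJM
  have b3 : ∑ j ∈ J, G j ≤ 64 + 32 / √Δ * (1 + log ((2 * M : ℕ) : ℝ)) := by
    rw [hG]
    simp only
    rw [Finset.sum_add_distrib, ← Finset.mul_sum, ← Finset.mul_sum]
    have : (0 : ℝ) ≤ 32 / √Δ := by positivity
    have := mul_le_mul_of_nonneg_left b2 this
    linarith
  calc _ ≤ 16 + 2 * (64 + 32 / √Δ * (1 + log ((2 * M : ℕ) : ℝ))) := by linarith
    _ = _ := by ring

theorem sum_sum_natAbs_le (M : ℕ) {y : ℝ} (hy : 0 < y) :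
    ∑ g ∈ (Finset.Icc (-M : ℤ) M).filter (· ≠ 0), ∑ k ∈ (Finset.Icc (-M : ℤ) M).filter (· ≠ 0),
      1 / ((g : ℝ) ^ 2 + (k : ℝ) ^ 2 * y ^ 2) ≤ 8 / y * (1 + log M) := by
  have habs : ∀ g : ℤ, ((g.natAbs : ℕ) : ℝ) ^ 2 = (g : ℝ) ^ 2 := fun g => by
    rw [Nat.cast_natAbs]; push_cast; rw [sq_abs]
  set I := (Finset.Icc (-M : ℤ) M).filter (· ≠ 0) with hI
  have hIm : I.image Int.natAbs ⊆ Finset.Icc 1 M := by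
    intro j hj
    obtain ⟨g, hg, rfl⟩ := Finset.mem_image.mp hj
    simp only [hI, Finset.mem_filter, Finset.mem_Icc] at hg ⊢
    lia
  rw [Finset.sum_comm]
  have h1 : ∀ k ∈ I, ∑ g ∈ I, 1 / ((g : ℝ) ^ 2 + (k : ℝ) ^ 2 * y ^ 2) ≤
      4 / y * (1 / ((k.natAbs : ℕ) : ℝ)) := by
    intro k hk
    have hk0 : k ≠ 0 := (Finset.mem_filter.mp hk).2
    have hk' : (0 : ℝ) < ((k.natAbs : ℕ) : ℝ) := by exact_mod_cast Int.natAbs_pos.mpr hk0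
    have h2 := sum_natAbs_le (fun j => 1 / ((j : ℝ) ^ 2 + ((k.natAbs : ℕ) * y : ℝ) ^ 2))
      (fun j => by positivity) I
    simp only [habs, mul_pow] at h2
    refine h2.trans ?_
    have h3 := sum_one_div_sq_add_sq_le (y := (k.natAbs : ℕ) * y) (by positivity) M
    have h4 : ∑ j ∈ I.image Int.natAbs, 1 / ((j : ℝ) ^ 2 + (k : ℝ) ^ 2 * y ^ 2) ≤
        2 / ((k.natAbs : ℕ) * y) := by
      refine (Finset.sum_le_sum_of_subset_of_nonneg hIm fun _ _ _ => by positivity).trans ?_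
      rw [mul_pow, habs] at h3
      refine le_trans (le_of_eq ?_) h3
      have h5 : Finset.Icc 1 M = (Finset.range M).image fun i => i + 1 := by
        ext j
        simp only [Finset.mem_Icc, Finset.mem_image, Finset.mem_range]
        exact ⟨fun h => ⟨j - 1, by lia, by lia⟩, by rintro ⟨i, hi, rfl⟩; lia⟩
      rw [h5, Finset.sum_image fun _ _ _ _ h => Nat.succ_injective h]
      simp
    calc _ ≤ 2 * (2 / ((k.natAbs : ℕ) * y)) := by gcongr
      _ = _ := by field_simp; norm_num
  refine (Finset.sum_le_sum h1).trans ?_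
  rw [← Finset.mul_sum]
  have h5 := sum_natAbs_le (fun j => 1 / (j : ℝ)) (fun j => by positivity) I
  have h6 := sum_one_div_le_one_add_log (I.image Int.natAbs)
    (fun h0 => by simpa using hIm h0) (M := M) (fun j hj => (Finset.mem_Icc.mp (hIm hj)).2)
  calc _ ≤ 4 / y * (2 * (1 + log M)) := by
        gcongr
        exact h5.trans (by linarith)
    _ = _ := by ring

/-- Pairs `(U, V)` that are conjugate for the bilinear form attached to `(a, b, c)`, with a small
divisor `e` of the discriminant relating their directions. -/
def ConjPair (Δ a b c : ℤ) (z : (ℤ × ℤ) × (ℤ × ℤ)) : Prop :=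
  ∃ (e : ℕ) (u : ℤ × ℤ) (g k : ℤ), 0 < e ∧ ((e : ℤ) ^ 2 ≤ Δ) ∧ (e : ℤ) ∣ Δ ∧
    (e : ℤ) ∣ 2 * a * u.1 + b * u.2 ∧ (e : ℤ) ∣ b * u.1 + 2 * c * u.2 ∧
    z.1 = (g * u.1, g * u.2) ∧ (e : ℤ) * z.2.1 = k * (b * u.1 + 2 * c * u.2) ∧
    (e : ℤ) * z.2.2 = k * -(2 * a * u.1 + b * u.2)

theorem qform_pos {Δ a b c : ℤ} (hΔ : 0 < Δ) (h : IsPrimPosForm Δ a b c) {x : ℤ × ℤ}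
    (hx : x ≠ 0) : 0 < qform a b c x := by
  have h1 : 4 * a * qform a b c x = (2 * a * x.1 + b * x.2) ^ 2 + Δ * x.2 ^ 2 := by
    rw [← h.disc, qform]; ring
  have ha := h.pos
  have h2 : 0 < (2 * a * x.1 + b * x.2) ^ 2 + Δ * x.2 ^ 2 := by
    by_cases hx2 : x.2 = 0
    · have hx1 : x.1 ≠ 0 := fun h => hx (Prod.ext h hx2)
      rw [hx2]
      have : 2 * a * x.1 ≠ 0 := by positivity
      have : 0 < (2 * a * x.1 + b * 0) ^ 2 := by rw [mul_zero, add_zero]; positivity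
      linarith
    · have : 0 < Δ * x.2 ^ 2 := by positivity
      nlinarith [sq_nonneg (2 * a * x.1 + b * x.2)]
  by_contra hcon
  nlinarith

theorem sum_conjPair_le {Δ a b c : ℤ} (hΔ : 0 < Δ) (h : IsPrimPosForm Δ a b c) (hb : |b| ≤ a)
    (hac : a ≤ c) {M : ℕ} (P : Finset ((ℤ × ℤ) × (ℤ × ℤ))) (hP : ∀ z ∈ P, ConjPair Δ a b c z)
    (h1 : ∀ z ∈ P, z.1 ≠ 0) (h2 : ∀ z ∈ P, z.2 ≠ 0)
    (hM1 : ∀ z ∈ P, z.1.1.natAbs ≤ M ∧ z.1.2.natAbs ≤ M)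
    (hM2 : ∀ z ∈ P, z.2.1.natAbs ≤ M ∧ z.2.2.natAbs ≤ M) :
    ∑ z ∈ P, 1 / ((qform a b c z.1 : ℝ) + qform a b c z.2) ≤
      Δ.toNat.divisors.card * (8 / √Δ * (1 + log M) *
        (144 + 64 * (1 + log ((2 * M : ℕ) : ℝ)) / √Δ)) := by
  have hΔ' : (0 : ℝ) < Δ := by exact_mod_cast hΔ
  set I := (Finset.Icc (-M : ℤ) M).filter (· ≠ 0) with hI
  set Lat : ℕ → Finset (ℤ × ℤ) := fun e => (Finset.Icc (-M : ℤ) M ×ˢ Finset.Icc (-M : ℤ) M).filter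
    fun u => u ≠ 0 ∧ (e : ℤ) ∣ 2 * a * u.1 + b * u.2 ∧ (e : ℤ) ∣ b * u.1 + 2 * c * u.2 with hLat
  set D := Δ.toNat.divisors.filter fun e : ℕ => 0 < e ∧ (e : ℤ) ^ 2 ≤ Δ with hD
  set T : Finset (Σ _ : ℕ, (ℤ × ℤ) × (ℤ × ℤ)) := D.sigma fun e => Lat e ×ˢ (I ×ˢ I) with hT
  set φ : (Σ _ : ℕ, (ℤ × ℤ) × (ℤ × ℤ)) → (ℤ × ℤ) × (ℤ × ℤ) := fun t =>
    ((t.2.2.1 * t.2.1.1, t.2.2.1 * t.2.1.2),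
      (t.2.2.2 * ((b * t.2.1.1 + 2 * c * t.2.1.2) / t.1),
        t.2.2.2 * (-(2 * a * t.2.1.1 + b * t.2.1.2) / t.1))) with hφ
  have hsub : P ⊆ T.image φ := by
    intro z hz
    obtain ⟨e, u, g, k, he0, heΔ, hed, hd1, hd2, hz1, hz2, hz3⟩ := hP z hz
    have he0' : (e : ℤ) ≠ 0 := by positivity
    obtain ⟨q, hq⟩ := hd2
    obtain ⟨p, hp⟩ := hd1
    have hz2' : z.2.1 = k * q := by
      rw [hq] at hz2
      exact mul_left_cancel₀ he0' (by linarith)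
    have hz3' : z.2.2 = k * -p := by
      rw [hp] at hz3
      exact mul_left_cancel₀ he0' (by linarith)
    obtain ⟨b1, b2⟩ := hM1 z hz
    obtain ⟨b3, b4⟩ := hM2 z hz
    have hg0 : g ≠ 0 := by
      rintro rfl
      exact h1 z hz (by rw [hz1]; simp)
    have hk0 : k ≠ 0 := by
      rintro rfl
      exact h2 z hz (Prod.ext (by simpa using hz2') (by simpa using hz3'))
    have hu0 : u ≠ 0 := by
      rintro rfl
      exact h1 z hz (by rw [hz1]; simp)
    have hmul : ∀ {r s : ℤ}, r ≠ 0 → s.natAbs ≤ (r * s).natAbs := fun {r s} hr => by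
      rw [Int.natAbs_mul]
      exact Nat.le_mul_of_pos_left _ (Int.natAbs_pos.mpr hr)
    have hmul' : ∀ {r s : ℤ}, s ≠ 0 → r.natAbs ≤ (r * s).natAbs := fun {r s} hr => by
      rw [Int.natAbs_mul]
      exact Nat.le_mul_of_pos_right _ (Int.natAbs_pos.mpr hr)
    rw [hz1] at b1 b2
    rw [hz2'] at b3
    rw [hz3'] at b4
    have c1 : u.1.natAbs ≤ M := (hmul hg0).trans b1
    have c2 : u.2.natAbs ≤ M := (hmul hg0).trans b2
    have c3 : g.natAbs ≤ M := by
      by_cases hu1 : u.1 = 0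
      · have hu2 : u.2 ≠ 0 := fun h => hu0 (Prod.ext hu1 h)
        exact (hmul' hu2).trans b2
      · exact (hmul' hu1).trans b1
    have c4 : k.natAbs ≤ M := by
      by_cases hq0 : q = 0
      · have hp0 : -p ≠ 0 := by
          intro hp0
          exact h2 z hz (Prod.ext (by simp [hz2', hq0]) (by rw [hz3', hp0]; simp))
        exact (hmul' hp0).trans b4
      · exact (hmul' hq0).trans b3
    refine Finset.mem_image.mpr ⟨⟨e, u, g, k⟩, ?_, ?_⟩
    · simp only [hT, Finset.mem_sigma, Finset.mem_product, hD, Finset.mem_filter, hLat, hI,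
        Finset.mem_Icc, Nat.mem_divisors]
      refine ⟨⟨⟨?_, by lia⟩, he0, heΔ⟩, ⟨⟨⟨by lia, by lia⟩, by lia, by lia⟩, hu0, ⟨p, hp⟩, ⟨q, hq⟩⟩,
        ⟨⟨by lia, by lia⟩, hg0⟩, ⟨by lia, by lia⟩, hk0⟩
      zify
      rwa [Int.toNat_of_nonneg hΔ.le]
    · refine Prod.ext hz1.symm (Prod.ext ?_ ?_)
      · simp only [hφ]
        rw [hq, Int.mul_ediv_cancel_left _ he0', hz2']
      · simp only [hφ]
        rw [hp, ← mul_neg, Int.mul_ediv_cancel_left _ he0', hz3']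
  have hval : ∀ e ∈ D, ∀ u ∈ Lat e, ∀ g k : ℤ, (qform a b c (φ ⟨e, u, g, k⟩).1 : ℝ) +
      qform a b c (φ ⟨e, u, g, k⟩).2 =
        qform a b c u * ((g : ℝ) ^ 2 + (k : ℝ) ^ 2 * (√Δ / e) ^ 2) := by
    intro e he u hu g k
    have he0 : 0 < e := (Finset.mem_filter.mp he).2.1
    obtain ⟨-, -, ⟨p, hp⟩, ⟨q, hq⟩⟩ := Finset.mem_filter.mp hu
    have he0' : (e : ℤ) ≠ 0 := by positivity
    have he0r : (e : ℝ) ≠ 0 := by positivity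
    simp only [hφ]
    rw [hp, hq, ← mul_neg, Int.mul_ediv_cancel_left _ he0', Int.mul_ediv_cancel_left _ he0']
    have e1 : (e : ℤ) ^ 2 * qform a b c (k * q, k * -p) = k ^ 2 * (Δ * qform a b c u) := by
      have : (e : ℤ) ^ 2 * qform a b c (k * q, k * -p) =
        k ^ 2 * (a * (e * q) ^ 2 - b * (e * q) * (e * p) + c * (e * p) ^ 2) := by
        unfold qform; ring
      rw [this, ← hp, ← hq, ← h.disc]
      unfold qform; ring
    have e2 : qform a b c (g * u.1, g * u.2) = g ^ 2 * qform a b c u := by unfold qform; ring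
    have e1' : (e : ℝ) ^ 2 * (qform a b c (k * q, k * -p) : ℝ) =
        (k : ℝ) ^ 2 * ((Δ : ℝ) * qform a b c u) := by exact_mod_cast e1
    rw [e2, div_pow, Real.sq_sqrt hΔ'.le]
    push_cast
    have e3 : (qform a b c (k * q, k * -p) : ℝ) =
        (k : ℝ) ^ 2 * ((Δ : ℝ) * qform a b c u) / (e : ℝ) ^ 2 := by
      rw [eq_div_iff (by positivity)]; linarith
    rw [e3]
    ring
  have hqpos : ∀ x : ℤ × ℤ, (0 : ℝ) ≤ qform a b c x := by
    intro x
    by_cases hx : x = 0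
    · simp [hx, qform]
    · exact_mod_cast (qform_pos hΔ h hx).le
  have hnn : ∀ z : (ℤ × ℤ) × (ℤ × ℤ), (0 : ℝ) ≤ 1 / ((qform a b c z.1 : ℝ) + qform a b c z.2) := fun z =>
    div_nonneg zero_le_one (add_nonneg (hqpos _) (hqpos _))
  refine (Finset.sum_le_sum_of_subset_of_nonneg hsub fun z _ _ => hnn z).trans ?_
  refine (Finset.sum_image_le_of_nonneg fun z _ => hnn z).trans ?_
  rw [hT, Finset.sum_sigma]
  have hstep : ∀ e ∈ D, ∑ s ∈ Lat e ×ˢ (I ×ˢ I), 1 / ((qform a b c (φ ⟨e, s⟩).1 : ℝ) +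
      qform a b c (φ ⟨e, s⟩).2) ≤ 8 / √Δ * (1 + log M) *
        (144 + 64 * (1 + log ((2 * M : ℕ) : ℝ)) / √Δ) := by
    intro e he
    have he0 : 0 < e := (Finset.mem_filter.mp he).2.1
    have he0r : (0 : ℝ) < e := by exact_mod_cast he0
    have heq : ∑ s ∈ Lat e ×ˢ (I ×ˢ I), 1 / ((qform a b c (φ ⟨e, s⟩).1 : ℝ) +
        qform a b c (φ ⟨e, s⟩).2) = (∑ u ∈ Lat e, 1 / (qform a b c u : ℝ)) *
          ∑ g ∈ I, ∑ k ∈ I, 1 / ((g : ℝ) ^ 2 + (k : ℝ) ^ 2 * (√Δ / e) ^ 2) := by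
      rw [Finset.sum_product, Finset.sum_mul]
      refine Finset.sum_congr rfl fun u hu => ?_
      rw [Finset.sum_product, Finset.mul_sum]
      refine Finset.sum_congr rfl fun g _ => ?_
      rw [Finset.mul_sum]
      refine Finset.sum_congr rfl fun k _ => ?_
      rw [hval e he u hu g k, one_div_mul_one_div]
    rw [heq]
    have k1 := sum_sum_natAbs_le M (y := √Δ / e) (by positivity)
    have k2 := sum_lattice_le hΔ h hb hac (e := e) (by exact_mod_cast he0)
      (Finset.mem_filter.mp he).2.2 (Lat e) (fun u hu => (Finset.mem_filter.mp hu).2.1) (M := M)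
      (fun u hu => by
        have := (Finset.mem_product.mp (Finset.mem_filter.mp hu).1).2
        rw [Finset.mem_Icc] at this
        lia)
      (fun u hu => (Finset.mem_filter.mp hu).2.2.1) (fun u hu => (Finset.mem_filter.mp hu).2.2.2)
    have hS : 0 ≤ ∑ u ∈ Lat e, 1 / (qform a b c u : ℝ) :=
      Finset.sum_nonneg fun u _ => div_nonneg zero_le_one (hqpos u)
    have hlog : 0 ≤ log (M : ℝ) := Real.log_natCast_nonneg M
    calc _ ≤ (∑ u ∈ Lat e, 1 / (qform a b c u : ℝ)) * (8 / (√Δ / e) * (1 + log M)) := by gcongr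
      _ = 8 / √Δ * (1 + log M) * (e * ∑ u ∈ Lat e, 1 / (qform a b c u : ℝ)) := by
        have : √(Δ : ℝ) ≠ 0 := by positivity
        field_simp
      _ ≤ _ := by
        push_cast at k2 ⊢
        gcongr
  refine (Finset.sum_le_sum hstep).trans ?_
  rw [Finset.sum_const, nsmul_eq_mul]
  have hlog : 0 ≤ log (M : ℝ) := Real.log_natCast_nonneg M
  have hlog2 : 0 ≤ log ((2 * M : ℕ) : ℝ) := Real.log_natCast_nonneg _
  have hcard : (D.card : ℝ) ≤ Δ.toNat.divisors.card := by
    exact_mod_cast Finset.card_filter_le _ _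
  gcongr

theorem conjPair_or_conjPair {Δ a b c : ℤ} (hΔ : 0 < Δ) (h : 4 * a * c - b ^ 2 = Δ)
    {U V : ℤ × ℤ} (hU : U ≠ 0) (hV : V ≠ 0)
    (hbil : (2 * a * U.1 + b * U.2) * V.1 + (b * U.1 + 2 * c * U.2) * V.2 = 0) :
    ConjPair Δ a b c (U, V) ∨ ConjPair Δ a b c (V, U) := by
  have key : ∀ W : ℤ × ℤ, W ≠ 0 → ∃ (w : ℤ × ℤ) (k : ℤ), k ≠ 0 ∧ W = (k * w.1, k * w.2) ∧
      IsCoprime w.1 w.2 := by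
    intro W hW
    have hpos : 0 < Int.gcd W.1 W.2 := by
      rw [Int.gcd_pos_iff]
      by_contra hcon
      push Not at hcon
      exact hW (Prod.ext hcon.1 hcon.2)
    obtain ⟨m, n, h1, h2, h3⟩ := Int.exists_gcd_one hpos
    exact ⟨(m, n), Int.gcd W.1 W.2, by exact_mod_cast hpos.ne',
      Prod.ext (h2.trans (mul_comm _ _)) (h3.trans (mul_comm _ _)),
      Int.isCoprime_iff_gcd_eq_one.mpr h1⟩
  obtain ⟨u, g, hg, hUg, hu⟩ := key U hU
  obtain ⟨v, k, hk, hVk, hv⟩ := key V hV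
  obtain ⟨s, t, hst⟩ := hv
  obtain ⟨s', t', hst'⟩ := hu
  have hbil' : (2 * a * u.1 + b * u.2) * v.1 + (b * u.1 + 2 * c * u.2) * v.2 = 0 := by
    rw [hUg, hVk] at hbil
    have : (g * k) * ((2 * a * u.1 + b * u.2) * v.1 + (b * u.1 + 2 * c * u.2) * v.2) = 0 := by
      simp only at hbil; linear_combination hbil
    exact (mul_eq_zero.mp this).resolve_left (mul_ne_zero hg hk)
  set p := 2 * a * u.1 + b * u.2 with hp
  set q := b * u.1 + 2 * c * u.2 with hq
  set e := s * q - t * p with he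
  have e1 : e * v.1 = q := by rw [he]; linear_combination q * hst - t * hbil'
  have e2 : e * v.2 = -p := by rw [he]; linear_combination -p * hst + s * hbil'
  set p' := 2 * a * v.1 + b * v.2 with hp'
  set q' := b * v.1 + 2 * c * v.2 with hq'
  have f1 : e * q' = -Δ * u.1 := by
    have : e * q' = b * (e * v.1) + 2 * c * (e * v.2) := by rw [hq']; ring
    rw [this, e1, e2, hp, hq, ← h]; ring
  have f2 : e * p' = Δ * u.2 := by
    have : e * p' = 2 * a * (e * v.1) + b * (e * v.2) := by rw [hp']; ring
    rw [this, e1, e2, hp, hq, ← h]; ring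
  have hed : e ∣ Δ := ⟨-s' * q' + t' * p', by linear_combination -Δ * hst' + s' * f1 - t' * f2⟩
  have he0 : e ≠ 0 := by
    rintro h0
    rw [h0] at hed
    exact hΔ.ne' (zero_dvd_iff.mp hed)
  obtain ⟨σ, hσ, hσe⟩ : ∃ σ : ℤ, σ * σ = 1 ∧ (e.natAbs : ℤ) = σ * e := by
    rcases Int.natAbs_eq e with h' | h'
    · exact ⟨1, by norm_num, by lia⟩
    · exact ⟨-1, by norm_num, by lia⟩
  obtain ⟨e', he'⟩ := hed
  have hn0 : 0 < e.natAbs := Int.natAbs_pos.mpr he0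
  have hnd : (e.natAbs : ℤ) ∣ Δ := Int.natAbs_dvd.mpr ⟨e', he'⟩
  have g1 : q' = -e' * u.1 := mul_left_cancel₀ he0 (by rw [f1, he']; ring)
  have g2 : p' = e' * u.2 := mul_left_cancel₀ he0 (by rw [f2, he']; ring)
  rcases le_or_gt ((e.natAbs : ℤ) ^ 2) Δ with hle | hgt
  · left
    refine ⟨e.natAbs, u, g, σ * k, hn0, hle, hnd, Int.natAbs_dvd.mpr ?_, Int.natAbs_dvd.mpr ?_,
      hUg, ?_, ?_⟩
    · exact ⟨-v.2, by linear_combination e2⟩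
    · exact ⟨v.1, e1.symm⟩
    · rw [hVk, hσe]; simp only; rw [← hq]; linear_combination σ * k * e1
    · rw [hVk, hσe]; simp only; rw [← hp]; linear_combination σ * k * e2
  · right
    have he'e : (e'.natAbs : ℤ) = σ * e' := by
      have h1 : (e.natAbs : ℤ) * e'.natAbs = Δ := by
        have := congrArg Int.natAbs he'
        rw [Int.natAbs_mul] at this
        rw [← Int.natAbs_of_nonneg hΔ.le, this]; push_cast; rfl
      have h2 : (e.natAbs : ℤ) * (σ * e') = Δ := by rw [hσe, he']; linear_combination (e * e') * hσ
      exact mul_left_cancel₀ (by positivity) (h1.trans h2.symm)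
    have hprod : (e.natAbs : ℤ) * e'.natAbs = Δ := by
      rw [hσe, he'e, he']; linear_combination (e * e') * hσ
    have hn0' : 0 < e'.natAbs := by
      rw [Int.natAbs_pos]; rintro rfl; simp at he'; lia
    have hlt : (e'.natAbs : ℤ) ≤ e.natAbs := by
      by_contra hcon
      nlinarith
    refine ⟨e'.natAbs, v, k, -σ * g, hn0', by nlinarith, Dvd.intro_left _ hprod,
      Int.natAbs_dvd.mpr ⟨u.2, g2⟩, Int.natAbs_dvd.mpr ⟨-u.1, by rw [← hq', g1]; ring⟩, hVk, ?_, ?_⟩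
    · rw [hUg, he'e]; simp only; rw [← hq', g1]; ring
    · rw [hUg, he'e]; simp only; rw [← hp', g2]; ring

theorem sum_offDiag_le {Δ a b c : ℤ} (hΔ : 0 < Δ) (h : IsPrimPosForm Δ a b c) (hb : |b| ≤ a)
    (hac : a ≤ c) {K : ℕ} (B : Finset (ℤ × ℤ))
    (hB : ∀ x ∈ B, 0 ≤ x.1 ∧ x.1 ≤ K ∧ 0 < x.2 ∧ x.2 ≤ K) :
    ∑ z ∈ (B ×ˢ B).filter (fun z => qform a b c z.1 = qform a b c z.2 ∧ z.1 ≠ z.2),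
      1 / (qform a b c z.1 : ℝ) ≤
      8 * (Δ.toNat.divisors.card * (8 / √Δ * (1 + log ((2 * K : ℕ) : ℝ)) *
        (144 + 64 * (1 + log ((2 * (2 * K) : ℕ) : ℝ)) / √Δ))) := by
  classical
  set S := (B ×ˢ B).filter (fun z => qform a b c z.1 = qform a b c z.2 ∧ z.1 ≠ z.2) with hS
  set ψ : (ℤ × ℤ) × (ℤ × ℤ) → (ℤ × ℤ) × (ℤ × ℤ) := fun z => (z.1 + z.2, z.1 - z.2) with hψ
  set ψ' : (ℤ × ℤ) × (ℤ × ℤ) → (ℤ × ℤ) × (ℤ × ℤ) := fun z => (z.1 - z.2, z.1 + z.2) with hψ'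
  have hinj : Function.Injective ψ := by
    intro z z' hz
    simp only [hψ, Prod.ext_iff, Prod.fst_add, Prod.snd_add, Prod.fst_sub,
      Prod.snd_sub] at hz
    ext <;> lia
  have hinj' : Function.Injective ψ' := by
    intro z z' hz
    simp only [hψ', Prod.ext_iff, Prod.fst_add, Prod.snd_add, Prod.fst_sub,
      Prod.snd_sub] at hz
    ext <;> lia
  have hSm : ∀ z ∈ S, z.1 ∈ B ∧ z.2 ∈ B ∧ qform a b c z.1 = qform a b c z.2 ∧ z.1 ≠ z.2 := by
    intro z hz
    obtain ⟨h1, h2⟩ := Finset.mem_filter.mp hz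
    obtain ⟨h3, h4⟩ := Finset.mem_product.mp h1
    exact ⟨h3, h4, h2⟩
  have hp : ∀ z ∈ S, z.1 + z.2 ≠ 0 := by
    intro z hz h0
    obtain ⟨h1, h2, -⟩ := hSm z hz
    have := (hB _ h1).2.2.1
    have := (hB _ h2).2.2.1
    have := congrArg Prod.snd h0
    simp only [Prod.snd_add, Prod.snd_zero] at this
    lia
  have hm : ∀ z ∈ S, z.1 - z.2 ≠ 0 := fun z hz => sub_ne_zero.mpr (hSm z hz).2.2.2
  have hbd : ∀ z ∈ S, ((z.1 + z.2).1.natAbs ≤ 2 * K ∧ (z.1 + z.2).2.natAbs ≤ 2 * K) ∧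
      ((z.1 - z.2).1.natAbs ≤ 2 * K ∧ (z.1 - z.2).2.natAbs ≤ 2 * K) := by
    intro z hz
    obtain ⟨h1, h2, -⟩ := hSm z hz
    have := hB _ h1
    have := hB _ h2
    simp only [Prod.snd_add, Prod.fst_add, Prod.fst_sub, Prod.snd_sub]
    lia
  have hval : ∀ z ∈ S, 1 / (qform a b c z.1 : ℝ) = 4 *
      (1 / ((qform a b c (z.1 + z.2) : ℝ) + qform a b c (z.1 - z.2))) := by
    intro z hz
    have h1 : qform a b c (z.1 + z.2) + qform a b c (z.1 - z.2) = 4 * qform a b c z.1 := by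
      have : qform a b c (z.1 + z.2) + qform a b c (z.1 - z.2) =
          2 * qform a b c z.1 + 2 * qform a b c z.2 := by
        simp only [qform, Prod.snd_add, Prod.fst_add, Prod.fst_sub, Prod.snd_sub]; ring
      rw [this, ← (hSm z hz).2.2.1]; ring
    have h2 : (qform a b c (z.1 + z.2) : ℝ) + qform a b c (z.1 - z.2) =
        4 * (qform a b c z.1 : ℝ) := by exact_mod_cast h1
    rw [h2, one_div, one_div, mul_inv]
    ring
  have hor : ∀ z ∈ S, ConjPair Δ a b c (ψ z) ∨ ConjPair Δ a b c (ψ' z) := by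
    intro z hz
    refine conjPair_or_conjPair hΔ h.disc (hp z hz) (hm z hz) ?_
    have := (hSm z hz).2.2.1
    simp only [qform, Prod.snd_add, Prod.fst_add, Prod.fst_sub, Prod.snd_sub] at this ⊢
    linear_combination 2 * this
  rw [Finset.sum_congr rfl hval, ← Finset.mul_sum,
    ← Finset.sum_filter_add_sum_filter_not S (fun z => ConjPair Δ a b c (ψ z))]
  have t1 := sum_conjPair_le hΔ h hb hac (M := 2 * K)
    ((S.filter fun z => ConjPair Δ a b c (ψ z)).image ψ)
    (by
      simp only [Finset.mem_image, Finset.mem_filter]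
      rintro _ ⟨z, ⟨hz, hc⟩, rfl⟩; exact hc)
    (by
      simp only [Finset.mem_image, Finset.mem_filter]
      rintro _ ⟨z, ⟨hz, hc⟩, rfl⟩; exact hp z hz)
    (by
      simp only [Finset.mem_image, Finset.mem_filter]
      rintro _ ⟨z, ⟨hz, hc⟩, rfl⟩; exact hm z hz)
    (by
      simp only [Finset.mem_image, Finset.mem_filter]
      rintro _ ⟨z, ⟨hz, hc⟩, rfl⟩; exact (hbd z hz).1)
    (by
      simp only [Finset.mem_image, Finset.mem_filter]
      rintro _ ⟨z, ⟨hz, hc⟩, rfl⟩; exact (hbd z hz).2)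
  have t2 := sum_conjPair_le hΔ h hb hac (M := 2 * K)
    ((S.filter fun z => ¬ ConjPair Δ a b c (ψ z)).image ψ')
    (by
      simp only [Finset.mem_image, Finset.mem_filter]
      rintro _ ⟨z, ⟨hz, hc⟩, rfl⟩; exact (hor z hz).resolve_left hc)
    (by
      simp only [Finset.mem_image, Finset.mem_filter]
      rintro _ ⟨z, ⟨hz, hc⟩, rfl⟩; exact hm z hz)
    (by
      simp only [Finset.mem_image, Finset.mem_filter]
      rintro _ ⟨z, ⟨hz, hc⟩, rfl⟩; exact hp z hz)
    (by
      simp only [Finset.mem_image, Finset.mem_filter]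
      rintro _ ⟨z, ⟨hz, hc⟩, rfl⟩; exact (hbd z hz).2)
    (by
      simp only [Finset.mem_image, Finset.mem_filter]
      rintro _ ⟨z, ⟨hz, hc⟩, rfl⟩; exact (hbd z hz).1)
  rw [Finset.sum_image (fun _ _ _ _ h => hinj h)] at t1
  rw [Finset.sum_image (fun _ _ _ _ h => hinj' h)] at t2
  have t3 : ∑ z ∈ S.filter (fun z => ¬ ConjPair Δ a b c (ψ z)),
      1 / ((qform a b c (z.1 + z.2) : ℝ) + qform a b c (z.1 - z.2)) =
      ∑ z ∈ S.filter (fun z => ¬ ConjPair Δ a b c (ψ z)),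
        1 / ((qform a b c (ψ' z).1 : ℝ) + qform a b c (ψ' z).2) :=
    Finset.sum_congr rfl fun z _ => by simp only [hψ']; rw [add_comm]
  rw [t3]
  simp only [hψ] at t1
  linarith

theorem sq_sum_one_div_le {ι : Type*} [DecidableEq ι] (B : Finset ι) (f : ι → ℕ) :
    (∑ x ∈ B, 1 / (f x : ℝ)) ^ 2 ≤ (∑ n ∈ B.image f, 1 / (n : ℝ)) *
      (∑ x ∈ B, 1 / (f x : ℝ) +
        ∑ z ∈ (B ×ˢ B).filter (fun z => f z.1 = f z.2 ∧ z.1 ≠ z.2), 1 / (f z.1 : ℝ)) := by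
  set r : ℕ → ℝ := fun n => ((B.filter fun x => f x = n).card : ℝ) with hr
  have h1 : ∑ x ∈ B, 1 / (f x : ℝ) = ∑ n ∈ B.image f, r n / n := by
    rw [← Finset.sum_fiberwise_of_maps_to (g := f) (t := B.image f)
      fun x hx => Finset.mem_image_of_mem _ hx]
    refine Finset.sum_congr rfl fun n _ => ?_
    rw [Finset.sum_congr rfl (g := fun _ => 1 / (n : ℝ)) fun x hx => by
      rw [(Finset.mem_filter.mp hx).2], Finset.sum_const, nsmul_eq_mul, mul_one_div]
  have h2 : ∑ x ∈ B, 1 / (f x : ℝ) +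
        ∑ z ∈ (B ×ˢ B).filter (fun z => f z.1 = f z.2 ∧ z.1 ≠ z.2), 1 / (f z.1 : ℝ) =
      ∑ n ∈ B.image f, r n ^ 2 / n := by
    have e1 : ∑ x ∈ B, 1 / (f x : ℝ) +
        ∑ z ∈ (B ×ˢ B).filter (fun z => f z.1 = f z.2 ∧ z.1 ≠ z.2), 1 / (f z.1 : ℝ) =
        ∑ x ∈ B, ∑ y ∈ B.filter (fun y => f y = f x), 1 / (f x : ℝ) := by
      rw [Finset.sum_filter, Finset.sum_product, ← Finset.sum_add_distrib]
      refine Finset.sum_congr rfl fun x hx => ?_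
      rw [← Finset.sum_filter, ← Finset.sum_erase_add (B.filter fun y => f y = f x) _
        (Finset.mem_filter.mpr ⟨hx, rfl⟩), add_comm]
      congr 1
      refine Finset.sum_congr ?_ fun _ _ => rfl
      ext y
      simp only [Finset.mem_filter, Finset.mem_erase]
      tauto
    rw [e1, ← Finset.sum_fiberwise_of_maps_to (g := f) (t := B.image f)
      fun x hx => Finset.mem_image_of_mem _ hx]
    refine Finset.sum_congr rfl fun n _ => ?_
    rw [Finset.sum_congr rfl (g := fun _ => r n / (n : ℝ)) fun x hx => by
      rw [(Finset.mem_filter.mp hx).2, Finset.sum_const, nsmul_eq_mul, mul_one_div],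
      Finset.sum_const, nsmul_eq_mul]
    simp only [hr]
    ring
  rw [h2, h1]
  refine Finset.sum_sq_le_sum_mul_sum_of_sq_le_mul _ (fun _ _ => by positivity)
    (fun _ _ => by positivity) fun n _ => ?_
  exact le_of_eq (by ring)

/-- The lattice points used for the lower bound on the density of represented numbers. -/
noncomputable def boxPoints (a c : ℤ) (N : ℕ) : Finset (ℤ × ℤ) :=
  (Finset.Icc (1 : ℤ) (N ^ 2) ×ˢ Finset.Icc (1 : ℤ) N).filter fun x => a * x.1 ^ 2 ≤ c * x.2 ^ 2

theorem qform_le_of_mem_boxPoints {a b c : ℤ} (hb : |b| ≤ a) (hac : a ≤ c) {N : ℕ}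
    {x : ℤ × ℤ} (hx : x ∈ boxPoints a c N) : qform a b c x ≤ 3 * c * x.2 ^ 2 := by
  have h1 := (Finset.mem_filter.mp hx).2
  obtain ⟨h2, h3⟩ := abs_le.mp hb
  unfold qform
  have e1 : 0 ≤ (a - b) * (x.1 ^ 2 + x.2 ^ 2) := mul_nonneg (by linarith) (by positivity)
  have e2 : 0 ≤ (a + b) * (x.1 - x.2) ^ 2 := mul_nonneg (by linarith) (sq_nonneg _)
  have e4 : 0 ≤ (a - b) * (x.1 - x.2) ^ 2 := mul_nonneg (by linarith) (sq_nonneg _)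
  have e5 : 0 ≤ (a - b) * (x.1 + x.2) ^ 2 := mul_nonneg (by linarith) (sq_nonneg _)
  have e3 : 0 ≤ (c - a) * x.2 ^ 2 := mul_nonneg (by linarith) (sq_nonneg _)
  nlinarith

theorem le_sum_boxPoints {a c : ℤ} (ha : 0 < a) (hac : a ≤ c) {N : ℕ}
    (hN : c ≤ N) :
    1 / (6 * √((a : ℝ) * c)) * log N ≤
      ∑ x ∈ boxPoints a c N, 1 / ((3 * c * x.2 ^ 2 : ℤ) : ℝ) := by
  have hc : 0 < c := by lia
  have ha' : (0 : ℝ) < a := by exact_mod_cast ha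
  have hc' : (0 : ℝ) < c := by exact_mod_cast hc
  have hac' : (a : ℝ) ≤ c := by exact_mod_cast hac
  have hN0 : 0 < N := by lia
  set ρ := √((c : ℝ) / a) with hρ
  have hρ1 : 1 ≤ ρ := by
    rw [hρ]; apply Real.one_le_sqrt.mpr; rw [le_div_iff₀ ha']; linarith
  have hρsq : ρ ^ 2 = c / a := Real.sq_sqrt (by positivity)
  have hsub : ((Finset.Icc 1 N).sigma (fun v => Finset.Icc 1 ⌊ρ * v⌋₊)).image
      (fun z : Σ _ : ℕ, ℕ => ((z.2 : ℤ), (z.1 : ℤ))) ⊆ boxPoints a c N := by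
    intro x hx
    obtain ⟨⟨v, u⟩, hz, rfl⟩ := Finset.mem_image.mp hx
    simp only [Finset.mem_sigma, Finset.mem_Icc] at hz
    obtain ⟨⟨hv1, hv2⟩, hu1, hu2⟩ := hz
    have hu3 : (u : ℝ) ≤ ρ * v := (Nat.le_floor_iff (by positivity)).mp hu2
    have hu4 : (a : ℝ) * (u : ℝ) ^ 2 ≤ c * (v : ℝ) ^ 2 := by
      calc (a : ℝ) * (u : ℝ) ^ 2 ≤ a * (ρ * v) ^ 2 := by gcongr
        _ = c * (v : ℝ) ^ 2 := by rw [mul_pow, hρsq]; field_simp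
    have hu5 : a * (u : ℤ) ^ 2 ≤ c * (v : ℤ) ^ 2 := by exact_mod_cast hu4
    simp only [boxPoints, Finset.mem_filter, Finset.mem_product, Finset.mem_Icc]
    refine ⟨⟨⟨by exact_mod_cast hu1, ?_⟩, by exact_mod_cast hv1, by exact_mod_cast hv2⟩, hu5⟩
    have h6 : (u : ℤ) ^ 2 ≤ (N : ℤ) ^ 3 := by
      calc (u : ℤ) ^ 2 ≤ a * (u : ℤ) ^ 2 := le_mul_of_one_le_left (by positivity) ha
        _ ≤ c * (v : ℤ) ^ 2 := hu5
        _ ≤ N * (N : ℤ) ^ 2 := by gcongr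
        _ = _ := by ring
    have h7 : (N : ℤ) ^ 3 ≤ ((N : ℤ) ^ 2) ^ 2 := by
      rw [← pow_mul]
      exact pow_le_pow_right₀ (by exact_mod_cast hN0) (by norm_num)
    exact abs_le_of_sq_le_sq' (h6.trans h7) (by positivity) |>.2
  refine le_trans ?_ (Finset.sum_le_sum_of_subset_of_nonneg hsub fun x _ _ => by positivity)
  rw [Finset.sum_image, Finset.sum_sigma]
  · have hrow : ∀ v ∈ Finset.Icc 1 N, 1 / (6 * √((a : ℝ) * c)) * (1 / (v : ℝ)) ≤
        ∑ s ∈ Finset.Icc 1 ⌊ρ * v⌋₊, 1 / ((3 * c * (v : ℤ) ^ 2 : ℤ) : ℝ) := by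
      intro v hv
      have hv1 : (1 : ℝ) ≤ v := by exact_mod_cast (Finset.mem_Icc.mp hv).1
      rw [Finset.sum_const, Nat.card_Icc, Nat.add_sub_cancel, nsmul_eq_mul]
      have hfl : ρ * v / 2 ≤ (⌊ρ * v⌋₊ : ℝ) := by
        have h1 : 1 ≤ ρ * v := by nlinarith
        have h2 : 1 ≤ ⌊ρ * v⌋₊ := Nat.le_floor (by simpa using h1)
        have h2' : (1 : ℝ) ≤ (⌊ρ * v⌋₊ : ℝ) := by exact_mod_cast h2
        have h3 := Nat.lt_floor_add_one (ρ * v)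
        linarith
      push_cast
      have hsq : √((a : ℝ) * c) = c / ρ := by
        rw [eq_div_iff (by positivity), hρ, ← Real.sqrt_mul (by positivity)]
        rw [show (a : ℝ) * c * (c / a) = c ^ 2 by field_simp, Real.sqrt_sq hc'.le]
      calc 1 / (6 * √((a : ℝ) * c)) * (1 / (v : ℝ)) =
          (ρ * v / 2) * (1 / (3 * c * (v : ℝ) ^ 2)) := by
            rw [hsq]; field_simp; norm_num
        _ ≤ _ := by gcongr
    refine le_trans ?_ (Finset.sum_le_sum hrow)
    rw [← Finset.mul_sum]
    gcongr
    have h8 := log_add_one_le_harmonic N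
    rw [harmonic_eq_sum_Icc] at h8
    push_cast at h8
    have h9 : log (N : ℝ) ≤ log ((N : ℝ) + 1) := Real.log_le_log (by exact_mod_cast hN0) (by linarith)
    simpa using h9.trans h8
  · rintro ⟨v, u⟩ _ ⟨v', u'⟩ _ hz
    simp only [Prod.mk.injEq, Nat.cast_inj] at hz
    rw [hz.1, hz.2]

theorem inv_le_of_sq_le_mul {M T L d s o : ℝ} (hs : 0 < s) (hL : s ≤ L) (hd : 1 ≤ d) (hT : 0 ≤ T)
    (ho : 0 ≤ o) (hM : L / (4 * s) ≤ M) (hob : o ≤ 148480 * d * L ^ 2 / s ^ 2)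
    (h : M ^ 2 ≤ T * (M + o)) : 1 / (2400000 * d) ≤ T := by
  set m := L / (4 * s) with hm
  have hL0 : 0 < L := hs.trans_le hL
  have hm0 : 0 < m := by positivity
  have hTm : m ^ 2 ≤ T * (m + o) := by
    have hM0 : 0 < M := lt_of_lt_of_le hm0 hM
    have h1 : m * (M + o) ≤ M * (m + o) := by nlinarith
    have h2 : m * M ≤ T * (m + o) := by
      have h3 : M * (m * M) ≤ M * (T * (m + o)) := by
        calc M * (m * M) = m * M ^ 2 := by ring
          _ ≤ m * (T * (M + o)) := by gcongr
          _ = T * (m * (M + o)) := by ring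
          _ ≤ T * (M * (m + o)) := by gcongr
          _ = _ := by ring
      exact le_of_mul_le_mul_left h3 hM0
    nlinarith
  have hmb : m ≤ d * L ^ 2 / s ^ 2 := by
    rw [hm, div_le_div_iff₀ (by positivity) (by positivity)]
    calc L * s ^ 2 = 1 * L * s * (1 * s) := by ring
      _ ≤ d * L * L * (4 * s) := by gcongr; norm_num
      _ = _ := by ring
  have h1 : m ^ 2 ≤ T * (148481 * d * L ^ 2 / s ^ 2) := by
    refine hTm.trans ?_
    gcongr
    calc m + o ≤ d * L ^ 2 / s ^ 2 + 148480 * d * L ^ 2 / s ^ 2 := by gcongr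
      _ = _ := by ring
  have h2 : m ^ 2 = L ^ 2 / s ^ 2 * (1 / 16) := by
    rw [hm, div_pow, mul_pow]; ring
  have h3 : T * (148481 * d * L ^ 2 / s ^ 2) = L ^ 2 / s ^ 2 * (T * (148481 * d)) := by ring
  rw [h2, h3] at h1
  have h4 : 1 / 16 ≤ T * (148481 * d) := le_of_mul_le_mul_left h1 (by positivity)
  rw [div_le_iff₀ (by positivity)]
  nlinarith

set_option maxHeartbeats 800000 in
theorem exists_finset_represents {Δ a b c : ℤ} (hΔ : 0 < Δ) (h : IsPrimPosForm Δ a b c)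
    (hb : |b| ≤ a) (hac : a ≤ c) {N : ℕ} (hN : Δ ≤ N) (hL : √Δ ≤ log N) :
    ∃ A : Finset ℕ, (∀ n ∈ A, Represents a b c n ∧ n ≤ N ^ 3) ∧
      1 / (2400000 * (Δ.toNat.divisors.card : ℝ)) ≤ ∑ n ∈ A, 1 / (n : ℝ) := by
  have ha := h.pos
  have hc : 0 < c := by lia
  have hΔ' : (0 : ℝ) < Δ := by exact_mod_cast hΔ
  have hac3 : 3 * (a * c) ≤ Δ := by
    rw [← h.disc]
    have : b ^ 2 ≤ a * c := by
      calc b ^ 2 = |b| ^ 2 := (sq_abs b).symm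
        _ ≤ a ^ 2 := by gcongr
        _ ≤ a * c := by nlinarith
    linarith
  have hc3 : 3 * c ≤ Δ := by nlinarith
  have hN1 : 1 ≤ N := by lia
  have hL1 : 1 ≤ log N := by
    refine le_trans (Real.one_le_sqrt.mpr ?_) hL
    exact_mod_cast hΔ
  set L := log N with hLdef
  set B := boxPoints a c N with hB
  set f : ℤ × ℤ → ℕ := fun x => (qform a b c x).toNat with hf
  have hBm : ∀ x ∈ B, 0 < x.1 ∧ x.1 ≤ (N ^ 2 : ℕ) ∧ 0 < x.2 ∧ x.2 ≤ (N ^ 2 : ℕ) ∧ x.2 ≤ N := by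
    intro x hx
    have h1 := Finset.mem_product.mp (Finset.mem_filter.mp hx).1
    rw [Finset.mem_Icc, Finset.mem_Icc] at h1
    have : (N : ℤ) ≤ N ^ 2 := by nlinarith
    push_cast
    lia
  have hpos : ∀ x ∈ B, 0 < qform a b c x := fun x hx => qform_pos hΔ h (fun h0 => by
    have := (hBm x hx).1; simp [h0] at this)
  have hfq : ∀ x ∈ B, (f x : ℤ) = qform a b c x := fun x hx => Int.toNat_of_nonneg (hpos x hx).le
  have hfq' : ∀ x ∈ B, (f x : ℝ) = qform a b c x := fun x hx => by exact_mod_cast hfq x hx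
  have hM1 : L / (4 * √Δ) ≤ ∑ x ∈ B, 1 / (f x : ℝ) := by
    calc L / (4 * √Δ) ≤ 1 / (6 * √((a : ℝ) * c)) * L := by
          have : 6 * √((a : ℝ) * c) ≤ 4 * √Δ := by
            rw [← Real.sqrt_sq (show (0 : ℝ) ≤ 6 by norm_num),
              ← Real.sqrt_sq (show (0 : ℝ) ≤ 4 by norm_num), ← Real.sqrt_mul (by positivity),
              ← Real.sqrt_mul (by positivity)]
            apply Real.sqrt_le_sqrt
            have : (3 * ((a : ℝ) * c)) ≤ Δ := by exact_mod_cast hac3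
            linarith
          rw [div_eq_mul_one_div, mul_comm]
          have ha' : (0 : ℝ) < a := by exact_mod_cast ha
          have hc' : (0 : ℝ) < c := by exact_mod_cast hc
          gcongr
      _ ≤ ∑ x ∈ B, 1 / ((3 * c * x.2 ^ 2 : ℤ) : ℝ) := le_sum_boxPoints ha hac (by lia)
      _ ≤ _ := by
          refine Finset.sum_le_sum fun x hx => ?_
          rw [hfq' x hx]
          have h1 : (0 : ℝ) < qform a b c x := by exact_mod_cast hpos x hx
          have h2 : (qform a b c x : ℝ) ≤ ((3 * c * x.2 ^ 2 : ℤ) : ℝ) := by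
            exact_mod_cast qform_le_of_mem_boxPoints hb hac hx
          exact one_div_le_one_div_of_le h1 h2
  have hoff := sum_offDiag_le hΔ h hb hac (K := N ^ 2) B
    (fun x hx => ⟨(hBm x hx).1.le, (hBm x hx).2.1, (hBm x hx).2.2.1, (hBm x hx).2.2.2.1⟩)
  have hoff' : ∑ z ∈ (B ×ˢ B).filter (fun z => f z.1 = f z.2 ∧ z.1 ≠ z.2), 1 / (f z.1 : ℝ) =
      ∑ z ∈ (B ×ˢ B).filter (fun z => qform a b c z.1 = qform a b c z.2 ∧ z.1 ≠ z.2),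
        1 / (qform a b c z.1 : ℝ) := by
    have : (B ×ˢ B).filter (fun z => f z.1 = f z.2 ∧ z.1 ≠ z.2) =
        (B ×ˢ B).filter (fun z => qform a b c z.1 = qform a b c z.2 ∧ z.1 ≠ z.2) := by
      refine Finset.filter_congr fun z hz => ?_
      obtain ⟨h1, h2⟩ := Finset.mem_product.mp hz
      rw [← hfq _ h1, ← hfq _ h2, Nat.cast_inj]
    rw [this]
    refine Finset.sum_congr rfl fun z hz => ?_
    rw [hfq' _ (Finset.mem_product.mp (Finset.mem_filter.mp hz).1).1]
  have hcs := sq_sum_one_div_le B f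
  rw [hoff'] at hcs
  set off := ∑ z ∈ (B ×ˢ B).filter (fun z => qform a b c z.1 = qform a b c z.2 ∧ z.1 ≠ z.2),
        1 / (qform a b c z.1 : ℝ) with hoffdef
  set M1 := ∑ x ∈ B, 1 / (f x : ℝ) with hM1def
  set T := ∑ n ∈ B.image f, 1 / (n : ℝ) with hT
  set d : ℝ := (Δ.toNat.divisors.card : ℝ) with hd
  have hd1 : 1 ≤ d := by
    rw [hd]
    exact_mod_cast Finset.card_pos.mpr ⟨1, Nat.one_mem_divisors.mpr (by lia)⟩
  have hsΔ : 0 < √(Δ : ℝ) := by positivity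
  have hss : √(Δ : ℝ) * √Δ = Δ := Real.mul_self_sqrt hΔ'.le
  have hN0 : (0 : ℝ) < N := by exact_mod_cast hN1
  have hlog2 : log (2 : ℝ) ≤ 1 := by have := Real.log_two_lt_d9; linarith
  have hl1 : log ((2 * N ^ 2 : ℕ) : ℝ) ≤ 1 + 2 * L := by
    push_cast
    rw [Real.log_mul (by norm_num) (by positivity), Real.log_pow]
    push_cast
    linarith
  have hl2 : log ((2 * (2 * N ^ 2) : ℕ) : ℝ) ≤ 2 + 2 * L := by
    push_cast
    rw [Real.log_mul (by norm_num) (by positivity), Real.log_mul (by norm_num) (by positivity),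
      Real.log_pow]
    push_cast
    linarith
  have hl0 : 0 ≤ log ((2 * N ^ 2 : ℕ) : ℝ) := Real.log_natCast_nonneg _
  have hl0' : 0 ≤ log ((2 * (2 * N ^ 2) : ℕ) : ℝ) := Real.log_natCast_nonneg _
  have hoffb : off ≤ 148480 * d * L ^ 2 / Δ := by
    refine hoff.trans ?_
    have h144 : 144 + 64 * (1 + log ((2 * (2 * N ^ 2) : ℕ) : ℝ)) / √Δ ≤ 464 * L / √Δ := by
      rw [le_div_iff₀ hsΔ, add_mul, div_mul_cancel₀ _ hsΔ.ne']
      linarith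
    calc 8 * (d * (8 / √Δ * (1 + log ((2 * N ^ 2 : ℕ) : ℝ)) *
        (144 + 64 * (1 + log ((2 * (2 * N ^ 2) : ℕ) : ℝ)) / √Δ))) ≤
        8 * (d * (8 / √Δ * (5 * L) * (464 * L / √Δ))) := by
          gcongr
          linarith
      _ = 148480 * d * L ^ 2 / (√Δ * √Δ) := by field_simp; norm_num
      _ = _ := by rw [hss]
  have hT0 : 0 ≤ T := Finset.sum_nonneg fun _ _ => by positivity
  have hoff0 : 0 ≤ off := by
    refine Finset.sum_nonneg fun z hz => ?_
    have := hpos z.1 (Finset.mem_product.mp (Finset.mem_filter.mp hz).1).1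
    have : (0 : ℝ) < qform a b c z.1 := by exact_mod_cast this
    positivity
  refine ⟨B.image f, ?_, ?_⟩
  · intro n hn
    obtain ⟨x, hx, rfl⟩ := Finset.mem_image.mp hn
    have h1 := hfq x hx
    have h2 := hpos x hx
    refine ⟨⟨by lia, x.1, x.2, by rw [h1]; rfl⟩, ?_⟩
    have h3 : (f x : ℤ) ≤ (N : ℤ) ^ 3 := by
      rw [h1]
      calc qform a b c x ≤ 3 * c * x.2 ^ 2 := qform_le_of_mem_boxPoints hb hac hx
        _ ≤ N * (N : ℤ) ^ 2 := by
          have := (hBm x hx).2.2.1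
          have := (hBm x hx).2.2.2.2
          gcongr
          linarith
        _ = _ := by ring
    exact_mod_cast h3
  · rw [← hss, ← sq] at hoffb
    exact inv_le_of_sq_le_mul hsΔ hL hd1 hT0 hoff0 hM1 hoffb hcs

/-- The weight `n ^ (-σ) * ∏ p ^ η`, the product being over the `p ∈ S` dividing `n`. -/
noncomputable def primeWeight (S : Finset ℕ) (σ η : ℝ) (n : ℕ) : ℝ :=
  (n : ℝ) ^ (-σ) * ∏ p ∈ S.filter (· ∣ n), (p : ℝ) ^ η

theorem primeWeight_nonneg (S : Finset ℕ) (σ η : ℝ) (n : ℕ) : 0 ≤ primeWeight S σ η n := by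
  unfold primeWeight
  positivity

theorem primeWeight_le {S : Finset ℕ} (hS : ∀ p ∈ S, p.Prime) {σ η : ℝ} (hη : 0 ≤ η) {n : ℕ}
    (hn : 0 < n) : primeWeight S σ η n ≤ (n : ℝ) ^ (-(σ - η)) := by
  have h1 : ∏ p ∈ S.filter (· ∣ n), p ∣ n :=
    Finset.prod_primes_dvd n (fun p hp => (hS p (Finset.mem_filter.mp hp).1).prime)
      fun p hp => (Finset.mem_filter.mp hp).2
  have h2 : ((∏ p ∈ S.filter (· ∣ n), p : ℕ) : ℝ) ≤ n := by exact_mod_cast Nat.le_of_dvd hn h1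
  have hn' : (0 : ℝ) < n := by exact_mod_cast hn
  calc primeWeight S σ η n = (n : ℝ) ^ (-σ) * (∏ p ∈ S.filter (· ∣ n), (p : ℝ)) ^ η := by
        rw [primeWeight, Real.finsetProd_rpow _ _ fun _ _ => by positivity]
    _ ≤ (n : ℝ) ^ (-σ) * (n : ℝ) ^ η := by
        rw [← Nat.cast_prod]
        gcongr
    _ = _ := by rw [← Real.rpow_add hn']; ring_nf

theorem le_primeWeight_mul {S : Finset ℕ} (hS : ∀ p ∈ S, p.Prime) {σ η : ℝ} (hη : 0 ≤ η)
    (p n : ℕ) : (p : ℝ) ^ (-σ) * primeWeight S σ η n ≤ primeWeight S σ η (p * n) := by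
  unfold primeWeight
  rw [Nat.cast_mul, Real.mul_rpow (by positivity) (by positivity), mul_assoc]
  gcongr ?_ * (?_ * ?_)
  have hsub : S.filter (· ∣ n) ⊆ S.filter (· ∣ p * n) := fun q hq => by
    rw [Finset.mem_filter] at hq ⊢
    exact ⟨hq.1, hq.2.mul_left p⟩
  rw [← Finset.prod_sdiff hsub]
  refine le_mul_of_one_le_left (by positivity) (Finset.one_le_prod fun q hq => ?_)
  have hqS := (Finset.mem_filter.mp (Finset.mem_sdiff.mp hq).1).1
  exact Real.one_le_rpow (by exact_mod_cast (hS q hqS).one_le) hη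

theorem primeWeight_insert {S : Finset ℕ} {p : ℕ} (hp : p ∉ S) (σ η : ℝ) (n : ℕ) :
    primeWeight (insert p S) σ η n =
      primeWeight S σ η n + if p ∣ n then ((p : ℝ) ^ η - 1) * primeWeight S σ η n else 0 := by
  unfold primeWeight
  rw [Finset.filter_insert]
  split_ifs with h
  · rw [Finset.prod_insert (by simp [hp])]
    ring
  · simp

theorem IsPrimPosForm.exists_finset_primeWeight {Δ : ℤ} (hΔ : 0 < Δ) {σ s δ : ℝ} (hs : s ≤ σ)
    (base : ∀ a b c, IsPrimPosForm Δ a b c →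
      ∃ A : Finset ℕ, (∀ n ∈ A, Represents a b c n) ∧ δ ≤ ∑ n ∈ A, (n : ℝ) ^ (-σ))
    (S : Finset ℕ) (hS : ∀ p ∈ S, p.Prime ∧ p ≠ 2 ∧ jacobiSym (-Δ) p = 1) {a b c : ℤ}
    (h : IsPrimPosForm Δ a b c) :
    ∃ A : Finset ℕ, (∀ n ∈ A, Represents a b c n) ∧
      δ * ∏ p ∈ S, (1 + (p : ℝ) ^ (-s) - (p : ℝ) ^ (-σ)) ≤
        ∑ n ∈ A, primeWeight S σ (σ - s) n := by
  induction S using Finset.induction_on generalizing a b c with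
  | empty => simpa [primeWeight] using base a b c h
  | insert p S hpS ih =>
    have hS' : ∀ p ∈ S, p.Prime ∧ p ≠ 2 ∧ jacobiSym (-Δ) p = 1 := fun q hq =>
      hS q (Finset.mem_insert_of_mem hq)
    have hSp : ∀ p ∈ S, p.Prime := fun q hq => (hS' q hq).1
    obtain ⟨hp, hp2, hpj⟩ := hS p (Finset.mem_insert_self p S)
    have hp1 : (1 : ℝ) ≤ p := by exact_mod_cast hp.one_le
    obtain ⟨a', b', c', h', hrep⟩ := h.exists_prime_mul hΔ hp hp2 hpj
    obtain ⟨A, hA, hA2⟩ := ih hS' h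
    obtain ⟨A', hA', hA2'⟩ := ih hS' h'
    have hη : 0 ≤ σ - s := by linarith
    have hη1 : 0 ≤ (p : ℝ) ^ (σ - s) - 1 := by linarith [Real.one_le_rpow hp1 hη]
    refine ⟨A ∪ A'.image (p * ·), ?_, ?_⟩
    · intro n hn
      rcases Finset.mem_union.mp hn with hn | hn
      · exact hA n hn
      · obtain ⟨m, hm, rfl⟩ := Finset.mem_image.mp hn
        exact hrep m (hA' m hm)
    · have e1 : ∑ n ∈ A ∪ A'.image (p * ·), primeWeight S σ (σ - s) n ≥
          ∑ n ∈ A, primeWeight S σ (σ - s) n :=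
        Finset.sum_le_sum_of_subset_of_nonneg Finset.subset_union_left
          fun n _ _ => primeWeight_nonneg _ _ _ _
      have e2 : ∑ n ∈ A ∪ A'.image (p * ·),
          (if p ∣ n then ((p : ℝ) ^ (σ - s) - 1) * primeWeight S σ (σ - s) n else 0) ≥
          ((p : ℝ) ^ (σ - s) - 1) * ((p : ℝ) ^ (-σ) * ∑ n ∈ A', primeWeight S σ (σ - s) n) := by
        calc _ ≤ ∑ m ∈ A', ((p : ℝ) ^ (σ - s) - 1) * primeWeight S σ (σ - s) (p * m) := by
              rw [Finset.mul_sum, Finset.mul_sum]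
              exact Finset.sum_le_sum fun m _ =>
                mul_le_mul_of_nonneg_left (le_primeWeight_mul hSp hη p m) hη1
          _ = ∑ n ∈ A'.image (p * ·),
              (if p ∣ n then ((p : ℝ) ^ (σ - s) - 1) * primeWeight S σ (σ - s) n else 0) := by
              rw [Finset.sum_image fun x _ y _ hxy => Nat.eq_of_mul_eq_mul_left hp.pos hxy]
              simp
          _ ≤ _ := Finset.sum_le_sum_of_subset_of_nonneg Finset.subset_union_right
              fun n _ _ => by
                split_ifs
                · exact mul_nonneg hη1 (primeWeight_nonneg _ _ _ _)
                · exact le_rfl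
      rw [Finset.prod_insert hpS, Finset.sum_congr rfl fun n _ => primeWeight_insert hpS _ _ n,
        Finset.sum_add_distrib]
      have e3 : (p : ℝ) ^ (-s) = (p : ℝ) ^ (σ - s) * (p : ℝ) ^ (-σ) := by
        rw [← Real.rpow_add (by linarith)]
        ring_nf
      have e4 := mul_le_mul_of_nonneg_left hA2'
        (mul_nonneg hη1 (Real.rpow_nonneg (by linarith : (0 : ℝ) ≤ p) (-σ)))
      rw [e3]
      linarith

theorem IsPrimPosForm.exists_finset_rpow {Δ a b c : ℤ} (hΔ : 0 < Δ) (h : IsPrimPosForm Δ a b c)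
    {N : ℕ} (hN : Δ ≤ N) (hL : √Δ ≤ log N) :
    ∃ A : Finset ℕ, (∀ n ∈ A, Represents a b c n) ∧
      exp (-3) / (2400000 * (Δ.toNat.divisors.card : ℝ)) ≤
        ∑ n ∈ A, (n : ℝ) ^ (-(1 + 1 / log N)) := by
  obtain ⟨a', b', c', h', hb, hac, hrep⟩ := h.exists_reduced hΔ
  obtain ⟨A, hA, hA2⟩ := exists_finset_represents hΔ h' hb hac hN hL
  refine ⟨A, fun n hn => hrep n (hA n hn).1, ?_⟩
  have hL0 : 0 < log N := lt_of_lt_of_le (Real.sqrt_pos.mpr (by exact_mod_cast hΔ)) hL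
  have hN0 : (0 : ℝ) < N := by exact_mod_cast (by lia : 0 < N)
  calc exp (-3) / (2400000 * (Δ.toNat.divisors.card : ℝ))
      = exp (-3) * (1 / (2400000 * (Δ.toNat.divisors.card : ℝ))) := by ring
    _ ≤ exp (-3) * ∑ n ∈ A, 1 / (n : ℝ) := by gcongr
    _ = ∑ n ∈ A, exp (-3) * (1 / (n : ℝ)) := Finset.mul_sum _ _ _
    _ ≤ _ := by
      refine Finset.sum_le_sum fun n hn => ?_
      obtain ⟨hn1, hn2⟩ := hA n hn
      have hn0 : (0 : ℝ) < n := by exact_mod_cast hn1.1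
      have hlog : log n ≤ 3 * log N := by
        have := Real.log_le_log hn0 (y := (N : ℝ) ^ 3) (by exact_mod_cast hn2)
        rwa [Real.log_pow, Nat.cast_ofNat] at this
      have : log n / log N ≤ 3 := by rwa [div_le_iff₀ hL0]
      rw [Real.rpow_def_of_pos hn0, one_div (n : ℝ), ← Real.exp_log (inv_pos.mpr hn0),
        ← Real.exp_add, Real.log_inv]
      gcongr
      have e : log n * -(1 + 1 / log N) = - log n - log n / log N := by ring
      rw [e]
      linarith

theorem IsPrimPosForm.exists_finset_rpow_mul_prod {Δ a b c : ℤ} (hΔ : 0 < Δ)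
    (h : IsPrimPosForm Δ a b c) {N : ℕ} (hN : Δ ≤ N) (hL : √Δ ≤ log N) {s : ℝ}
    (hs : s ≤ 1 + 1 / log N) (S : Finset ℕ)
    (hS : ∀ p ∈ S, p.Prime ∧ p ≠ 2 ∧ jacobiSym (-Δ) p = 1) :
    ∃ A : Finset ℕ, (∀ n ∈ A, Represents a b c n) ∧
      exp (-3) / (2400000 * (Δ.toNat.divisors.card : ℝ)) *
          ∏ p ∈ S, (1 + (p : ℝ) ^ (-s) - (p : ℝ) ^ (-(1 + 1 / log N))) ≤
        ∑ n ∈ A, (n : ℝ) ^ (-s) := by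
  obtain ⟨A, hA, hA2⟩ := h.exists_finset_primeWeight hΔ hs
    (fun a b c hf => hf.exists_finset_rpow hΔ hN hL) S hS
  refine ⟨A, hA, hA2.trans (Finset.sum_le_sum fun n hn => ?_)⟩
  have := primeWeight_le (σ := 1 + 1 / log N) (fun p hp => (hS p hp).1)
    (sub_nonneg.mpr hs) (hA n hn).1
  rwa [sub_sub_cancel] at this

/-- The quadratic character attached to the discriminant `-Δ`, set to zero at even integers. -/
noncomputable def oddJacobi (Δ : ℤ) : ℕ →*₀ ℝ where
  toFun n := if Odd n then (jacobiSym (-Δ) n : ℝ) else 0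
  map_zero' := by simp
  map_one' := by simp
  map_mul' m n := by
    by_cases hm : Odd m
    · by_cases hn : Odd n
      · have := hm.pos.ne'
        have := hn.pos.ne'
        have : NeZero m := ⟨by assumption⟩
        have : NeZero n := ⟨by assumption⟩
        simp [hm, hn, jacobiSym.mul_right]
      · simp [Nat.odd_mul, hn]
    · simp [Nat.odd_mul, hm]

theorem oddJacobi_apply (Δ : ℤ) (n : ℕ) :
    oddJacobi Δ n = if Odd n then (jacobiSym (-Δ) n : ℝ) else 0 := rfl

theorem oddJacobi_trichotomy (Δ : ℤ) (n : ℕ) :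
    oddJacobi Δ n = 0 ∨ oddJacobi Δ n = 1 ∨ oddJacobi Δ n = -1 := by
  rw [oddJacobi_apply]
  split_ifs
  · rcases jacobiSym.trichotomy (-Δ) n with h | h | h <;> simp [h]
  · simp

theorem abs_oddJacobi_le_one (Δ : ℤ) (n : ℕ) : |oddJacobi Δ n| ≤ 1 := by
  rcases oddJacobi_trichotomy Δ n with h | h | h <;> simp [h]

theorem oddJacobi_mod {Δ : ℤ} (n : ℕ) :
    oddJacobi Δ (n % (4 * Δ.natAbs)) = oddJacobi Δ n := by
  have h1 : Odd (n % (4 * Δ.natAbs)) ↔ Odd n := by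
    rw [Nat.odd_iff, Nat.odd_iff, Nat.mod_mod_of_dvd _ ⟨2 * Δ.natAbs, by ring⟩]
  rw [oddJacobi_apply, oddJacobi_apply]
  simp only [h1]
  split_ifs with h
  · rw [jacobiSym.mod_right (-Δ) h, Int.natAbs_neg]
  · rfl

theorem oddJacobi_sub_one {Δ : ℤ} (hΔ : 0 < Δ) : oddJacobi Δ (4 * Δ.natAbs - 1) = -1 := by
  set m := Δ.natAbs with hm
  have hm0 : 0 < m := by lia
  have hodd : Odd (4 * m - 1) := ⟨2 * m - 1, by lia⟩
  have h3 : (4 * m - 1) % 4 = 3 := by lia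
  have hΔm : Δ = m := by lia
  have h5 : jacobiSym (-Δ) (4 * m - 1) = -1 := by
    calc jacobiSym (-Δ) (4 * m - 1) = jacobiSym 4 (4 * m - 1) * jacobiSym (-Δ) (4 * m - 1) := by
          rw [jacobiSym.at_four hodd, one_mul]
      _ = jacobiSym (-1) (4 * m - 1) := by
          rw [← jacobiSym.mul_left]
          apply jacobiSym.mod_left'
          apply Int.ModEq.symm
          rw [Int.modEq_iff_dvd]
          exact ⟨-1, by push_cast [Nat.cast_sub (show 1 ≤ 4 * m by lia)]; rw [hΔm]; ring⟩
      _ = -1 := by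
          rw [jacobiSym.at_neg_one hodd, ZMod.χ₄_nat_three_mod_four h3]
  rw [oddJacobi_apply, if_pos hodd, h5]
  norm_num

theorem oddJacobi_reflect {Δ : ℤ} (hΔ : 0 < Δ) {n : ℕ} (hn : n ≤ 4 * Δ.natAbs) :
    oddJacobi Δ (4 * Δ.natAbs - n) = - oddJacobi Δ n := by
  have h1 : (n * (4 * Δ.natAbs - 1)) % (4 * Δ.natAbs) =
      (4 * Δ.natAbs - n) % (4 * Δ.natAbs) := by
    change n * (4 * Δ.natAbs - 1) ≡ 4 * Δ.natAbs - n [MOD 4 * Δ.natAbs]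
    have h4 : 1 ≤ 4 * Δ.natAbs := by lia
    generalize 4 * Δ.natAbs = m at hn h4
    rw [← Int.natCast_modEq_iff, Int.modEq_iff_dvd]
    refine ⟨1 - n, ?_⟩
    rw [Nat.cast_sub hn, Nat.cast_mul, Nat.cast_sub h4]
    push_cast
    ring
  rw [← oddJacobi_mod, ← h1, oddJacobi_mod, map_mul, oddJacobi_sub_one hΔ]
  ring

theorem sum_oddJacobi_period {Δ : ℤ} (hΔ : 0 < Δ) :
    ∑ n ∈ Finset.range (4 * Δ.natAbs), oddJacobi Δ n = 0 := by
  have h1 := Finset.sum_range_reflect (fun n => oddJacobi Δ n) (4 * Δ.natAbs + 1)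
  have h2 : ∑ n ∈ Finset.range (4 * Δ.natAbs + 1), oddJacobi Δ (4 * Δ.natAbs + 1 - 1 - n) =
      - ∑ n ∈ Finset.range (4 * Δ.natAbs + 1), oddJacobi Δ n := by
    rw [← Finset.sum_neg_distrib]
    refine Finset.sum_congr rfl fun n hn => ?_
    rw [Nat.add_sub_cancel, oddJacobi_reflect hΔ (by simpa [Nat.lt_succ_iff] using hn)]
  rw [h2, Finset.sum_range_succ] at h1
  have h3 : oddJacobi Δ (4 * Δ.natAbs) = 0 := by
    rw [← oddJacobi_mod, Nat.mod_self, map_zero]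
  linarith

theorem abs_sum_range_oddJacobi_le {Δ : ℤ} (hΔ : 0 < Δ) (N : ℕ) :
    |∑ n ∈ Finset.range N, oddJacobi Δ n| ≤ 4 * Δ := by
  have hΔm : (Δ : ℝ) = Δ.natAbs := by
    rw [← Int.cast_natCast, Int.natAbs_of_nonneg hΔ.le]
  induction N using Nat.strong_induction_on with
  | _ N ih =>
    rcases lt_or_ge N (4 * Δ.natAbs) with h | h
    · calc |∑ n ∈ Finset.range N, oddJacobi Δ n| ≤ ∑ n ∈ Finset.range N, |oddJacobi Δ n| :=
          Finset.abs_sum_le_sum_abs _ _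
        _ ≤ ∑ n ∈ Finset.range N, 1 := Finset.sum_le_sum fun n _ => abs_oddJacobi_le_one Δ n
        _ = N := by simp
        _ ≤ 4 * Δ := by rw [hΔm]; exact_mod_cast h.le
    · obtain ⟨M, rfl⟩ := Nat.exists_eq_add_of_le h
      rw [Finset.sum_range_add, sum_oddJacobi_period hΔ, zero_add]
      have := ih M (by lia)
      rwa [Finset.sum_congr rfl fun n _ => by
        rw [← oddJacobi_mod, Nat.add_mod_left, oddJacobi_mod]]

theorem abs_sum_Ico_mul_le {x b : ℕ → ℝ} {q : ℝ} {M N : ℕ} (hMN : M ≤ N)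
    (hx : ∀ N, |∑ n ∈ Finset.range N, x n| ≤ q) (hb0 : ∀ n, M ≤ n → 0 ≤ b n)
    (hb : ∀ n, M ≤ n → b (n + 1) ≤ b n) :
    |∑ n ∈ Finset.Ico M N, x n * b n| ≤ 2 * q * b M := by
  have key : |∑ n ∈ Finset.Ico M N, x n * b n + (∑ n ∈ Finset.range M, x n) * b M -
      (∑ n ∈ Finset.range N, x n) * b N| ≤ q * (b M - b N) := by
    induction N, hMN using Nat.le_induction with
    | base => simp
    | succ N hMN ih =>
      rw [Finset.sum_Ico_succ_top hMN]
      have e : ∑ n ∈ Finset.Ico M N, x n * b n + x N * b N + (∑ n ∈ Finset.range M, x n) * b M -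
          (∑ n ∈ Finset.range (N + 1), x n) * b (N + 1) =
          (∑ n ∈ Finset.Ico M N, x n * b n + (∑ n ∈ Finset.range M, x n) * b M -
          (∑ n ∈ Finset.range N, x n) * b N) +
          (∑ n ∈ Finset.range (N + 1), x n) * (b N - b (N + 1)) := by
        rw [Finset.sum_range_succ]
        ring
      rw [e]
      refine (abs_add_le _ _).trans ?_
      rw [abs_mul, abs_of_nonneg (sub_nonneg.mpr (hb N hMN))]
      have := mul_le_mul_of_nonneg_right (hx (N + 1)) (sub_nonneg.mpr (hb N hMN))
      linarith
  have h1 : |(∑ n ∈ Finset.range M, x n) * b M| ≤ q * b M := by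
    rw [abs_mul, abs_of_nonneg (hb0 M le_rfl)]
    exact mul_le_mul_of_nonneg_right (hx M) (hb0 M le_rfl)
  have h2 : |(∑ n ∈ Finset.range N, x n) * b N| ≤ q * b N := by
    rw [abs_mul, abs_of_nonneg (hb0 N hMN)]
    exact mul_le_mul_of_nonneg_right (hx N) (hb0 N hMN)
  rw [abs_le] at *
  constructor <;> linarith [key.1, key.2, h1.1, h1.2, h2.1, h2.2]

/-- The Dirichlet `L`-series of the character `oddJacobi Δ` at a real point. -/
noncomputable def oddJacobiL (Δ : ℤ) (s : ℝ) : ℝ := ∑' n : ℕ, oddJacobi Δ n * (n : ℝ) ^ (-s)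

theorem summable_oddJacobi {s : ℝ} (hs : 1 < s) (Δ : ℤ) :
    Summable fun n : ℕ => ‖oddJacobi Δ n * (n : ℝ) ^ (-s)‖ := by
  refine Summable.of_nonneg_of_le (fun _ => norm_nonneg _) (fun n => ?_)
    (Real.summable_nat_rpow.mpr (by linarith : -s < -1))
  rw [norm_mul, Real.norm_eq_abs, Real.norm_of_nonneg (by positivity)]
  exact mul_le_of_le_one_left (by positivity) (abs_oddJacobi_le_one Δ n)

theorem abs_oddJacobiL_sub_le {Δ : ℤ} (hΔ : 0 < Δ) {s : ℝ} (hs : 1 < s) {M : ℕ} (hM : 0 < M) :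
    |oddJacobiL Δ s - ∑ n ∈ Finset.range M, oddJacobi Δ n * (n : ℝ) ^ (-s)| ≤ 8 * Δ / M := by
  have h1 := (summable_oddJacobi hs Δ).of_norm.hasSum.tendsto_sum_nat
  have h2 := (h1.sub_const (∑ n ∈ Finset.range M, oddJacobi Δ n * (n : ℝ) ^ (-s))).abs
  refine le_of_tendsto h2 ?_
  filter_upwards [eventually_ge_atTop M] with N hN
  rw [← Finset.sum_Ico_eq_sub _ hN]
  have hM1 : (1 : ℝ) ≤ M := by exact_mod_cast hM
  refine (abs_sum_Ico_mul_le hN (abs_sum_range_oddJacobi_le hΔ) (fun n _ => by positivity)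
    fun n hn => ?_).trans ?_
  · have : 0 < n := by lia
    exact Real.rpow_le_rpow_of_nonpos (by exact_mod_cast this) (by simp) (by linarith)
  · have hΔ' : (0 : ℝ) < Δ := by exact_mod_cast hΔ
    rw [div_eq_mul_inv, ← Real.rpow_neg_one]
    calc 2 * (4 * (Δ : ℝ)) * (M : ℝ) ^ (-s) ≤ 2 * (4 * (Δ : ℝ)) * (M : ℝ) ^ (-1 : ℝ) := by
          gcongr
      _ = _ := by ring

theorem sub_rpow_neg_le {n Y : ℕ} (hn : 0 < n) (hY : n ≤ Y) {s σ : ℝ} (hs : 1 < s)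
    (hsσ : s ≤ σ) : |(n : ℝ) ^ (-σ) - (n : ℝ) ^ (-s)| ≤ (σ - s) * log Y * (1 / n) := by
  have hn' : (1 : ℝ) ≤ n := by exact_mod_cast hn
  have hlog : 0 ≤ log n := Real.log_nonneg hn'
  have hlogY : log n ≤ log Y := Real.log_le_log (by linarith) (by exact_mod_cast hY)
  rw [abs_sub_comm, abs_of_nonneg (sub_nonneg.mpr
    (Real.rpow_le_rpow_of_exponent_le hn' (by linarith)))]
  have e1 : (n : ℝ) ^ (-σ) = (n : ℝ) ^ (-s) * exp (-((σ - s) * log n)) := by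
    rw [Real.rpow_def_of_pos (by linarith), Real.rpow_def_of_pos (by linarith), ← Real.exp_add]
    ring_nf
  have e2 := Real.add_one_le_exp (-((σ - s) * log n))
  have e3 : (n : ℝ) ^ (-s) ≤ 1 / n := by
    rw [one_div, ← Real.rpow_neg_one]
    exact Real.rpow_le_rpow_of_exponent_le hn' (by linarith)
  calc (n : ℝ) ^ (-s) - (n : ℝ) ^ (-σ) = (1 - exp (-((σ - s) * log n))) * (n : ℝ) ^ (-s) := by
        rw [e1]; ring
    _ ≤ ((σ - s) * log n) * (n : ℝ) ^ (-s) := by gcongr; linarith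
    _ ≤ ((σ - s) * log Y) * (1 / n) := by
        have : 0 ≤ σ - s := by linarith
        gcongr

theorem oddJacobiL_le_add {Δ : ℤ} (hΔ : 0 < Δ) {s σ : ℝ} (hs : 1 < s) (hsσ : s ≤ σ) {Y : ℕ}
    (hY : 0 < Y) :
    oddJacobiL Δ σ ≤ oddJacobiL Δ s + (σ - s) * log Y * (1 + log Y) + 16 * Δ / Y := by
  have h1 := abs_oddJacobiL_sub_le hΔ hs hY
  have h2 := abs_oddJacobiL_sub_le hΔ (hs.trans_le hsσ) hY
  have h3 : |∑ n ∈ Finset.range Y, oddJacobi Δ n * (n : ℝ) ^ (-σ) -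
      ∑ n ∈ Finset.range Y, oddJacobi Δ n * (n : ℝ) ^ (-s)| ≤
      (σ - s) * log Y * (1 + log Y) := by
    rw [← Finset.sum_sub_distrib]
    calc _ ≤ ∑ n ∈ Finset.range Y, |oddJacobi Δ n * (n : ℝ) ^ (-σ) -
          oddJacobi Δ n * (n : ℝ) ^ (-s)| := Finset.abs_sum_le_sum_abs _ _
      _ = ∑ n ∈ (Finset.range Y).erase 0, |oddJacobi Δ n * (n : ℝ) ^ (-σ) -
          oddJacobi Δ n * (n : ℝ) ^ (-s)| := by
          rw [Finset.sum_erase]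
          simp
      _ ≤ ∑ n ∈ (Finset.range Y).erase 0, (σ - s) * log Y * (1 / n) := by
          refine Finset.sum_le_sum fun n hn => ?_
          rw [Finset.mem_erase, Finset.mem_range] at hn
          rw [← mul_sub, abs_mul]
          exact (mul_le_of_le_one_left (abs_nonneg _) (abs_oddJacobi_le_one Δ n)).trans
            (sub_rpow_neg_le (by lia) hn.2.le hs hsσ)
      _ ≤ _ := by
          rw [← Finset.mul_sum]
          have h4 : 0 ≤ log Y := Real.log_natCast_nonneg Y
          refine mul_le_mul_of_nonneg_left ?_ (mul_nonneg (by linarith) h4)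
          refine sum_one_div_le_one_add_log _ (by simp) fun j hj => ?_
          rw [Finset.mem_erase, Finset.mem_range] at hj
          exact hj.2.le
  have e : 16 * (Δ : ℝ) / Y = 8 * Δ / Y + 8 * Δ / Y := by ring
  rw [abs_le] at h1 h2 h3
  rw [e]
  linarith [h1.1, h1.2, h2.1, h2.2, h3.1, h3.2]

/-- The character `oddJacobi Δ` as an arithmetic function. -/
noncomputable def oddJacobiArith (Δ : ℤ) : ArithmeticFunction ℝ :=
  ⟨fun n => oddJacobi Δ n, map_zero _⟩

theorem oddJacobiArith_isMultiplicative (Δ : ℤ) : (oddJacobiArith Δ).IsMultiplicative :=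
  ⟨map_one (oddJacobi Δ), fun _ => map_mul (oddJacobi Δ) _ _⟩

/-- The divisor sum of the character `oddJacobi Δ`. -/
noncomputable def oddJacobiSum (Δ : ℤ) : ArithmeticFunction ℝ :=
  oddJacobiArith Δ * (ArithmeticFunction.zeta : ArithmeticFunction ℝ)

theorem oddJacobiSum_isMultiplicative (Δ : ℤ) : (oddJacobiSum Δ).IsMultiplicative :=
  (oddJacobiArith_isMultiplicative Δ).mul ArithmeticFunction.isMultiplicative_zeta.natCast

theorem oddJacobiSum_prime_pow (Δ : ℤ) {p : ℕ} (hp : p.Prime) (k : ℕ) :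
    oddJacobiSum Δ (p ^ k) = ∑ i ∈ Finset.range (k + 1), oddJacobi Δ p ^ i := by
  rw [oddJacobiSum, ArithmeticFunction.coe_mul_zeta_apply, Nat.sum_divisors_prime_pow hp]
  exact Finset.sum_congr rfl fun i _ => map_pow (oddJacobi Δ) p i

theorem sum_neg_one_pow (k : ℕ) :
    ∑ i ∈ Finset.range (k + 1), (-1 : ℝ) ^ i = if Even k then 1 else 0 := by
  rw [neg_one_geom_sum]
  by_cases h : Even k <;> simp [h, Nat.even_add_one]

theorem oddJacobiSum_prime_pow_nonneg (Δ : ℤ) {p : ℕ} (hp : p.Prime) (k : ℕ) :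
    0 ≤ oddJacobiSum Δ (p ^ k) := by
  rw [oddJacobiSum_prime_pow Δ hp]
  rcases oddJacobi_trichotomy Δ p with h | h | h <;> rw [h]
  · positivity
  · positivity
  · rw [sum_neg_one_pow]
    split_ifs <;> norm_num

theorem one_le_oddJacobiSum_prime_pow (Δ : ℤ) {p : ℕ} (hp : p.Prime) {k : ℕ}
    (hk : oddJacobi Δ p = -1 → Even k) : 1 ≤ oddJacobiSum Δ (p ^ k) := by
  rw [oddJacobiSum_prime_pow Δ hp]
  rcases oddJacobi_trichotomy Δ p with h | h | h
  · rw [h, Finset.sum_range_succ']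
    simp
  · simp [h]
  · rw [h, sum_neg_one_pow, if_pos (hk h)]

theorem oddJacobiSum_nonneg (Δ : ℤ) (n : ℕ) : 0 ≤ oddJacobiSum Δ n := by
  rcases eq_or_ne n 0 with rfl | hn
  · simp
  · rw [(oddJacobiSum_isMultiplicative Δ).multiplicative_factorization _ hn]
    exact Finset.prod_nonneg fun p hp =>
      oddJacobiSum_prime_pow_nonneg Δ (Nat.prime_of_mem_primeFactors hp) _

theorem even_factorization_of_eq {Δ : ℤ} {p : ℕ} (hp : p.Prime) (h : oddJacobi Δ p = -1) {n : ℕ}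
    (hn : n ≠ 0) {u v : ℤ} (huv : (n : ℤ) = u ^ 2 + Δ * v ^ 2) : Even (n.factorization p) := by
  have hj : jacobiSym (-Δ) p = -1 := by
    rw [oddJacobi_apply] at h
    split_ifs at h
    · exact_mod_cast h
    · norm_num at h
  have : Fact p.Prime := ⟨hp⟩
  induction n using Nat.strong_induction_on generalizing u v with
  | _ n ih =>
    by_cases hpn : p ∣ n
    · have h1 : (p : ℤ) ∣ u ^ 2 - (-Δ) * v ^ 2 := by
        have : (p : ℤ) ∣ n := by exact_mod_cast hpn
        rw [huv] at this
        simpa using this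
      obtain ⟨⟨u', rfl⟩, ⟨v', rfl⟩⟩ := jacobiSym.prime_dvd_of_eq_neg_one hj h1
      have h2 : (n : ℤ) = (p : ℤ) ^ 2 * (u' ^ 2 + Δ * v' ^ 2) := by rw [huv]; ring
      have h3 : p ^ 2 ∣ n := by
        have : ((p ^ 2 : ℕ) : ℤ) ∣ n := ⟨u' ^ 2 + Δ * v' ^ 2, by rw [h2]; push_cast; ring⟩
        exact_mod_cast this
      obtain ⟨m, rfl⟩ := h3
      have hm : m ≠ 0 := fun h => hn (by rw [h, mul_zero])
      have hp0 : (p : ℤ) ^ 2 ≠ 0 := pow_ne_zero _ (by exact_mod_cast hp.ne_zero)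
      have h4 : (m : ℤ) = u' ^ 2 + Δ * v' ^ 2 := by
        apply mul_left_cancel₀ hp0
        rw [← h2]
        push_cast
        ring
      have h5 := ih m (lt_mul_of_one_lt_left (by lia) (Nat.one_lt_pow (by norm_num) hp.one_lt)) hm h4
      rw [Nat.factorization_mul (pow_ne_zero _ hp.ne_zero) hm, Finsupp.add_apply,
        hp.factorization_pow, Finsupp.single_eq_same]
      exact (by decide : Even 2).add h5
    · rw [Nat.factorization_eq_zero_of_not_dvd hpn]
      exact Even.zero

theorem one_le_oddJacobiSum {Δ : ℤ} {n : ℕ} (hn : n ≠ 0) {u v : ℤ}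
    (huv : (n : ℤ) = u ^ 2 + Δ * v ^ 2) : 1 ≤ oddJacobiSum Δ n := by
  rw [(oddJacobiSum_isMultiplicative Δ).multiplicative_factorization _ hn]
  exact Finset.one_le_prod fun p hp =>
    one_le_oddJacobiSum_prime_pow Δ (Nat.prime_of_mem_primeFactors hp) fun h =>
      even_factorization_of_eq (Nat.prime_of_mem_primeFactors hp) h hn huv

theorem mul_pow_le_sum_range_pow_sq (x : ℝ) (d : ℕ) :
    (d + 1) * x ^ d ≤ ∑ i ∈ Finset.range (d + 1), (x ^ 2) ^ i := by
  have h1 := Finset.sum_range_reflect (fun i => (x ^ 2) ^ i) (d + 1)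
  have h2 : ∑ i ∈ Finset.range (d + 1), 2 * x ^ d ≤
      ∑ i ∈ Finset.range (d + 1), ((x ^ 2) ^ (d + 1 - 1 - i) + (x ^ 2) ^ i) := by
    refine Finset.sum_le_sum fun i hi => ?_
    obtain ⟨j, rfl⟩ := Nat.exists_eq_add_of_le (Nat.lt_succ_iff.mp (Finset.mem_range.mp hi))
    rw [Nat.add_sub_cancel, Nat.add_sub_cancel_left, ← pow_mul, ← pow_mul, mul_comm 2 j,
      mul_comm 2 i, pow_mul, pow_mul, pow_add]
    nlinarith [sq_nonneg (x ^ j - x ^ i)]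
  rw [Finset.sum_add_distrib, h1] at h2
  simp only [Finset.sum_const, Finset.card_range, nsmul_eq_mul, Nat.cast_add, Nat.cast_one] at h2
  linarith

theorem lambert_sub_antitone {t : ℝ} (ht0 : 0 < t) (ht1 : t < 1) {d : ℕ} (hd : 0 < d) :
    1 / ((d + 1 : ℕ) * (1 - t)) - t ^ (d + 1) / (1 - t ^ (d + 1)) ≤
      1 / (d * (1 - t)) - t ^ d / (1 - t ^ d) := by
  obtain ⟨e, rfl⟩ := Nat.exists_eq_add_of_lt hd
  rw [zero_add]
  set x := √t with hx
  have hx0 : 0 < x := Real.sqrt_pos.mpr ht0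
  have hxt : x ^ 2 = t := Real.sq_sqrt ht0.le
  have hx1 : x ≤ 1 := by nlinarith
  have g1 := mul_pow_le_sum_range_pow_sq x e
  have g2 := mul_pow_le_sum_range_pow_sq x (e + 1)
  rw [hxt] at g1 g2
  have h1t : 0 < 1 - t := by linarith
  have s1 : 1 - t ^ (e + 1) = (1 - t) * ∑ i ∈ Finset.range (e + 1), t ^ i :=
    (mul_neg_geom_sum t (e + 1)).symm
  have s2 : 1 - t ^ (e + 1 + 1) = (1 - t) * ∑ i ∈ Finset.range (e + 1 + 1), t ^ i :=
    (mul_neg_geom_sum t (e + 1 + 1)).symm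
  rw [s1, s2]
  have s3 : t * ∑ i ∈ Finset.range (e + 1), t ^ i = ∑ i ∈ Finset.range (e + 1 + 1), t ^ i - 1 := by
    rw [Finset.sum_range_succ' _ (e + 1), Finset.mul_sum]
    simp [pow_succ']
  set G := ∑ i ∈ Finset.range (e + 1), t ^ i
  set G' := ∑ i ∈ Finset.range (e + 1 + 1), t ^ i
  have hG : 0 < G := lt_of_lt_of_le (by positivity) g1
  have hG' : 0 < G' := lt_of_lt_of_le (by positivity) g2
  have hprod : ((e : ℝ) + 1) * ((e + 1 : ℕ) + 1) * t ^ (e + 1) ≤ G * G' := by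
    calc ((e : ℝ) + 1) * ((e + 1 : ℕ) + 1) * t ^ (e + 1)
        = ((e : ℝ) + 1) * ((e + 1 : ℕ) + 1) * (x ^ e * x ^ (e + 1)) * x := by rw [← hxt]; ring
      _ ≤ ((e : ℝ) + 1) * ((e + 1 : ℕ) + 1) * (x ^ e * x ^ (e + 1)) * 1 := by gcongr
      _ = (((e : ℝ) + 1) * x ^ e) * (((e + 1 : ℕ) + 1) * x ^ (e + 1)) := by ring
      _ ≤ G * G' := by gcongr
  have key : t ^ (e + 1) / G - t ^ (e + 1 + 1) / G' ≤ 1 / ((e + 1 : ℕ) : ℝ) - 1 / ((e + 1 + 1 : ℕ) : ℝ) := by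
    have e1 : t ^ (e + 1) / G - t ^ (e + 1 + 1) / G' = t ^ (e + 1) / (G * G') := by
      have : G' = 1 + t * G := by linarith
      field_simp
      rw [this]
      ring
    have e2 : 1 / ((e + 1 : ℕ) : ℝ) - 1 / ((e + 1 + 1 : ℕ) : ℝ) =
        1 / (((e : ℝ) + 1) * ((e + 1 : ℕ) + 1)) := by
      push_cast
      field_simp
      ring
    rw [e1, e2, div_le_div_iff₀ (by positivity) (by positivity)]
    linarith
  have key2 := div_le_div_of_nonneg_right key h1t.le
  have e3 : ∀ A B C D : ℝ, (A / B - C / D) / (1 - t) = A / (B * (1 - t)) - C / (D * (1 - t)) := by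
    intro A B C D
    rw [sub_div, div_div, div_div]
  rw [e3, e3] at key2
  rw [mul_comm (1 - t) G, mul_comm (1 - t) G']
  linarith

theorem lambert_sub_nonneg {t : ℝ} (ht0 : 0 < t) (ht1 : t < 1) {d : ℕ} (hd : 0 < d) :
    0 ≤ 1 / (d * (1 - t)) - t ^ d / (1 - t ^ d) := by
  have h1t : 0 < 1 - t := by linarith
  have hd' : (0 : ℝ) < d := by exact_mod_cast hd
  have h2 : 0 < 1 - t ^ d := by linarith [pow_lt_one₀ ht0.le ht1 hd.ne']
  have h1 := one_add_mul_le_pow (a := 1 / t - 1)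
    (by have : 0 < 1 / t := by positivity
        linarith) d
  have e : (1 + (1 / t - 1)) ^ d = 1 / t ^ d := by rw [add_sub_cancel, div_pow, one_pow]
  rw [e, le_div_iff₀ (by positivity)] at h1
  rw [sub_nonneg, div_le_div_iff₀ h2 (by positivity)]
  have h3 : 1 - t ≤ 1 / t - 1 := by
    rw [le_sub_iff_add_le, le_div_iff₀ ht0]
    nlinarith [sq_nonneg (1 - t)]
  have h4 : (d : ℝ) * (1 - t) * t ^ d ≤ d * (1 / t - 1) * t ^ d := by gcongr
  linarith

theorem sum_filter_dvd_pow {t : ℝ} (ht0 : 0 < t) (ht1 : t < 1) {d N : ℕ} (hd : 0 < d) :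
    |t ^ d / (1 - t ^ d) - ∑ n ∈ (Finset.Ioc 0 N).filter (d ∣ ·), t ^ n| ≤ t ^ N / (1 - t) := by
  have h1 : (Finset.Ioc 0 N).filter (d ∣ ·) =
      (Finset.range (N / d)).image fun k => d * (k + 1) := by
    ext n
    simp only [Finset.mem_filter, Finset.mem_Ioc, Finset.mem_image, Finset.mem_range]
    constructor
    · rintro ⟨⟨h0, hN⟩, k, rfl⟩
      have hk : 0 < k := Nat.pos_of_mul_pos_left h0
      refine ⟨k - 1, ?_, by rw [Nat.sub_add_cancel hk]⟩
      have : k ≤ N / d := (Nat.le_div_iff_mul_le hd).mpr (by linarith)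
      lia
    · rintro ⟨k, hk, rfl⟩
      refine ⟨⟨by positivity, ?_⟩, dvd_mul_right _ _⟩
      have := (Nat.le_div_iff_mul_le hd).mp (Nat.succ_le_of_lt hk)
      rw [mul_comm]
      exact this
  have h2 : 0 < 1 - t ^ d := by linarith [pow_lt_one₀ ht0.le ht1 hd.ne']
  rw [h1, Finset.sum_image fun a _ b _ hab => by
    simpa using Nat.eq_of_mul_eq_mul_left hd hab]
  have h3 : ∑ k ∈ Finset.range (N / d), t ^ (d * (k + 1)) =
      t ^ d / (1 - t ^ d) - t ^ (d * (N / d + 1)) / (1 - t ^ d) := by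
    have := mul_neg_geom_sum (t ^ d) (N / d)
    rw [← sub_div, eq_div_iff h2.ne', pow_mul, pow_succ', ← mul_one_sub, ← this,
      Finset.sum_congr rfl fun k _ => by rw [pow_mul, pow_succ'], ← Finset.mul_sum]
    ring
  rw [h3, sub_sub_cancel, abs_of_nonneg (by positivity)]
  have h4 : N ≤ d * (N / d + 1) := (Nat.lt_mul_div_succ N hd).le
  have h5 : t ^ d ≤ t := pow_le_of_le_one ht0.le ht1.le hd.ne'
  have h6 : t ^ (d * (N / d + 1)) ≤ t ^ N := pow_le_pow_of_le_one ht0.le ht1.le h4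
  gcongr

theorem sum_oddJacobiSum_mul_pow (Δ : ℤ) (t : ℝ) (N : ℕ) :
    ∑ n ∈ Finset.Ioc 0 N, oddJacobiSum Δ n * t ^ n =
      ∑ d ∈ Finset.Ioc 0 N, oddJacobi Δ d * ∑ n ∈ (Finset.Ioc 0 N).filter (d ∣ ·), t ^ n := by
  have h1 : ∀ n ∈ Finset.Ioc 0 N, oddJacobiSum Δ n * t ^ n =
      ∑ d ∈ Finset.Ioc 0 N, if d ∣ n then oddJacobi Δ d * t ^ n else 0 := by
    intro n hn
    rw [Finset.mem_Ioc] at hn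
    rw [oddJacobiSum, ArithmeticFunction.coe_mul_zeta_apply, Finset.sum_mul, ← Finset.sum_filter]
    refine Finset.sum_congr ?_ fun _ _ => rfl
    ext d
    simp only [Nat.mem_divisors, Finset.mem_filter, Finset.mem_Ioc]
    constructor
    · rintro ⟨h, h0⟩
      exact ⟨⟨Nat.pos_of_dvd_of_pos h hn.1, (Nat.le_of_dvd hn.1 h).trans hn.2⟩, h⟩
    · rintro ⟨-, h⟩
      exact ⟨h, hn.1.ne'⟩
  rw [Finset.sum_congr rfl h1, Finset.sum_comm]
  refine Finset.sum_congr rfl fun d _ => ?_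
  rw [Finset.mul_sum, Finset.sum_filter]

theorem le_sum_oddJacobi_div {Δ : ℤ} (hΔ : 0 < Δ) {t : ℝ} (ht0 : 0 < t) (ht1 : t < 1) (N : ℕ) :
    (1 - t) * (∑ n ∈ Finset.Ioc 0 N, oddJacobiSum Δ n * t ^ n - 8 * Δ - N * (t ^ N / (1 - t))) ≤
      ∑ d ∈ Finset.Ioc 0 N, oddJacobi Δ d / d := by
  have h1t : 0 < 1 - t := by linarith
  have h1 : ∑ d ∈ Finset.Ioc 0 N, oddJacobi Δ d / d = (1 - t) *
      (∑ d ∈ Finset.Ico 1 (N + 1), oddJacobi Δ d * (1 / (d * (1 - t)) - t ^ d / (1 - t ^ d)) +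
      ∑ d ∈ Finset.Ioc 0 N, oddJacobi Δ d * (t ^ d / (1 - t ^ d))) := by
    have : Finset.Ico 1 (N + 1) = Finset.Ioc 0 N := by
      ext
      simp only [Finset.mem_Ico, Finset.mem_Ioc]
      lia
    rw [this, ← Finset.sum_add_distrib, Finset.mul_sum]
    refine Finset.sum_congr rfl fun d _ => ?_
    field_simp
    ring
  have h2 := abs_sum_Ico_mul_le (M := 1) (N := N + 1) (by lia) (abs_sum_range_oddJacobi_le hΔ)
    (b := fun d => 1 / (d * (1 - t)) - t ^ d / (1 - t ^ d))
    (fun d hd => lambert_sub_nonneg ht0 ht1 hd) (fun d hd => lambert_sub_antitone ht0 ht1 hd)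
  have h3 : 1 / (((1 : ℕ) : ℝ) * (1 - t)) - t ^ 1 / (1 - t ^ 1) = 1 := by
    rw [Nat.cast_one, one_mul, pow_one, ← sub_div, div_self h1t.ne']
  rw [h3] at h2
  have h4 : |∑ d ∈ Finset.Ioc 0 N, oddJacobi Δ d * (t ^ d / (1 - t ^ d)) -
      ∑ n ∈ Finset.Ioc 0 N, oddJacobiSum Δ n * t ^ n| ≤ N * (t ^ N / (1 - t)) := by
    rw [sum_oddJacobiSum_mul_pow, ← Finset.sum_sub_distrib]
    calc _ ≤ ∑ d ∈ Finset.Ioc 0 N, |oddJacobi Δ d * (t ^ d / (1 - t ^ d)) -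
          oddJacobi Δ d * ∑ n ∈ (Finset.Ioc 0 N).filter (d ∣ ·), t ^ n| :=
          Finset.abs_sum_le_sum_abs _ _
      _ ≤ ∑ d ∈ Finset.Ioc 0 N, t ^ N / (1 - t) := by
          refine Finset.sum_le_sum fun d hd => ?_
          rw [← mul_sub, abs_mul]
          exact (mul_le_of_le_one_left (abs_nonneg _) (abs_oddJacobi_le_one Δ d)).trans
            (sum_filter_dvd_pow ht0 ht1 (Finset.mem_Ioc.mp hd).1)
      _ = _ := by simp
  rw [h1]
  refine mul_le_mul_of_nonneg_left ?_ h1t.le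
  rw [abs_le] at h2 h4
  linarith [h2.1, h4.1]

theorem card_image_sq_add_mul_sq {D U V W : ℕ} (hD : 0 < D) (hW : D * V ^ 2 ≤ W ^ 2) :
    U * V ≤ ((Finset.Icc 1 U ×ˢ Finset.Icc 1 V).image fun x => x.1 ^ 2 + D * x.2 ^ 2).card +
      V * V * W := by
  classical
  set P := Finset.Icc 1 U ×ˢ Finset.Icc 1 V with hP
  set f : ℕ × ℕ → ℕ := fun x => x.1 ^ 2 + D * x.2 ^ 2 with hf
  set B := P.filter fun x => ∃ y ∈ P, f y = f x ∧ y.1 < x.1 with hB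
  have hcard : P.card = U * V := by simp [hP]
  have h1 : (P.filter fun x => ¬∃ y ∈ P, f y = f x ∧ y.1 < x.1).card ≤ (P.image f).card := by
    refine Finset.card_le_card_of_injOn f (fun x hx => Finset.mem_image_of_mem f
      (Finset.mem_filter.mp hx).1) fun x hx y hy hxy => ?_
    obtain ⟨hx1, hx2⟩ := Finset.mem_filter.mp hx
    obtain ⟨hy1, hy2⟩ := Finset.mem_filter.mp hy
    push Not at hx2 hy2
    have h3 : x.1 = y.1 := le_antisymm (hx2 y hy1 hxy.symm) (hy2 x hx1 hxy)
    have h4 : D * x.2 ^ 2 = D * y.2 ^ 2 := by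
      have : x.1 ^ 2 + D * x.2 ^ 2 = y.1 ^ 2 + D * y.2 ^ 2 := hxy
      rw [h3] at this
      exact Nat.add_left_cancel this
    exact Prod.ext h3 (Nat.pow_left_injective (by norm_num : 2 ≠ 0)
      (Nat.eq_of_mul_eq_mul_left hD h4))
  have h2 : B.card ≤ V * V * W := by
    have hex : ∀ x ∈ B, ∃ y ∈ P, f y = f x ∧ y.1 < x.1 := fun x hx => (Finset.mem_filter.mp hx).2
    choose! g hgP hgf hgl using hex
    have h3 : (Finset.Icc 1 V ×ˢ Finset.Icc 1 V ×ˢ Finset.range W).card = V * V * W := by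
      simp [mul_assoc]
    rw [← h3]
    refine Finset.card_le_card_of_injOn (fun x => (x.2, (g x).2, x.1 - (g x).1)) ?_ ?_
    · intro x hx
      have hxP := (Finset.mem_filter.mp hx).1
      have hgx := hgP x hx
      have e1 := hgf x hx
      have e2 := hgl x hx
      simp only [hP, Finset.mem_product, Finset.mem_Icc] at hxP hgx
      simp only [Finset.coe_product, Set.mem_prod, Finset.mem_coe, Finset.mem_Icc,
        Finset.mem_range]
      refine ⟨hxP.2, hgx.2, ?_⟩
      obtain ⟨e, he⟩ := Nat.exists_eq_add_of_lt e2
      simp only [hf] at e1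
      have h4 : D * (g x).2 ^ 2 ≤ D * V ^ 2 := by gcongr; exact hgx.2.2
      have h5 : (x.1 - (g x).1) ^ 2 < W ^ 2 := by
        rw [he, add_assoc, Nat.add_sub_cancel_left]
        have h6 : 0 < (g x).1 := hgx.1.1
        rw [he] at e1
        nlinarith [Nat.zero_le (D * x.2 ^ 2)]
      exact lt_of_pow_lt_pow_left₀ 2 (Nat.zero_le _) h5
    · intro x hx y hy hxy
      simp only [Prod.mk.injEq] at hxy
      obtain ⟨i1, i2, i3⟩ := hxy
      have e1 := hgf x hx
      have e2 := hgl x hx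
      have e3 := hgf y hy
      have e4 := hgl y hy
      simp only [hf] at e1 e3
      obtain ⟨e, he⟩ := Nat.exists_eq_add_of_lt e2
      obtain ⟨e', he'⟩ := Nat.exists_eq_add_of_lt e4
      have hee : e = e' := by lia
      subst hee
      rw [he, i1, i2] at e1
      rw [he'] at e3
      have h7 : (e + 1) * (g x).1 = (e + 1) * (g y).1 := by nlinarith
      have h8 := Nat.eq_of_mul_eq_mul_left (by lia) h7
      exact Prod.ext (by rw [he, he', h8]) i1
  have h3 := Finset.card_filter_add_card_filter_not (s := P)
    (fun x => ∃ y ∈ P, f y = f x ∧ y.1 < x.1)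
  rw [← hcard]
  lia

theorem le_sum_oddJacobiSum_mul_pow {Δ : ℤ} (hΔ : 0 < Δ) {V : ℕ} (hV : 0 < V)
    (hΔV : Δ ≤ V ^ 6) {t : ℝ} (ht : t = 1 - 1 / (2050 * V ^ 10)) {N : ℕ}
    (hN : 1025 * V ^ 10 ≤ N) :
    31 / 2 * (V : ℝ) ^ 6 ≤ ∑ n ∈ Finset.Ioc 0 N, oddJacobiSum Δ n * t ^ n := by
  have hV1 : (1 : ℝ) ≤ V := by exact_mod_cast hV
  have hV10 : (1 : ℝ) ≤ V ^ 10 := one_le_pow₀ hV1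
  have ht0 : 0 < t := by
    rw [ht, sub_pos, div_lt_one (by positivity)]
    linarith
  have ht1 : t ≤ 1 := by
    rw [ht]
    have : (0 : ℝ) ≤ 1 / (2050 * V ^ 10) := by positivity
    linarith
  obtain ⟨D, rfl⟩ := Int.eq_ofNat_of_zero_le hΔ.le
  have hD : 0 < D := by exact_mod_cast hΔ
  have hDV : D ≤ V ^ 6 := by exact_mod_cast hΔV
  set I := (Finset.Icc 1 (32 * V ^ 5) ×ˢ Finset.Icc 1 V).image
    fun x => x.1 ^ 2 + D * x.2 ^ 2 with hI
  have hcard : 32 * V ^ 5 * V ≤ I.card + V * V * V ^ 4 :=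
    card_image_sq_add_mul_sq hD (by
      calc D * V ^ 2 ≤ V ^ 6 * V ^ 2 := by gcongr
        _ = (V ^ 4) ^ 2 := by ring)
  have hcard' : 31 * (V : ℝ) ^ 6 ≤ I.card := by
    have : ((32 * V ^ 5 * V : ℕ) : ℝ) ≤ (I.card + V * V * V ^ 4 : ℕ) := by exact_mod_cast hcard
    push_cast at this
    ring_nf at this ⊢
    linarith
  have hIN : ∀ n ∈ I, 0 < n ∧ n ≤ 1025 * V ^ 10 := by
    intro n hn
    obtain ⟨x, hx, rfl⟩ := Finset.mem_image.mp hn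
    simp only [Finset.mem_product, Finset.mem_Icc] at hx
    refine ⟨by have := hx.1.1; positivity, ?_⟩
    calc x.1 ^ 2 + D * x.2 ^ 2 ≤ (32 * V ^ 5) ^ 2 + V ^ 6 * V ^ 2 := by
          gcongr
          exacts [hx.1.2, hx.2.2]
      _ = 1024 * V ^ 10 + V ^ 8 := by ring
      _ ≤ 1024 * V ^ 10 + V ^ 10 := by gcongr; lia
      _ = _ := by ring
  have hone : ∀ n ∈ I, 1 ≤ oddJacobiSum D n := by
    intro n hn
    have h0 := (hIN n hn).1.ne'
    obtain ⟨x, hx, rfl⟩ := Finset.mem_image.mp hn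
    exact one_le_oddJacobiSum (u := x.1) (v := x.2) h0 (by push_cast; ring)
  have hhalf : ∀ n ∈ I, 1 / 2 ≤ t ^ n := by
    intro n hn
    have h1 := one_add_mul_le_pow (a := -(1 / (2050 * (V : ℝ) ^ 10))) (by
      have : 1 / (2050 * (V : ℝ) ^ 10) ≤ 1 := by
        rw [div_le_one (by positivity)]
        linarith
      linarith) n
    rw [← sub_eq_add_neg, ← ht] at h1
    refine le_trans ?_ h1
    have h2 : (n : ℝ) * (1 / (2050 * (V : ℝ) ^ 10)) ≤ 1 / 2 := by
      have h3 : (n : ℝ) ≤ 1025 * (V : ℝ) ^ 10 := by exact_mod_cast (hIN n hn).2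
      rw [mul_one_div, div_le_div_iff₀ (by positivity) (by norm_num)]
      linarith
    linarith
  calc 31 / 2 * (V : ℝ) ^ 6 ≤ I.card * (1 / 2) := by linarith
    _ = ∑ n ∈ I, (1 / 2 : ℝ) := by simp
    _ ≤ ∑ n ∈ I, oddJacobiSum D n * t ^ n := Finset.sum_le_sum fun n hn => by
        have := mul_le_mul (hone n hn) (hhalf n hn) (by norm_num)
          (oddJacobiSum_nonneg D n)
        linarith
    _ ≤ _ := by
        refine Finset.sum_le_sum_of_subset_of_nonneg (fun n hn => ?_) fun n _ _ =>
          mul_nonneg (oddJacobiSum_nonneg D n) (by positivity)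
        obtain ⟨h1, h2⟩ := hIN n hn
        exact Finset.mem_Ioc.mpr ⟨h1, h2.trans hN⟩

theorem eventually_le_sum_oddJacobi_div {Δ : ℤ} (hΔ : 0 < Δ) {V : ℕ} (hV : 0 < V)
    (hΔV : Δ ≤ V ^ 6) :
    ∀ᶠ N : ℕ in atTop, 1 / (300 * (V : ℝ) ^ 4) ≤ ∑ d ∈ Finset.Ioc 0 N, oddJacobi Δ d / d := by
  have hV1 : (1 : ℝ) ≤ V := by exact_mod_cast hV
  have hV10 : (1 : ℝ) ≤ V ^ 10 := one_le_pow₀ hV1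
  have hV6 : (1 : ℝ) ≤ V ^ 6 := one_le_pow₀ hV1
  set t : ℝ := 1 - 1 / (2050 * V ^ 10) with ht
  have ht0 : 0 < t := by
    rw [ht, sub_pos, div_lt_one (by positivity)]
    linarith
  have h1t : 1 - t = 1 / (2050 * V ^ 10) := by rw [ht, sub_sub_cancel]
  have ht1 : t < 1 := by
    rw [← sub_pos, h1t]
    positivity
  have hlim : Tendsto (fun N : ℕ => N * (t ^ N / (1 - t))) atTop (nhds 0) := by
    have := (tendsto_self_mul_const_pow_of_lt_one ht0.le ht1).div_const (1 - t)
    rw [zero_div] at this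
    exact this.congr fun N => by ring
  filter_upwards [eventually_ge_atTop (1025 * V ^ 10),
    hlim.eventually (gt_mem_nhds (by norm_num : (0 : ℝ) < 1 / 2))] with N hN hN2
  refine le_trans ?_ (le_sum_oddJacobi_div hΔ ht0 ht1 N)
  have h1 := le_sum_oddJacobiSum_mul_pow hΔ hV hΔV ht hN
  have h2 : (Δ : ℝ) ≤ V ^ 6 := by exact_mod_cast hΔV
  rw [h1t] at hN2 ⊢
  have h3 : 7 * (V : ℝ) ^ 6 ≤ ∑ n ∈ Finset.Ioc 0 N, oddJacobiSum Δ n * t ^ n - 8 * Δ -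
      N * (t ^ N / (1 / (2050 * V ^ 10))) := by
    linarith
  refine le_trans ?_ (mul_le_mul_of_nonneg_left h3 (by positivity))
  have e : 1 / (2050 * (V : ℝ) ^ 10) * (7 * V ^ 6) = 7 / (2050 * V ^ 4) := by
    field_simp
  rw [e, div_le_div_iff₀ (by positivity) (by positivity)]
  have : (0 : ℝ) ≤ V ^ 4 := by positivity
  linarith

theorem eventually_le_oddJacobiL {Δ : ℤ} (hΔ : 0 < Δ) {V : ℕ} (hV : 0 < V) (hΔV : Δ ≤ V ^ 6) :
    ∀ᶠ s : ℝ in nhdsWithin 1 (Set.Ioi 1), 1 / (600 * (V : ℝ) ^ 4) ≤ oddJacobiL Δ s := by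
  have hV0 : (0 : ℝ) < V := by exact_mod_cast hV
  have hlim : Tendsto (fun N : ℕ => 8 * (Δ : ℝ) / ((N + 1 : ℕ) : ℝ)) atTop (nhds 0) :=
    (tendsto_const_div_atTop_nhds_zero_nat _).comp (tendsto_add_atTop_nat 1)
  obtain ⟨N, hN1, hN2⟩ := ((eventually_le_sum_oddJacobi_div hΔ hV hΔV).and
    (hlim.eventually (gt_mem_nhds (by positivity : (0 : ℝ) < 1 / (1200 * (V : ℝ) ^ 4))))).exists
  have hcont : Tendsto (fun s : ℝ => ∑ n ∈ Finset.range (N + 1), oddJacobi Δ n * (n : ℝ) ^ (-s))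
      (nhdsWithin 1 (Set.Ioi 1)) (nhds (∑ d ∈ Finset.Ioc 0 N, oddJacobi Δ d / d)) := by
    have e : ∑ d ∈ Finset.Ioc 0 N, oddJacobi Δ d / d =
        ∑ n ∈ Finset.range (N + 1), oddJacobi Δ n * (n : ℝ) ^ (-1 : ℝ) := by
      have : Finset.Ioc 0 N = (Finset.range (N + 1)).erase 0 := by
        ext
        simp only [Finset.mem_Ioc, Finset.mem_erase, Finset.mem_range]
        lia
      rw [this, Finset.sum_erase _ (by simp)]
      refine Finset.sum_congr rfl fun n _ => ?_
      rw [Real.rpow_neg_one, div_eq_mul_inv]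
    rw [e]
    refine tendsto_nhdsWithin_of_tendsto_nhds (tendsto_finsetSum _ fun n _ => ?_)
    rcases Nat.eq_zero_or_pos n with rfl | hn
    · simp
    · refine Tendsto.const_mul _ ?_
      have hc : ContinuousAt (fun s : ℝ => (n : ℝ) ^ (-s)) 1 :=
        (Real.continuousAt_const_rpow (by exact_mod_cast hn.ne')).comp continuousAt_neg
      exact hc
  have h3 : 1 / (400 * (V : ℝ) ^ 4) < ∑ d ∈ Finset.Ioc 0 N, oddJacobi Δ d / d := by
    refine lt_of_lt_of_le ?_ hN1
    gcongr
    norm_num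
  filter_upwards [hcont.eventually (lt_mem_nhds h3), self_mem_nhdsWithin] with s hs1 hs2
  have h4 := (abs_le.mp (abs_oddJacobiL_sub_le hΔ hs2 (Nat.succ_pos N))).1
  have e : 1 / (600 * (V : ℝ) ^ 4) = 1 / (400 * V ^ 4) - 1 / (1200 * V ^ 4) := by
    field_simp
    norm_num
  rw [e]
  rw [Nat.succ_eq_add_one] at h4
  linarith

/-- The completely multiplicative function `n ↦ n ^ (-s)`. -/
noncomputable def natRpowNeg (s : ℝ) (hs : s ≠ 0) : ℕ →*₀ ℝ where
  toFun n := (n : ℝ) ^ (-s)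
  map_zero' := by simp [Real.zero_rpow (neg_ne_zero.mpr hs)]
  map_one' := by simp
  map_mul' m n := by rw [Nat.cast_mul, Real.mul_rpow (by positivity) (by positivity)]

/-- The partial Euler product of `ζ(s) L(s)`. -/
noncomputable def partialEuler (Δ : ℤ) (s : ℝ) (N : ℕ) : ℝ :=
  ∏ p ∈ N.primesBelow, ((1 - (p : ℝ) ^ (-s))⁻¹ * (1 - oddJacobi Δ p * (p : ℝ) ^ (-s))⁻¹)

theorem tendsto_partialEuler (Δ : ℤ) {s : ℝ} (hs : 1 < s) :
    Tendsto (partialEuler Δ s) atTop (nhds ((∑' n : ℕ, (n : ℝ) ^ (-s)) * oddJacobiL Δ s)) := by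
  have hs0 : s ≠ 0 := by linarith
  have h1 := EulerProduct.eulerProduct_completely_multiplicative (f := natRpowNeg s hs0)
    (by exact (Real.summable_nat_rpow.mpr (by linarith : -s < -1)).norm)
  have h2 := EulerProduct.eulerProduct_completely_multiplicative
    (f := oddJacobi Δ * natRpowNeg s hs0) (by exact summable_oddJacobi hs Δ)
  refine (h1.mul h2).congr fun N => ?_
  rw [← Finset.prod_mul_distrib]
  rfl

theorem half_le_prod_one_sub (N : ℕ) :
    1 / 2 ≤ ∏ p ∈ N.primesBelow, (1 - 1 / (p : ℝ) ^ 2) := by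
  have h1 : ∀ N : ℕ, ∏ n ∈ Finset.Ico 2 (N + 2), (1 - 1 / (n : ℝ) ^ 2) =
      ((N : ℝ) + 2) / (2 * ((N : ℝ) + 1)) := by
    intro N
    induction N with
    | zero => norm_num
    | succ N ih =>
      rw [show N + 1 + 2 = (N + 2) + 1 by ring, Finset.prod_Ico_succ_top (by lia), ih]
      push_cast
      field_simp
      ring
  have h2 : N.primesBelow ⊆ Finset.Ico 2 (N + 2) := fun p hp => by
    have := (Nat.prime_of_mem_primesBelow hp).two_le
    have := Nat.lt_of_mem_primesBelow hp
    rw [Finset.mem_Ico]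
    lia
  have h3 : ∀ n ∈ Finset.Ico 2 (N + 2), 0 ≤ 1 - 1 / (n : ℝ) ^ 2 ∧ 1 - 1 / (n : ℝ) ^ 2 ≤ 1 := by
    intro n hn
    have hn1 : (1 : ℝ) ≤ n := by exact_mod_cast (by grind : 1 ≤ n)
    have : 1 / (n : ℝ) ^ 2 ≤ 1 := by
      rw [div_le_one (by positivity)]
      exact one_le_pow₀ hn1
    have : 0 ≤ 1 / (n : ℝ) ^ 2 := by positivity
    constructor <;> linarith
  have h4 := Finset.prod_le_prod_of_subset_of_le_one h2 (fun n hn => (h3 n hn).1)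
    fun n hn _ => (h3 n hn).2
  refine le_trans ?_ h4
  rw [h1, div_le_div_iff₀ (by norm_num) (by positivity)]
  linarith

theorem euler_factor_split {x y : ℝ} (hy : 0 < y) (hxy : y ≤ x) {z : ℝ} (hxz : x ≤ z)
    (hz : z < 1) :
    ((1 - x)⁻¹ * (1 - x)⁻¹) * (1 - z ^ 2) ^ 2 ≤ (1 + x - y) ^ 2 * ((1 - y)⁻¹ * (1 - y)⁻¹) := by
  have h1 : 0 < 1 - x := by linarith
  have h2 : 0 < 1 - y := by linarith
  have h3 : (1 - x)⁻¹ * (1 - z ^ 2) ≤ (1 + x - y) * (1 - y)⁻¹ := by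
    rw [inv_mul_eq_div, ← div_eq_mul_inv, div_le_div_iff₀ h1 h2]
    have h4 : (1 - z ^ 2) * (1 - y) ≤ (1 - x ^ 2) * (1 - y) := by gcongr; linarith
    nlinarith [mul_nonneg (mul_nonneg hy.le (hy.le.trans hxy)) h1.le]
  have h5 : 0 ≤ (1 - x)⁻¹ * (1 - z ^ 2) :=
    mul_nonneg (inv_nonneg.mpr h1.le) (by nlinarith)
  have h6 := pow_le_pow_left₀ h5 h3 2
  calc _ = ((1 - x)⁻¹ * (1 - z ^ 2)) ^ 2 := by ring
    _ ≤ _ := h6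
    _ = _ := by ring

theorem euler_factor_inert {x y : ℝ} (hy : 0 < y) (hxy : y ≤ x) {z : ℝ} (hxz : x ≤ z)
    (hz : z < 1) :
    ((1 - x)⁻¹ * (1 - -1 * x)⁻¹) * (1 - z ^ 2) ^ 2 ≤ (1 - y)⁻¹ * (1 - -1 * y)⁻¹ := by
  have e : ∀ x : ℝ, (1 - x)⁻¹ * (1 - -1 * x)⁻¹ = (1 - x ^ 2)⁻¹ := by
    intro x
    rw [← mul_inv]
    ring_nf
  have h1 : 0 < 1 - x ^ 2 := by nlinarith
  have h2 : 0 < 1 - y ^ 2 := by nlinarith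
  have h3 : 0 < 1 - z ^ 2 := by nlinarith
  rw [e, e, inv_mul_eq_div, div_le_iff₀ h1]
  have h4 : (1 - z ^ 2) ^ 2 ≤ 1 - x ^ 2 := by nlinarith
  refine h4.trans (le_mul_of_one_le_left h1.le ?_)
  exact (one_le_inv₀ h2).mpr (by nlinarith)

theorem euler_factor_ramified {x y : ℝ} (hy : 0 < y) (hxy : y ≤ x) {z : ℝ} (hxz : x ≤ z)
    (hz : z ≤ 1 / 2) :
    ((1 - x)⁻¹ * (1 - 0 * x)⁻¹) * (1 - z ^ 2) ^ 2 ≤ 2 * ((1 - y)⁻¹ * (1 - 0 * y)⁻¹) := by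
  simp only [zero_mul, sub_zero, inv_one, mul_one]
  have h1 : 0 < 1 - x := by linarith
  have h2 : 0 < 1 - y := by linarith
  have h3 : (1 - x)⁻¹ ≤ 2 := by
    rw [inv_le_comm₀ h1 (by norm_num)]
    linarith
  have h4 : 1 ≤ (1 - y)⁻¹ := (one_le_inv₀ h2).mpr (by linarith)
  have h5 : (1 - z ^ 2) ^ 2 ≤ 1 := pow_le_one₀ (by nlinarith) (by nlinarith)
  calc (1 - x)⁻¹ * (1 - z ^ 2) ^ 2 ≤ 2 * 1 := by gcongr
    _ ≤ _ := by linarith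

theorem two_pow_card_primeFactors_le {n : ℕ} (hn : n ≠ 0) :
    2 ^ n.primeFactors.card ≤ n.divisors.card := by
  rw [Nat.card_divisors hn, ← Finset.prod_const]
  refine Finset.prod_le_prod' fun p hp => ?_
  have := (Nat.prime_of_mem_primeFactors hp).factorization_pos_of_dvd hn
    (Nat.dvd_of_mem_primeFactors hp)
  lia

theorem mem_primeFactors_of_oddJacobi_eq_zero {Δ : ℤ} (hΔ : 0 < Δ) {p : ℕ} (hp : p.Prime)
    (h : oddJacobi Δ p = 0) : p ∈ (2 * Δ.natAbs).primeFactors := by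
  rw [Nat.mem_primeFactors]
  refine ⟨hp, ?_, by lia⟩
  rw [oddJacobi_apply] at h
  split_ifs at h with h2
  · have h3 : jacobiSym (-Δ) p = 0 := by exact_mod_cast h
    rw [jacobiSym.eq_zero_iff] at h3
    have h4 := h3.2
    rw [Int.gcd_comm, Int.gcd_neg, Int.gcd_eq_natAbs] at h4
    simp only [Int.natAbs_natCast] at h4
    exact ((Nat.Prime.coprime_iff_not_dvd hp).not_left.mp h4).mul_left 2
  · rw [Nat.not_odd_iff_even] at h2
    rw [hp.even_iff.mp h2]
    exact dvd_mul_right _ _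

/-- The odd primes below `N` at which `-Δ` is a nonzero square. -/
noncomputable def splitPrimes (Δ : ℤ) (N : ℕ) : Finset ℕ :=
  N.primesBelow.filter fun p => oddJacobi Δ p = 1

theorem mem_splitPrimes {Δ : ℤ} {N p : ℕ} (h : p ∈ splitPrimes Δ N) :
    p.Prime ∧ p ≠ 2 ∧ jacobiSym (-Δ) p = 1 := by
  obtain ⟨h1, h2⟩ := Finset.mem_filter.mp h
  rw [oddJacobi_apply] at h2
  split_ifs at h2 with h3
  · refine ⟨Nat.prime_of_mem_primesBelow h1, ?_, by exact_mod_cast h2⟩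
    rintro rfl
    exact absurd h3 (by decide)
  · norm_num at h2

theorem partialEuler_le {Δ : ℤ} (hΔ : 0 < Δ) {s σ : ℝ} (hs : 1 < s) (hsσ : s ≤ σ) (N : ℕ) :
    partialEuler Δ s N ≤ 4 * ((2 * Δ.natAbs).divisors.card : ℝ) *
      (∏ p ∈ splitPrimes Δ N, (1 + (p : ℝ) ^ (-s) - (p : ℝ) ^ (-σ))) ^ 2 *
      partialEuler Δ σ N := by
  have hfac : ∀ p ∈ N.primesBelow,
      ((1 - (p : ℝ) ^ (-s))⁻¹ * (1 - oddJacobi Δ p * (p : ℝ) ^ (-s))⁻¹) *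
        (1 - (1 / (p : ℝ)) ^ 2) ^ 2 ≤
      (if oddJacobi Δ p = 1 then (1 + (p : ℝ) ^ (-s) - (p : ℝ) ^ (-σ)) ^ 2 else 1) *
      (if oddJacobi Δ p = 0 then 2 else 1) *
      ((1 - (p : ℝ) ^ (-σ))⁻¹ * (1 - oddJacobi Δ p * (p : ℝ) ^ (-σ))⁻¹) ∧
      0 ≤ ((1 - (p : ℝ) ^ (-s))⁻¹ * (1 - oddJacobi Δ p * (p : ℝ) ^ (-s))⁻¹) *
        (1 - (1 / (p : ℝ)) ^ 2) ^ 2 ∧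
      0 ≤ (1 - (p : ℝ) ^ (-σ))⁻¹ * (1 - oddJacobi Δ p * (p : ℝ) ^ (-σ))⁻¹ := by
    intro p hp
    have hp2 : (2 : ℝ) ≤ p := by exact_mod_cast (Nat.prime_of_mem_primesBelow hp).two_le
    have hy : 0 < (p : ℝ) ^ (-σ) := by positivity
    have hxy : (p : ℝ) ^ (-σ) ≤ (p : ℝ) ^ (-s) :=
      Real.rpow_le_rpow_of_exponent_le (by linarith) (by linarith)
    have hxz : (p : ℝ) ^ (-s) ≤ 1 / p := by
      rw [one_div, ← Real.rpow_neg_one]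
      exact Real.rpow_le_rpow_of_exponent_le (by linarith) (by linarith)
    have hz : 1 / (p : ℝ) ≤ 1 / 2 := one_div_le_one_div_of_le (by norm_num) hp2
    set x := (p : ℝ) ^ (-s)
    set y := (p : ℝ) ^ (-σ)
    have hχ := abs_le.mp (abs_oddJacobi_le_one Δ p)
    have h1 : 0 ≤ 1 - x := by linarith
    have h2 : 0 ≤ 1 - y := by linarith
    have h3 : 0 ≤ 1 - oddJacobi Δ p * x := by nlinarith
    have h4 : 0 ≤ 1 - oddJacobi Δ p * y := by nlinarith
    refine ⟨?_, by positivity, by positivity⟩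
    rcases oddJacobi_trichotomy Δ p with h | h | h <;> rw [h]
    · have := euler_factor_ramified hy hxy hxz hz
      norm_num at this ⊢
      exact this
    · have := euler_factor_split hy hxy hxz (by linarith)
      norm_num at this ⊢
      exact this
    · have := euler_factor_inert hy hxy hxz (by linarith)
      norm_num at this ⊢
      exact this
  have hprod : partialEuler Δ s N * (∏ p ∈ N.primesBelow, (1 - (1 / (p : ℝ)) ^ 2)) ^ 2 ≤
      (∏ p ∈ splitPrimes Δ N, (1 + (p : ℝ) ^ (-s) - (p : ℝ) ^ (-σ))) ^ 2 *
      2 ^ (N.primesBelow.filter fun p => oddJacobi Δ p = 0).card * partialEuler Δ σ N := by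
    unfold partialEuler splitPrimes
    rw [← Finset.prod_pow, ← Finset.prod_pow, ← Finset.prod_const (2 : ℝ), Finset.prod_filter,
      Finset.prod_filter, ← Finset.prod_mul_distrib, ← Finset.prod_mul_distrib,
      ← Finset.prod_mul_distrib]
    exact Finset.prod_le_prod (fun p hp => (hfac p hp).2.1) fun p hp => (hfac p hp).1
  have hE : 0 ≤ partialEuler Δ σ N := Finset.prod_nonneg fun p hp => (hfac p hp).2.2
  have hEs : 0 ≤ partialEuler Δ s N := by
    refine Finset.prod_nonneg fun p hp => ?_
    have hp2 : (2 : ℝ) ≤ p := by exact_mod_cast (Nat.prime_of_mem_primesBelow hp).two_le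
    have hz : (1 / (p : ℝ)) ^ 2 < 1 := by
      rw [div_pow, one_pow, div_lt_one (by positivity)]
      nlinarith
    exact nonneg_of_mul_nonneg_left (hfac p hp).2.1 (by
      have : 0 < 1 - (1 / (p : ℝ)) ^ 2 := by linarith
      positivity)
  have hcard : (2 : ℝ) ^ (N.primesBelow.filter fun p => oddJacobi Δ p = 0).card ≤
      ((2 * Δ.natAbs).divisors.card : ℝ) := by
    have h1 : (N.primesBelow.filter fun p => oddJacobi Δ p = 0).card ≤
        (2 * Δ.natAbs).primeFactors.card := Finset.card_le_card fun p hp =>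
      mem_primeFactors_of_oddJacobi_eq_zero hΔ
        (Nat.prime_of_mem_primesBelow (Finset.mem_filter.mp hp).1) (Finset.mem_filter.mp hp).2
    calc (2 : ℝ) ^ _ ≤ 2 ^ (2 * Δ.natAbs).primeFactors.card :=
          pow_le_pow_right₀ (by norm_num) h1
      _ ≤ _ := by exact_mod_cast two_pow_card_primeFactors_le (by lia)
  have hhalf := half_le_prod_one_sub N
  have hquarter : 1 / 4 ≤ (∏ p ∈ N.primesBelow, (1 - (1 / (p : ℝ)) ^ 2)) ^ 2 := by
    simp only [div_pow, one_pow]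
    nlinarith
  have h5 := mul_le_mul_of_nonneg_left hquarter hEs
  have h6 : (∏ p ∈ splitPrimes Δ N, (1 + (p : ℝ) ^ (-s) - (p : ℝ) ^ (-σ))) ^ 2 *
      2 ^ (N.primesBelow.filter fun p => oddJacobi Δ p = 0).card * partialEuler Δ σ N ≤
      (∏ p ∈ splitPrimes Δ N, (1 + (p : ℝ) ^ (-s) - (p : ℝ) ^ (-σ))) ^ 2 *
      ((2 * Δ.natAbs).divisors.card : ℝ) * partialEuler Δ σ N := by
    gcongr
  have h7 := (h5.trans hprod).trans h6
  linarith

theorem zeta_mul_oddJacobiL_le {Δ : ℤ} (hΔ : 0 < Δ) {s σ : ℝ} (hs : 1 < s) (hsσ : s ≤ σ) {B : ℝ}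
    (hB : ∀ S : Finset ℕ, (∀ p ∈ S, p.Prime ∧ p ≠ 2 ∧ jacobiSym (-Δ) p = 1) →
      (∏ p ∈ S, (1 + (p : ℝ) ^ (-s) - (p : ℝ) ^ (-σ))) ^ 2 ≤ B) :
    (∑' n : ℕ, (n : ℝ) ^ (-s)) * oddJacobiL Δ s ≤
      4 * ((2 * Δ.natAbs).divisors.card : ℝ) * B *
        ((∑' n : ℕ, (n : ℝ) ^ (-σ)) * oddJacobiL Δ σ) := by
  refine le_of_tendsto_of_tendsto' (tendsto_partialEuler Δ hs)
    ((tendsto_partialEuler Δ (hs.trans_le hsσ)).const_mul _) fun N => ?_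
  refine (partialEuler_le hΔ hs hsσ N).trans ?_
  have hE : 0 ≤ partialEuler Δ σ N := by
    refine Finset.prod_nonneg fun p hp => ?_
    have hp1 : (1 : ℝ) ≤ p := by exact_mod_cast (Nat.prime_of_mem_primesBelow hp).one_le
    have hx : (p : ℝ) ^ (-σ) ≤ 1 := Real.rpow_le_one_of_one_le_of_nonpos hp1 (by linarith)
    have hx0 : 0 ≤ (p : ℝ) ^ (-σ) := by positivity
    have hχ := abs_le.mp (abs_oddJacobi_le_one Δ p)
    have h1 : 0 ≤ 1 - (p : ℝ) ^ (-σ) := by linarith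
    have h2 : 0 ≤ 1 - oddJacobi Δ p * (p : ℝ) ^ (-σ) := by nlinarith
    positivity
  gcongr
  exact hB _ fun p hp => mem_splitPrimes hp

theorem sum_range_one_div_sqrt_le (m : ℕ) :
    ∑ j ∈ Finset.range m, 1 / √((j : ℝ) + 1) ≤ 2 * √m := by
  induction m with
  | zero => simp
  | succ m ih =>
    rw [Finset.sum_range_succ]
    have h1 : 0 < √((m : ℝ) + 1) := Real.sqrt_pos.mpr (by positivity)
    have h2 : √(m : ℝ) ≤ √((m : ℝ) + 1) := Real.sqrt_le_sqrt (by linarith)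
    have h3 := Real.sq_sqrt (by positivity : (0 : ℝ) ≤ (m : ℝ) + 1)
    have h4 := Real.sq_sqrt (by positivity : (0 : ℝ) ≤ (m : ℝ))
    have h5 : 1 / √((m : ℝ) + 1) ≤ 2 * (√((m : ℝ) + 1) - √m) := by
      rw [div_le_iff₀ h1]
      nlinarith [sq_nonneg (√((m : ℝ) + 1) - √m)]
    push_cast
    linarith

theorem sum_pow_div_sqrt_le {m : ℕ} (hm : 0 < m) {x : ℝ} (hx0 : 0 ≤ x) (hx : x ^ m = 1 / 2)
    (t : Finset ℕ) : ∑ j ∈ t, x ^ j / √((j : ℝ) + 1) ≤ 4 * √m := by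
  have hm' : (1 : ℝ) ≤ m := by exact_mod_cast hm
  have hx1 : x ≤ 1 - 1 / (2 * m) := by
    have h1 : 1 / (2 * (m : ℝ)) ≤ 1 := by
      rw [div_le_one (by positivity)]
      linarith
    have h2 := one_add_mul_le_pow (a := -(1 / (2 * (m : ℝ)))) (by linarith) m
    refine le_of_pow_le_pow_left₀ hm.ne' (by linarith) ?_
    rw [hx, sub_eq_add_neg]
    refine le_trans (le_of_eq ?_) h2
    field_simp
    norm_num
  have hx1' : x < 1 := by
    have : 0 < 1 / (2 * (m : ℝ)) := by positivity
    linarith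
  have hgeom : ∑ j ∈ t, x ^ j ≤ 2 * m := by
    calc ∑ j ∈ t, x ^ j ≤ ∑' j : ℕ, x ^ j :=
          (summable_geometric_of_lt_one hx0 hx1').sum_le_tsum t fun _ _ => by positivity
      _ = (1 - x)⁻¹ := tsum_geometric_of_lt_one hx0 hx1'
      _ ≤ 2 * m := by
          rw [inv_le_comm₀ (by linarith) (by positivity), ← one_div]
          linarith
  have hsm : 0 < √(m : ℝ) := Real.sqrt_pos.mpr (by positivity)
  have hterm : ∀ j ∈ t, x ^ j / √((j : ℝ) + 1) ≤
      x ^ j * (1 / √m) + if j < m then 1 / √((j : ℝ) + 1) else 0 := by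
    intro j _
    have hxj : x ^ j ≤ 1 := pow_le_one₀ hx0 hx1'.le
    split_ifs with h
    · have : x ^ j / √((j : ℝ) + 1) ≤ 1 / √((j : ℝ) + 1) := by gcongr
      have : 0 ≤ x ^ j * (1 / √m) := by positivity
      linarith
    · rw [add_zero, mul_one_div]
      have : (m : ℝ) ≤ j + 1 := by exact_mod_cast (by lia : m ≤ j + 1)
      gcongr
  calc _ ≤ ∑ j ∈ t, (x ^ j * (1 / √m) + if j < m then 1 / √((j : ℝ) + 1) else 0) :=
        Finset.sum_le_sum hterm
    _ = (∑ j ∈ t, x ^ j) * (1 / √m) + ∑ j ∈ t.filter (· < m), 1 / √((j : ℝ) + 1) := by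
        rw [Finset.sum_add_distrib, Finset.sum_mul, Finset.sum_filter]
    _ ≤ 2 * m * (1 / √m) + ∑ j ∈ Finset.range m, 1 / √((j : ℝ) + 1) := by
        gcongr
        intro j hj
        exact Finset.mem_range.mpr (Finset.mem_filter.mp hj).2
    _ ≤ 2 * √m + 2 * √m := by
        refine add_le_add (le_of_eq ?_) (sum_range_one_div_sqrt_le m)
        field_simp
        rw [Real.sq_sqrt (by positivity)]
    _ = _ := by ring

theorem card_le_Bcount {a b c : ℤ} {T : Finset ℕ} {x : ℝ}
    (hT : ∀ n ∈ T, Represents a b c n ∧ (n : ℝ) ≤ x) : T.card ≤ Bcount a b c x := by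
  rw [Bcount, ← Set.ncard_coe_finset]
  refine Set.ncard_le_ncard (fun n hn => ⟨(hT n hn).1.1, (hT n hn).2, (hT n hn).1.2⟩) ?_
  exact (Set.finite_Iic ⌊x⌋₊).subset fun n hn => Nat.le_floor hn.2.1

theorem exists_sum_rpow_le {a b c : ℤ} {C : ℝ} (hC0 : 0 ≤ C)
    (hC : ∀ᶠ x : ℝ in atTop, (Bcount a b c x : ℝ) * √(log x) / x ≤ C) :
    ∃ K : ℝ, 0 ≤ K ∧ ∀ m : ℕ, 0 < m → ∀ A : Finset ℕ, (∀ n ∈ A, Represents a b c n) →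
      ∑ n ∈ A, (n : ℝ) ^ (-(1 + 1 / (m : ℝ))) ≤ K + 10 * C * √m := by
  have h2 : Tendsto (fun j : ℕ => (2 : ℝ) ^ j) atTop atTop :=
    tendsto_pow_atTop_atTop_of_one_lt (by norm_num)
  obtain ⟨J, hJ⟩ := eventually_atTop.mp (h2.eventually hC)
  refine ⟨2 ^ J, by positivity, fun m hm A hA => ?_⟩
  have hm' : (0 : ℝ) < m := by exact_mod_cast hm
  set s : ℝ := 1 + 1 / (m : ℝ) with hs
  have hs1 : 1 ≤ s := by
    rw [hs]
    have : 0 ≤ 1 / (m : ℝ) := by positivity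
    linarith
  set x : ℝ := (2 : ℝ) ^ (-(1 / (m : ℝ))) with hx
  have hx0 : 0 ≤ x := by positivity
  have hxm : x ^ m = 1 / 2 := by
    rw [hx, ← Real.rpow_natCast, ← Real.rpow_mul (by norm_num), neg_mul, one_div_mul_cancel hm'.ne',
      Real.rpow_neg_one, one_div]
  rw [← Finset.sum_filter_add_sum_filter_not A (· < 2 ^ J)]
  refine add_le_add ?_ ?_
  · calc ∑ n ∈ A.filter (· < 2 ^ J), (n : ℝ) ^ (-s) ≤ ∑ n ∈ A.filter (· < 2 ^ J), (1 : ℝ) := by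
          refine Finset.sum_le_sum fun n hn => ?_
          have : 1 ≤ n := (hA n (Finset.mem_filter.mp hn).1).1
          exact Real.rpow_le_one_of_one_le_of_nonpos (by exact_mod_cast this) (by linarith)
      _ ≤ ∑ n ∈ Finset.range (2 ^ J), (1 : ℝ) := by
          gcongr
          intro n hn
          exact Finset.mem_range.mpr (Finset.mem_filter.mp hn).2
      _ = 2 ^ J := by simp
  · set A₂ := A.filter fun n => ¬ n < 2 ^ J with hA₂
    have hA2 : ∀ n ∈ A₂, Represents a b c n ∧ J ≤ Nat.log 2 n := by
      intro n hn
      obtain ⟨h3, h4⟩ := Finset.mem_filter.mp hn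
      exact ⟨hA n h3, Nat.le_log_of_pow_le (by norm_num) (not_lt.mp h4)⟩
    rw [← Finset.sum_fiberwise_of_maps_to (g := Nat.log 2) (t := A₂.image (Nat.log 2))
      fun n hn => Finset.mem_image_of_mem _ hn]
    have hfib : ∀ j ∈ A₂.image (Nat.log 2), ∑ n ∈ A₂.filter (fun n => Nat.log 2 n = j),
        (n : ℝ) ^ (-s) ≤ 5 / 2 * C * (x ^ j / √((j : ℝ) + 1)) := by
      intro j hj
      have hJj : J ≤ j := by
        obtain ⟨n, hn, rfl⟩ := Finset.mem_image.mp hj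
        exact (hA2 n hn).2
      have hcard : ((A₂.filter fun n => Nat.log 2 n = j).card : ℝ) ≤
          Bcount a b c (2 ^ (j + 1)) := by
        refine Nat.cast_le.mpr (card_le_Bcount fun n hn => ?_)
        obtain ⟨h3, h4⟩ := Finset.mem_filter.mp hn
        have h5 := Nat.lt_pow_succ_log_self (by norm_num : 1 < 2) n
        rw [h4] at h5
        exact ⟨(hA2 n h3).1, by exact_mod_cast h5.le⟩
      have hB := hJ (j + 1) (by lia)
      have hsq : 4 / 5 * √((j : ℝ) + 1) ≤ √(log (2 ^ (j + 1))) := by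
        rw [Real.log_pow]
        refine Real.le_sqrt_of_sq_le ?_
        rw [mul_pow, Real.sq_sqrt (by positivity)]
        push_cast
        have := Real.log_two_gt_d9
        nlinarith
      have hj1 : 0 < √((j : ℝ) + 1) := Real.sqrt_pos.mpr (by positivity)
      have hcard2 : ((A₂.filter fun n => Nat.log 2 n = j).card : ℝ) ≤
          5 / 4 * C * 2 ^ (j + 1) / √((j : ℝ) + 1) := by
        rw [div_le_iff₀ (by positivity)] at hB
        rw [le_div_iff₀ hj1]
        have h6 := mul_le_mul hcard hsq (by positivity) (by positivity)
        linarith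
      have hterm : ∀ n ∈ A₂.filter (fun n => Nat.log 2 n = j), (n : ℝ) ^ (-s) ≤
          x ^ j / 2 ^ j := by
        intro n hn
        obtain ⟨h3, h4⟩ := Finset.mem_filter.mp hn
        have h5 : 2 ^ j ≤ n := h4 ▸ Nat.pow_log_le_self 2 (hA2 n h3).1.1.ne'
        have h6 : (2 : ℝ) ^ j ≤ n := by exact_mod_cast h5
        calc (n : ℝ) ^ (-s) ≤ ((2 : ℝ) ^ j) ^ (-s) :=
              Real.rpow_le_rpow_of_nonpos (by positivity) h6 (by linarith)
          _ = ((2 : ℝ) ^ (-s)) ^ j := by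
              rw [← Real.rpow_natCast, ← Real.rpow_natCast, ← Real.rpow_mul (by norm_num),
                ← Real.rpow_mul (by norm_num), mul_comm]
          _ = _ := by
              rw [← div_pow, hx, hs]
              congr 1
              rw [eq_div_iff (by norm_num), ← Real.rpow_add_one (by norm_num)]
              ring_nf
      calc _ ≤ ∑ n ∈ A₂.filter (fun n => Nat.log 2 n = j), x ^ j / 2 ^ j :=
            Finset.sum_le_sum hterm
        _ = (A₂.filter fun n => Nat.log 2 n = j).card * (x ^ j / 2 ^ j) := by simp
        _ ≤ (5 / 4 * C * 2 ^ (j + 1) / √((j : ℝ) + 1)) * (x ^ j / 2 ^ j) := by gcongr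
        _ = _ := by
            field_simp
            ring
    refine (Finset.sum_le_sum hfib).trans ?_
    rw [← Finset.mul_sum]
    have := mul_le_mul_of_nonneg_left (sum_pow_div_sqrt_le hm hx0 hxm (A₂.image (Nat.log 2)))
      (by positivity : 0 ≤ 5 / 2 * C)
    linarith

theorem succ_pow_le_mul_two_pow {k : ℕ} (hk : 0 < k) (v : ℕ) :
    (v + 1) ^ k ≤ k ^ k * 2 ^ v := by
  have h1 : v + 1 ≤ k * 2 ^ (v / k) := by
    have h2 : v < k * (v / k + 1) := Nat.lt_mul_div_succ v hk
    have h3 : v / k + 1 ≤ 2 ^ (v / k) := Nat.lt_two_pow_self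
    exact h2.trans_le (Nat.mul_le_mul_left k h3)
  calc (v + 1) ^ k ≤ (k * 2 ^ (v / k)) ^ k := Nat.pow_le_pow_left h1 k
    _ = k ^ k * 2 ^ (v / k * k) := by rw [mul_pow, ← pow_mul]
    _ ≤ k ^ k * 2 ^ v := by
      gcongr
      · norm_num
      · exact Nat.div_mul_le_self v k

theorem card_divisors_pow_le {k : ℕ} (hk : 0 < k) {n : ℕ} (hn : n ≠ 0) :
    n.divisors.card ^ k ≤ (k ^ k) ^ (2 ^ k) * n := by
  have hkk : 1 ≤ k ^ k := Nat.one_le_pow _ _ hk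
  rw [Nat.card_divisors hn, ← Finset.prod_pow]
  calc ∏ p ∈ n.primeFactors, (n.factorization p + 1) ^ k
      ≤ ∏ p ∈ n.primeFactors, ((if p < 2 ^ k then k ^ k else 1) * p ^ n.factorization p) := by
        refine Finset.prod_le_prod' fun p hp => ?_
        have hp2 : 2 ≤ p := (Nat.prime_of_mem_primeFactors hp).two_le
        split_ifs with h
        · exact (succ_pow_le_mul_two_pow hk _).trans
            (Nat.mul_le_mul_left _ (Nat.pow_le_pow_left hp2 _))
        · rw [one_mul]
          calc (n.factorization p + 1) ^ k ≤ (2 ^ n.factorization p) ^ k :=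
                Nat.pow_le_pow_left Nat.lt_two_pow_self k
            _ = (2 ^ k) ^ n.factorization p := by rw [← pow_mul, ← pow_mul, mul_comm]
            _ ≤ p ^ n.factorization p := Nat.pow_le_pow_left (not_lt.mp h) _
    _ = (∏ p ∈ n.primeFactors, if p < 2 ^ k then k ^ k else 1) * n := by
        rw [Finset.prod_mul_distrib]
        congr 1
        exact Nat.prod_factorization_pow_eq_self hn
    _ ≤ (k ^ k) ^ (2 ^ k) * n := by
        refine Nat.mul_le_mul_right n ?_
        rw [← Finset.prod_filter, Finset.prod_const]
        refine Nat.pow_le_pow_right hkk ?_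
        calc _ ≤ (Finset.range (2 ^ k)).card := Finset.card_le_card fun p hp => by
              simp at hp ⊢; exact hp.2
          _ = _ := Finset.card_range _

theorem tsum_rpow_neg_eq {s : ℝ} (hs : 1 < s) :
    ∑' n : ℕ, (n : ℝ) ^ (-s) = ∑' n : ℕ, 1 / ((n : ℝ) + 1) ^ s := by
  have h1 : Summable fun n : ℕ => (n : ℝ) ^ (-s) := Real.summable_nat_rpow.mpr (by linarith)
  rw [h1.tsum_eq_zero_add]
  rw [Nat.cast_zero, Real.zero_rpow (by linarith), zero_add]
  refine tsum_congr fun n => ?_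
  rw [Real.rpow_neg (by positivity)]
  push_cast
  rw [one_div]

theorem tsum_rpow_neg_le {s : ℝ} (hs : 1 < s) :
    ∑' n : ℕ, (n : ℝ) ^ (-s) ≤ 1 + 1 / (s - 1) := by
  have h1 := ZetaAsymptotics.zeta_limit_aux1 hs
  have h2 : 0 ≤ ZetaAsymptotics.termTSum s :=
    tsum_nonneg fun n => ZetaAsymptotics.term_nonneg _ _
  rw [tsum_rpow_neg_eq hs]
  nlinarith

theorem tendsto_nhdsGT_one_add_one_div :
    Tendsto (fun m : ℕ => 1 + 1 / (m : ℝ)) atTop (nhdsWithin 1 (Set.Ioi 1)) := by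
  refine tendsto_nhdsWithin_iff.mpr ⟨?_, ?_⟩
  · simpa using (tendsto_one_div_atTop_nhds_zero_nat (𝕜 := ℝ)).const_add 1
  · filter_upwards [eventually_gt_atTop 0] with m hm
    have : (0 : ℝ) < m := by exact_mod_cast hm
    simp [this]

theorem tendsto_tsum_rpow_neg_div :
    Tendsto (fun m : ℕ => (∑' n : ℕ, (n : ℝ) ^ (-(1 + 1 / (m : ℝ)))) / m) atTop (nhds 1) := by
  have h := tendsto_sub_mul_tsum_nat_rpow.comp tendsto_nhdsGT_one_add_one_div
  refine h.congr fun m => ?_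
  simp only [Function.comp_apply]
  rw [add_sub_cancel_left, div_mul_eq_mul_div, one_mul]
  congr 1
  refine tsum_congr fun n => ?_
  rw [Real.rpow_neg (Nat.cast_nonneg n), one_div]

theorem tendsto_add_mul_sqrt_sq_div (K c : ℝ) :
    Tendsto (fun m : ℕ => (K + c * √(m : ℝ)) ^ 2 / m) atTop (nhds (c ^ 2)) := by
  have h1 : Tendsto (fun m : ℕ => √(m : ℝ)) atTop atTop :=
    Real.tendsto_sqrt_atTop.comp tendsto_natCast_atTop_atTop
  have h2 : Tendsto (fun m : ℕ => (K / √(m : ℝ) + c) ^ 2) atTop (nhds ((0 + c) ^ 2)) :=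
    ((h1.const_div_atTop K).add_const c).pow 2
  rw [zero_add] at h2
  refine h2.congr' ?_
  filter_upwards [eventually_gt_atTop 0] with m hm
  have h3 : (0 : ℝ) < m := by exact_mod_cast hm
  have h4 := Real.sqrt_pos.mpr h3
  have h5 := Real.sq_sqrt h3.le
  nth_rewrite 3 [← h5]
  rw [← div_pow]
  congr 1
  field_simp

theorem oddJacobiL_le_mul {Δ : ℤ} (hΔ : 0 < Δ) {V : ℕ} (hV : 0 < V) (hΔV : Δ ≤ V ^ 6) {s σ : ℝ}
    (hs : 1 < s) (hsσ : s ≤ σ) (hσ : σ ≤ 1 + 1 / (V : ℝ) ^ 4)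
    (h : 1 / (600 * (V : ℝ) ^ 4) ≤ oddJacobiL Δ s) :
    oddJacobiL Δ σ ≤ (1 + 600 * (10 * log V * (1 + 10 * log V) + 16)) * oddJacobiL Δ s := by
  have hV1 : (1 : ℝ) ≤ V := by exact_mod_cast hV
  have hl : 0 ≤ log (V : ℝ) := Real.log_nonneg hV1
  have h1 := oddJacobiL_le_add hΔ hs hsσ (Y := V ^ 10) (by positivity)
  have h2 : log ((V ^ 10 : ℕ) : ℝ) = 10 * log V := by
    push_cast
    rw [Real.log_pow]
    norm_num
  rw [h2] at h1
  have h3 : 16 * (Δ : ℝ) / ((V ^ 10 : ℕ) : ℝ) ≤ 16 * (1 / (V : ℝ) ^ 4) := by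
    have : (Δ : ℝ) ≤ (V : ℝ) ^ 6 := by exact_mod_cast hΔV
    push_cast
    rw [div_le_iff₀ (by positivity)]
    have h5 : 16 * (1 / (V : ℝ) ^ 4) * (V : ℝ) ^ 10 = 16 * (V : ℝ) ^ 6 := by
      field_simp
    linarith
  have h4 : (σ - s) * (10 * log V) * (1 + 10 * log V) ≤
      1 / (V : ℝ) ^ 4 * (10 * log V) * (1 + 10 * log V) := by
    gcongr
    linarith
  have h6 : 1 / (V : ℝ) ^ 4 ≤ 600 * oddJacobiL Δ s := by
    have : 1 / (600 * (V : ℝ) ^ 4) = 1 / (V : ℝ) ^ 4 / 600 := by field_simp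
    linarith
  have h7 : 0 ≤ 10 * log (V : ℝ) * (1 + 10 * log V) + 16 := by positivity
  nlinarith [mul_le_mul_of_nonneg_right h6 h7]

theorem IsPrimPosForm.sq_le_of_eventually_le {Δ a b c : ℤ} (hΔ : 0 < Δ)
    (h : IsPrimPosForm Δ a b c) {V : ℕ} (hV : 0 < V) (hΔV : Δ ≤ V ^ 6) {C : ℝ} (hC0 : 0 ≤ C)
    (hC : ∀ᶠ x : ℝ in atTop, (Bcount a b c x : ℝ) * √(log x) / x ≤ C) :
    (exp (-3) / (2400000 * (Δ.toNat.divisors.card : ℝ))) ^ 2 ≤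
      1200 * ((2 * Δ.natAbs).divisors.card : ℝ) * (V : ℝ) ^ 4 *
        (1 + 600 * (10 * log V * (1 + 10 * log V) + 16)) * C ^ 2 := by
  have hV1 : (1 : ℝ) ≤ V := by exact_mod_cast hV
  have hl : 0 ≤ log (V : ℝ) := Real.log_nonneg hV1
  have hV4 : (1 : ℝ) ≤ (V : ℝ) ^ 4 := one_le_pow₀ hV1
  set R := 1 + 600 * (10 * log (V : ℝ) * (1 + 10 * log V) + 16) with hR
  have hR0 : 0 < R := by positivity
  set δ := exp (-3) / (2400000 * (Δ.toNat.divisors.card : ℝ)) with hδ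
  have hδ0 : 0 < δ := by
    have : 0 < Δ.toNat.divisors.card := Finset.card_pos.mpr ⟨1, by simp; omega⟩
    positivity
  set d : ℝ := ((2 * Δ.natAbs).divisors.card : ℝ) with hd
  obtain ⟨N, hNdef⟩ : ∃ N : ℕ, N = ⌈exp ((V : ℝ) ^ 4)⌉₊ := ⟨_, rfl⟩
  have hN1 : exp ((V : ℝ) ^ 4) ≤ N := by rw [hNdef]; exact Nat.le_ceil _
  have hNpos : (0 : ℝ) < N := (exp_pos _).trans_le hN1
  have hL : (V : ℝ) ^ 4 ≤ log N := (Real.le_log_iff_exp_le hNpos).mpr hN1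
  have hL2 : log N ≤ (V : ℝ) ^ 4 + 1 := by
    rw [Real.log_le_iff_le_exp hNpos, Real.exp_add]
    have h1 : (N : ℝ) < exp ((V : ℝ) ^ 4) + 1 := by rw [hNdef]; exact Nat.ceil_lt_add_one (exp_pos _).le
    have h2 : 1 ≤ exp ((V : ℝ) ^ 4) := Real.one_le_exp (by positivity)
    have h3 : 2 ≤ exp 1 := by linarith [Real.add_one_le_exp 1]
    nlinarith
  have hΔV' : (Δ : ℝ) ≤ (V : ℝ) ^ 6 := by exact_mod_cast hΔV
  have hNΔ : Δ ≤ N := by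
    have h1 : (V : ℝ) ^ 6 ≤ exp ((V : ℝ) ^ 4) := by
      have h2 := Real.add_one_le_exp ((V : ℝ) ^ 4 / 2)
      have h3 : exp ((V : ℝ) ^ 4) = exp ((V : ℝ) ^ 4 / 2) ^ 2 := by
        rw [← Real.exp_nat_mul]
        congr 1
        push_cast
        ring
      have h5 : ((V : ℝ) ^ 4 / 2 + 1) ^ 2 ≤ exp ((V : ℝ) ^ 4 / 2) ^ 2 :=
        pow_le_pow_left₀ (by positivity) h2 2
      nlinarith [sq_nonneg ((V : ℝ) ^ 4 / 2 - (V : ℝ) ^ 2)]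
    exact_mod_cast hΔV'.trans (h1.trans hN1)
  have hsqrt : √(Δ : ℝ) ≤ log N := by
    refine le_trans ?_ hL
    rw [Real.sqrt_le_left (by positivity), ← pow_mul]
    exact hΔV'.trans (pow_le_pow_right₀ hV1 (by norm_num))
  set σ := 1 + 1 / log (N : ℝ) with hσ
  have hLpos : 0 < log (N : ℝ) := by linarith
  have hσV : σ ≤ 1 + 1 / (V : ℝ) ^ 4 := by
    rw [hσ]; gcongr
  have hσ1 : 1 < σ := by rw [hσ]; linarith [one_div_pos.mpr hLpos]
  have hζσ : ∑' n : ℕ, (n : ℝ) ^ (-σ) ≤ 3 * (V : ℝ) ^ 4 := by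
    refine (tsum_rpow_neg_le hσ1).trans ?_
    rw [hσ, add_sub_cancel_left, one_div_one_div]
    linarith
  obtain ⟨K, hK0, hK⟩ := exists_sum_rpow_le hC0 hC
  have hlim := (tendsto_add_mul_sqrt_sq_div K (10 * C)).const_mul (12 * d * (V : ℝ) ^ 4 * R / δ ^ 2)
  have hle := le_of_tendsto_of_tendsto tendsto_tsum_rpow_neg_div hlim (by
    filter_upwards [eventually_gt_atTop 0, eventually_ge_atTop ⌈log (N : ℝ)⌉₊,
      tendsto_nhdsGT_one_add_one_div.eventually (eventually_le_oddJacobiL hΔ hV hΔV)]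
      with m hm0 hmL hmV
    have hm : (0 : ℝ) < m := by exact_mod_cast hm0
    have hs : 1 < 1 + 1 / (m : ℝ) := by linarith [one_div_pos.mpr hm]
    have hsσ : 1 + 1 / (m : ℝ) ≤ σ := by
      rw [hσ]
      have := Nat.ceil_le.mp hmL
      gcongr
    have hLs : 0 < oddJacobiL Δ (1 + 1 / (m : ℝ)) := lt_of_lt_of_le (by positivity) hmV
    have h1 := zeta_mul_oddJacobiL_le hΔ hs hsσ (B := ((K + 10 * C * √m) / δ) ^ 2) (by
      intro S hS
      obtain ⟨A, hA, hA2⟩ := h.exists_finset_rpow_mul_prod hΔ hNΔ hsqrt hsσ S hS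
      have h2 := hA2.trans (hK m hm0 A hA)
      refine pow_le_pow_left₀ (Finset.prod_nonneg fun p hp => ?_) ?_ 2
      · have hp1 : (1 : ℝ) ≤ p := by exact_mod_cast (hS p hp).1.one_le
        have h3 : (p : ℝ) ^ (-σ) ≤ 1 :=
          Real.rpow_le_one_of_one_le_of_nonpos hp1 (by linarith)
        have h4 : (0 : ℝ) ≤ (p : ℝ) ^ (-(1 + 1 / (m : ℝ))) := by positivity
        linarith
      · rw [le_div_iff₀ hδ0, mul_comm]
        exact h2)
    have h2 : (∑' n : ℕ, (n : ℝ) ^ (-σ)) * oddJacobiL Δ σ ≤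
        3 * (V : ℝ) ^ 4 * (R * oddJacobiL Δ (1 + 1 / (m : ℝ))) := by
      have h3 := oddJacobiL_le_mul hΔ hV hΔV hs hsσ hσV hmV
      have h4 : 0 ≤ ∑' n : ℕ, (n : ℝ) ^ (-σ) := tsum_nonneg fun n => by positivity
      calc _ ≤ (∑' n : ℕ, (n : ℝ) ^ (-σ)) * (R * oddJacobiL Δ (1 + 1 / (m : ℝ))) :=
            mul_le_mul_of_nonneg_left h3 h4
        _ ≤ _ := mul_le_mul_of_nonneg_right hζσ (by positivity)
    have h3 : ∑' n : ℕ, (n : ℝ) ^ (-(1 + 1 / (m : ℝ))) ≤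
        4 * d * ((K + 10 * C * √m) / δ) ^ 2 * (3 * (V : ℝ) ^ 4 * R) := by
      refine le_of_mul_le_mul_right (h1.trans ?_) hLs
      calc _ ≤ 4 * d * ((K + 10 * C * √m) / δ) ^ 2 *
            (3 * (V : ℝ) ^ 4 * (R * oddJacobiL Δ (1 + 1 / (m : ℝ)))) :=
            mul_le_mul_of_nonneg_left h2 (by positivity)
        _ = _ := by ring
    calc _ ≤ 4 * d * ((K + 10 * C * √m) / δ) ^ 2 * (3 * (V : ℝ) ^ 4 * R) / m := by gcongr
      _ = _ := by rw [div_pow]; ring)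
  rw [div_mul_eq_mul_div, le_div_iff₀ (by positivity)] at hle
  linarith

theorem exists_le_pow_six_le {Δ : ℤ} (hΔ : 0 < Δ) :
    ∃ V : ℕ, 0 < V ∧ Δ ≤ (V : ℤ) ^ 6 ∧ (V : ℤ) ^ 6 ≤ 64 * Δ := by
  have hex : ∃ V : ℕ, Δ ≤ (V : ℤ) ^ 6 := by
    refine ⟨Δ.toNat, ?_⟩
    rw [Int.toNat_of_nonneg hΔ.le]
    exact le_self_pow₀ (by omega) (by norm_num)
  classical
  have h1 := Nat.find_spec hex
  have h2 := fun {m} => Nat.find_min hex (m := m)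
  set V := Nat.find hex
  have hV : 0 < V := by
    rcases Nat.eq_zero_or_pos V with h | h
    · rw [h] at h1
      norm_num at h1
      omega
    · exact h
  refine ⟨V, hV, h1, ?_⟩
  obtain ⟨W, hW⟩ : ∃ W, V = W + 1 := ⟨V - 1, by omega⟩
  have h3 := h2 (m := W) (by omega)
  rcases Nat.eq_zero_or_pos W with h | h
  · rw [hW, h]
    norm_num
    omega
  · have h4 : (V : ℤ) ≤ 2 * W := by omega
    calc (V : ℤ) ^ 6 ≤ (2 * W) ^ 6 := by gcongr
      _ = 64 * (W : ℤ) ^ 6 := by ring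
      _ ≤ 64 * Δ := by linarith

theorem exists_forall_lt_of_sq_le_mul_log (K : ℝ) :
    ∃ X : ℕ, ∀ V : ℕ, 0 < V → (V : ℝ) ^ 2 ≤ K * (1 + log V) ^ 20 → V < X := by
  have h1 : (fun x : ℝ => K * log x ^ 20) =o[atTop] (id : ℝ → ℝ) :=
    (isLittleO_pow_log_id_atTop (n := 20)).const_mul_left K
  have h2 := (h1.bound (by norm_num : (0 : ℝ) < 1 / 9)).and (eventually_gt_atTop 0)
  obtain ⟨X, hX⟩ := eventually_atTop.mp h2
  refine ⟨⌈X⌉₊ + 1, fun V hV h => ?_⟩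
  by_contra! hVX
  have hV1 : (1 : ℝ) ≤ V := by exact_mod_cast hV
  have h3 : X ≤ V := (Nat.le_ceil X).trans (by exact_mod_cast (Nat.le_succ _).trans hVX)
  have he : 1 ≤ exp 1 := Real.one_le_exp zero_le_one
  have he3 : exp 1 < 3 := Real.exp_one_lt_d9.trans (by norm_num)
  obtain ⟨h4, h5⟩ := hX (exp 1 * V) (h3.trans (by nlinarith))
  rw [Real.log_mul (exp_pos 1).ne' (by positivity), Real.log_exp, id, Real.norm_eq_abs,
    Real.norm_eq_abs, abs_of_pos h5] at h4
  have h6 := (le_abs_self _).trans h4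
  nlinarith

theorem exists_card_divisors_pow_le {k : ℕ} (hk : 0 < k) :
    ∃ M : ℕ, ∀ n : ℕ, n ≠ 0 → n.divisors.card ^ k ≤ M * n :=
  ⟨_, fun _ hn => card_divisors_pow_le hk hn⟩

theorem IsPrimPosForm.exists_forall_le {r : ℝ} (hr : 0 < r) :
    ∃ X : ℕ, ∀ Δ a b c : ℤ, 0 < Δ → IsPrimPosForm Δ a b c →
      (∀ᶠ x : ℝ in atTop, (Bcount a b c x : ℝ) * √(log x) / x ≤ 2 * r / √(Δ : ℝ)) →
      Δ ≤ (X : ℤ) ^ 6 := by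
  obtain ⟨k, hk⟩ : ∃ k : ℝ, k = 1200 * 256 * 60000 * r ^ 2 * (2400000 / exp (-3)) ^ 2 := ⟨_, rfl⟩
  have hk0 : 0 < k := by rw [hk]; positivity
  obtain ⟨M, hM⟩ : ∃ M : ℕ, ∀ n : ℕ, n ≠ 0 → n.divisors.card ^ 10 ≤ M * n :=
    exists_card_divisors_pow_le (by norm_num)
  obtain ⟨X, hX⟩ := exists_forall_lt_of_sq_le_mul_log (k ^ 10 * ((M : ℝ) * 2) ^ 3)
  refine ⟨X, fun Δ a b c hΔ h hC => ?_⟩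
  obtain ⟨V, hV, hΔV, hVΔ⟩ := exists_le_pow_six_le hΔ
  suffices hlt : V < X by
    refine hΔV.trans ?_
    gcongr
  refine hX V hV ?_
  have hΔ' : (0 : ℝ) < Δ := by exact_mod_cast hΔ
  have hV1 : (1 : ℝ) ≤ V := by exact_mod_cast hV
  have hl : 0 ≤ log (V : ℝ) := Real.log_nonneg hV1
  have hmain := h.sq_le_of_eventually_le hΔ hV hΔV (by positivity) hC
  obtain ⟨d, hd⟩ : ∃ d : ℕ, d = (2 * Δ.natAbs).divisors.card := ⟨_, rfl⟩
  have h2Δ : 2 * Δ.natAbs ≠ 0 := by omega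
  have hd1 : (1 : ℝ) ≤ d := by
    have : 0 < d := by rw [hd]; exact Finset.card_pos.mpr ⟨1, by simp; omega⟩
    exact_mod_cast this
  have hdd : (Δ.toNat.divisors.card : ℝ) ≤ d := by
    rw [hd]
    refine Nat.cast_le.mpr (Finset.card_le_card (Nat.divisors_subset_of_dvd h2Δ ?_))
    rw [show Δ.toNat = Δ.natAbs by omega]
    exact Dvd.intro_left 2 rfl
  have hdp : (0 : ℝ) < Δ.toNat.divisors.card := by
    have : 0 < Δ.toNat.divisors.card := Finset.card_pos.mpr ⟨1, by simp; omega⟩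
    exact_mod_cast this
  have hd10 : (d : ℝ) ^ 10 ≤ M * 2 * (V : ℝ) ^ 6 := by
    have h1 := hM _ h2Δ
    rw [← hd] at h1
    have h2 : (d : ℝ) ^ 10 ≤ M * (2 * (Δ.natAbs : ℝ)) := by exact_mod_cast h1
    have h3 : (Δ.natAbs : ℝ) ≤ (V : ℝ) ^ 6 := by
      have : (Δ.natAbs : ℤ) ≤ (V : ℤ) ^ 6 := by omega
      exact_mod_cast this
    nlinarith [(Nat.cast_nonneg M : (0 : ℝ) ≤ M)]
  have hV6 : (V : ℝ) ^ 6 ≤ 64 * Δ := by exact_mod_cast hVΔ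
  have hCsq : (2 * r / √(Δ : ℝ)) ^ 2 ≤ 256 * r ^ 2 / (V : ℝ) ^ 6 := by
    rw [div_pow, Real.sq_sqrt hΔ'.le, div_le_div_iff₀ hΔ' (by positivity)]
    nlinarith [mul_le_mul_of_nonneg_left hV6 (sq_nonneg r)]
  have hδ : (exp (-3) / (2400000 * (d : ℝ))) ^ 2 ≤
      (exp (-3) / (2400000 * (Δ.toNat.divisors.card : ℝ))) ^ 2 := by
    gcongr
  have hR : 1 + 600 * (10 * log (V : ℝ) * (1 + 10 * log V) + 16) ≤
      60000 * (1 + log (V : ℝ)) ^ 2 := by nlinarith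
  rw [← hd] at hmain
  have hchain : (exp (-3) / (2400000 * (d : ℝ))) ^ 2 ≤ 1200 * (d : ℝ) * (V : ℝ) ^ 4 *
      (60000 * (1 + log (V : ℝ)) ^ 2) * (256 * r ^ 2 / (V : ℝ) ^ 6) := by
    refine hδ.trans (hmain.trans ?_)
    gcongr
  have hV2 : (V : ℝ) ^ 2 ≤ k * (d : ℝ) ^ 3 * (1 + log (V : ℝ)) ^ 2 := by
    have h1 := mul_le_mul_of_nonneg_left hchain
      (by positivity : 0 ≤ (2400000 * (d : ℝ) / exp (-3)) ^ 2 * (V : ℝ) ^ 2)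
    refine le_trans (le_of_eq ?_) (h1.trans (le_of_eq ?_))
    · have := (exp_pos (-3)).ne'
      field_simp
    · rw [hk]
      have := (exp_pos (-3)).ne'
      field_simp
  have h20 : (V : ℝ) ^ 20 ≤ k ^ 10 * ((M : ℝ) * 2) ^ 3 * (V : ℝ) ^ 18 *
      (1 + log (V : ℝ)) ^ 20 := by
    calc (V : ℝ) ^ 20 = ((V : ℝ) ^ 2) ^ 10 := by ring
      _ ≤ (k * (d : ℝ) ^ 3 * (1 + log (V : ℝ)) ^ 2) ^ 10 := by gcongr
      _ = k ^ 10 * ((d : ℝ) ^ 10) ^ 3 * (1 + log (V : ℝ)) ^ 20 := by ring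
      _ ≤ k ^ 10 * (M * 2 * (V : ℝ) ^ 6) ^ 3 * (1 + log (V : ℝ)) ^ 20 := by gcongr
      _ = _ := by ring
  have hV18 : (0 : ℝ) < (V : ℝ) ^ 18 := by positivity
  refine le_of_mul_le_mul_right ?_ hV18
  calc _ = (V : ℝ) ^ 20 := by ring
    _ ≤ _ := h20
    _ = _ := by ring

theorem stmt2 (r : ℝ) :
    {D : ℤ | D < 0 ∧ (D % 4 = 0 ∨ D % 4 = 1) ∧
      ∃ (a b c : ℤ) (C : ℝ), 0 < a ∧ Int.gcd (Int.gcd a b) c = 1 ∧ b ^ 2 - 4 * a * c = D ∧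
        Tendsto (fun x : ℝ => (Bcount a b c x : ℝ) * Real.sqrt (Real.log x) / x)
          atTop (nhds C) ∧
        Real.sqrt |(D : ℝ)| / 2 * C < r}.Finite := by
  have hlimnonneg : ∀ {a b c : ℤ} {C : ℝ}, Tendsto (fun x : ℝ =>
      (Bcount a b c x : ℝ) * Real.sqrt (Real.log x) / x) atTop (nhds C) → 0 ≤ C := fun hlim => by
    refine ge_of_tendsto hlim ?_
    filter_upwards [eventually_ge_atTop 0] with x hx
    positivity
  rcases le_or_gt r 0 with hr | hr
  · refine Set.Finite.subset Set.finite_empty ?_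
    rintro D ⟨-, -, a, b, c, C, -, -, -, hlim, hlt⟩
    have h1 := hlimnonneg hlim
    have h2 : 0 ≤ √|(D : ℝ)| / 2 * C := by positivity
    linarith
  obtain ⟨X, hX⟩ := IsPrimPosForm.exists_forall_le hr
  refine (Set.finite_Icc (-((X : ℤ) ^ 6)) 0).subset ?_
  rintro D ⟨hD, -, a, b, c, C, ha, hgcd, hdisc, hlim, hlt⟩
  have hform : IsPrimPosForm (-D) a b c := by
    have h := isPrimPosForm_of_gcd ha hgcd
    rwa [show 4 * a * c - b ^ 2 = -D by linarith] at h
  have hD' : (0 : ℝ) < ((-D : ℤ) : ℝ) := by exact_mod_cast (by omega : 0 < -D)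
  have habs : |(D : ℝ)| = ((-D : ℤ) : ℝ) := by
    push_cast at hD' ⊢
    exact abs_of_neg (by linarith)
  have hs := Real.sqrt_pos.mpr hD'
  rw [habs] at hlt
  have hC : C < 2 * r / √((-D : ℤ) : ℝ) := by
    rw [lt_div_iff₀ hs]
    linarith
  have h := hX (-D) a b c (by omega) hform
    ((hlim.eventually (gt_mem_nhds hC)).mono fun x hx => le_of_lt hx)
  exact ⟨by linarith, hD.le⟩
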